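/- Under the assumptions of the main theorem (𝒜, ℬ as in the context with Λ_𝒜 spanning, Ω bounded open with 𝓛ⁿ(∂Ω) = 0, ν a Young measure on Ω with λ(∂Ω) = 0 whose barycentre v satisfies 𝒜v = 0 distributionally and which satisfies the a.e. Jensen-type inequalities for 𝒜-quasiconvex integrands of linear growth), the following holds: given ε > 0 there exist t_ε > 0 and, for each t ∈ (0,t_ε], a map φ = φ^{(t)} ∈ C_c^∞(Ω,𝕌) with ‖φ‖_{W^{l−1,1}(Ω,𝕌)} < ε such that | ∫_Ω η Φ(0) dx + ∫_Ω η ⟨Φ^∞, ν_x^∞⟩ dλ^s(x) − ∫_Ω η Φ( (φ_t * (ν̄_·^∞ λ^s))(x) + ℬφ(x) ) dx | < ε holds for all t ∈ (0,t_ε], uniformly over all η : Ω̄ → ℝ and Φ ∈ ℍ with ‖η‖_LIP ≤ 1 and ‖TΦ‖_LIP ≤ 1. Here φ_t * (ν̄_·^∞ λ^s) denotes the mollification at scale t of the singular part ν̄_x^∞ λ^s of the barycentre (extended by zero outside Ω). -/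

import Mathlib

open MeasureTheory Filter Topology
noncomputable section
/-! ## Basic PDE setup -/
abbrev Dom (n : ℕ) := Fin n → ℝ
def unitCube (n : ℕ) : Set (Dom n) := Set.univ.pi fun _ => Set.Ioo (-(1/2) : ℝ) (1/2)
def closedUnitCube (n : ℕ) : Set (Dom n) := Set.univ.pi fun _ => Set.Icc (-(1/2) : ℝ) (1/2)
/-- The finite set of multi-indices of degree `k`. -/
def degSet (n k : ℕ) : Finset (Fin n → ℕ) :=
  (Fintype.piFinset fun _ : Fin n => Finset.range (k+1)).filter fun α => (∑ i, α i) = k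
/-- Partial derivative in the `j`-th coordinate direction. -/
def pderivDir {n : ℕ} {V : Type*} [NormedAddCommGroup V] [NormedSpace ℝ V]
    (j : Fin n) (u : Dom n → V) : Dom n → V :=
  fun x => fderiv ℝ u x (Pi.single j 1)
/-- The multi-index partial derivative `∂^α`. -/
def mderiv {n : ℕ} {V : Type*} [NormedAddCommGroup V] [NormedSpace ℝ V]
    (α : Fin n → ℕ) (u : Dom n → V) : Dom n → V :=
  (List.finRange n).foldr (fun j f => (pderivDir j)^[α j] f) u
/-- The action of a homogeneous `k`-th order constant-coefficient operator with
coefficients `A α` on a function. -/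
def opApply {n : ℕ} {V W : Type*} [NormedAddCommGroup V] [NormedSpace ℝ V]
    [NormedAddCommGroup W] [NormedSpace ℝ W]
    (A : (Fin n → ℕ) → (V →L[ℝ] W)) (k : ℕ) (u : Dom n → V) (x : Dom n) : W :=
  ∑ α ∈ degSet n k, A α (mderiv α u x)
/-- The symbol `𝒜(ξ) = Σ_{|α|=k} ξ^α A_α`. -/
def opSymbol {n : ℕ} {V W : Type*} [NormedAddCommGroup V] [NormedSpace ℝ V]
    [NormedAddCommGroup W] [NormedSpace ℝ W]
    (A : (Fin n → ℕ) → (V →L[ℝ] W)) (k : ℕ) (ξ : Dom n) : V →L[ℝ] W :=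
  ∑ α ∈ degSet n k, (∏ i, ξ i ^ α i) • A α
/-- The wave cone `Λ_𝒜 = ⋃_{ξ ≠ 0} ker 𝒜(ξ)`. -/
def waveCone {n : ℕ} {V W : Type*} [NormedAddCommGroup V] [NormedSpace ℝ V]
    [NormedAddCommGroup W] [NormedSpace ℝ W]
    (A : (Fin n → ℕ) → (V →L[ℝ] W)) (k : ℕ) : Set V :=
  {v | ∃ ξ : Dom n, ξ ≠ 0 ∧ opSymbol A k ξ v = 0}
/-- The wave cone is spanning. -/
def SpanningCone {n : ℕ} {V W : Type*} [NormedAddCommGroup V] [NormedSpace ℝ V]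
    [NormedAddCommGroup W] [NormedSpace ℝ W]
    (A : (Fin n → ℕ) → (V →L[ℝ] W)) (k : ℕ) : Prop :=
  Submodule.span ℝ (waveCone A k) = ⊤
/-- `ℬ` is an exact potential of `𝒜`:  `ker 𝒜(ξ) = im ℬ(ξ)` for all `ξ ≠ 0`. -/
def ExactPotential {n : ℕ} {U V W : Type*} [NormedAddCommGroup V] [NormedSpace ℝ V]
    [NormedAddCommGroup W] [NormedSpace ℝ W] [NormedAddCommGroup U] [NormedSpace ℝ U]
    (A : (Fin n → ℕ) → (V →L[ℝ] W)) (k : ℕ)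
    (B : (Fin n → ℕ) → (U →L[ℝ] V)) (l : ℕ) : Prop :=
  ∀ ξ : Dom n, ξ ≠ 0 → LinearMap.ker (opSymbol A k ξ : V →ₗ[ℝ] W) =
    LinearMap.range (opSymbol B l ξ : U →ₗ[ℝ] V)
/-- `ℤⁿ`-periodicity. -/
def ZPeriodic {n : ℕ} {V : Type*} (v : Dom n → V) : Prop :=
  ∀ (x : Dom n) (m : Fin n → ℤ), v (x + fun i => (m i : ℝ)) = v x
/-- `𝒜`-quasiconvexity of a continuous integrand. -/
def AQuasiconvex {n : ℕ} {V W : Type*} [NormedAddCommGroup V] [NormedSpace ℝ V]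
    [NormedAddCommGroup W] [NormedSpace ℝ W]
    (A : (Fin n → ℕ) → (V →L[ℝ] W)) (k : ℕ) (f : V → ℝ) : Prop :=
  Continuous f ∧ ∀ (z : V) (v : Dom n → V), ContDiff ℝ (⊤ : ℕ∞) v → ZPeriodic v →
    (∫ x in unitCube n, v x) = 0 → (∀ x, opApply A k v x = 0) →
    f z ≤ ∫ x in unitCube n, f (z + v x)
def LinearGrowth {V : Type*} [NormedAddCommGroup V] (f : V → ℝ) : Prop :=
  ∃ c : ℝ, ∀ z, |f z| ≤ c * (1 + ‖z‖)
/-- Upper recession function `f^∞(z) = limsup_{t→∞, z'→z} f(tz')/t`. -/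
def urec {V : Type*} [NormedAddCommGroup V] [NormedSpace ℝ V] (f : V → ℝ) (z : V) : ℝ :=
  limsup (fun p : ℝ × V => f (p.1 • p.2) / p.1) (atTop ×ˢ 𝓝 z)
/-- The radial recession function `z ↦ limsup_{t→∞} f(tz)/t`. -/
def rrec {V : Type*} [NormedAddCommGroup V] [NormedSpace ℝ V] (f : V → ℝ) (z : V) : ℝ :=
  limsup (fun t : ℝ => f (t • z) / t) atTop
/-- `g` is the recession function of `Φ`, the limit being locally uniform. -/
def HasRec {V : Type*} [NormedAddCommGroup V] [NormedSpace ℝ V] (Φ g : V → ℝ) : Prop :=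
  TendstoLocallyUniformly (fun (t : ℝ) (z : V) => Φ (t • z) / t) g atTop
/-- Membership in the class `ℍ`. -/
def MemH {V : Type*} [NormedAddCommGroup V] [NormedSpace ℝ V] (Φ : V → ℝ) : Prop :=
  Continuous Φ ∧ LinearGrowth Φ ∧ ∃ g : V → ℝ, HasRec Φ g
/-- `C_c^∞` functions with support in `Ω`. -/
def CcSmooth {n : ℕ} {U : Type*} [NormedAddCommGroup U] [NormedSpace ℝ U]
    (Ω : Set (Dom n)) (u : Dom n → U) : Prop :=
  ContDiff ℝ (⊤ : ℕ∞) u ∧ HasCompactSupport u ∧ tsupport u ⊆ Ω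
/-- The `W^{l-1,1}` norm : sum of the `L¹` norms of derivatives of order `< l`. -/
def sobNorm {n : ℕ} {U : Type*} [NormedAddCommGroup U] [NormedSpace ℝ U]
    (l : ℕ) (u : Dom n → U) : ℝ :=
  ∑ j ∈ Finset.range l, ∫ x : Dom n, ‖iteratedFDeriv ℝ j u x‖
/-- Membership of a pair `(ν⁰, ν^∞)` in the set `Y(z)` of Young measures generated by
sequences `z + ℬ u_j` with `u_j ∈ C_c^∞(𝕏, 𝕌)` and `‖u_j‖_{W^{l-1,1}} → 0`. -/
def memY {n : ℕ} {U V : Type*} [NormedAddCommGroup V] [InnerProductSpace ℝ V]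
    [FiniteDimensional ℝ V] [MeasurableSpace V] [BorelSpace V]
    [NormedAddCommGroup U] [NormedSpace ℝ U]
    (B : (Fin n → ℕ) → (U →L[ℝ] V)) (l : ℕ) (z : V)
    (nu0 : Measure V) (nuInf : Measure (Metric.sphere (0:V) 1)) : Prop :=
  ∃ u : ℕ → Dom n → U,
    (∀ j, CcSmooth (unitCube n) (u j)) ∧
    Tendsto (fun j => sobNorm l (u j)) atTop (𝓝 0) ∧
    ∀ Φ : V → ℝ, MemH Φ →
      Tendsto (fun j => ∫ x in unitCube n, Φ (z + opApply B l (u j) x)) atTop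
        (𝓝 ((∫ v, Φ v ∂nu0) + ∫ w, rrec Φ (w : V) ∂nuInf))
/-! ## The transform T, Lipschitz test classes, derivative sets, envelopes -/
/-- The transformed integrand on the open unit ball. -/
def transf {V : Type*} [NormedAddCommGroup V] [NormedSpace ℝ V] (Φ : V → ℝ) (zh : V) : ℝ :=
  (1 - ‖zh‖) * Φ ((1 - ‖zh‖)⁻¹ • zh)
/-- The function `TΦ` on the closed unit ball (as a function on `V`). -/
def Tfun {V : Type*} [NormedAddCommGroup V] [NormedSpace ℝ V] (Φ : V → ℝ) (zh : V) : ℝ :=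
  if ‖zh‖ < 1 then transf Φ zh else rrec Φ zh
/-- `‖TΦ‖_LIP ≤ 1` on the closed unit ball. -/
def TLipUnit {V : Type*} [NormedAddCommGroup V] [NormedSpace ℝ V] (Φ : V → ℝ) : Prop :=
  ∃ K : NNReal, LipschitzOnWith K (Tfun Φ) (Metric.closedBall (0:V) 1) ∧
    (⨆ zh ∈ Metric.closedBall (0:V) 1, |Tfun Φ zh|) + (K : ℝ) ≤ 1
/-- `‖η‖_LIP ≤ 1` on `Ω̄` (with the `ℓ^∞` metric on `ℝⁿ`). -/
def etaLipUnit {n : ℕ} (Ω : Set (Dom n)) (η : Dom n → ℝ) : Prop :=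
  ∃ K : NNReal, LipschitzOnWith K η (closure Ω) ∧
    (⨆ x ∈ closure Ω, |η x|) + (K : ℝ) ≤ 1
/-- The set of derivatives `F'(z₀)` of `F` (realized as vectors via the inner product). -/
def derivSet {V : Type*} [NormedAddCommGroup V] [InnerProductSpace ℝ V]
    [FiniteDimensional ℝ V] (F : V → ℝ) : Set V :=
  {ζ : V | ∃ z₀ : V, HasFDerivAt F (InnerProductSpace.toDual ℝ V ζ : V →L[ℝ] ℝ) z₀}
/-- The support function of a set `D ⊂ 𝕍`. -/
def suppFn {V : Type*} [NormedAddCommGroup V] [InnerProductSpace ℝ V]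
    (D : Set V) (w : V) : ℝ :=
  sSup ((fun ζ => (inner ℝ ζ w : ℝ)) '' D)
/-- The `𝒜`-quasiconvex envelope, with values in `[-∞, ∞)` (realized in `EReal`). -/
def qcEnv {n : ℕ} {V W : Type*} [NormedAddCommGroup V] [InnerProductSpace ℝ V]
    [FiniteDimensional ℝ V] [NormedAddCommGroup W] [NormedSpace ℝ W]
    (A : (Fin n → ℕ) → (V →L[ℝ] W)) (k : ℕ) (Φ : V → ℝ) (ξ : V) : EReal :=
  sInf {r : EReal | ∃ v : Dom n → V, ContDiff ℝ (⊤ : ℕ∞) v ∧ ZPeriodic v ∧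
    (∫ x in unitCube n, v x) = 0 ∧ (∀ x, opApply A k v x = 0) ∧
    r = ((∫ x in unitCube n, Φ (ξ + v x) : ℝ) : EReal)}
/-- A standard mollifier: smooth, nonnegative, supported in the closed unit cube,
positive on the open unit cube, with integral one. -/
def IsStdMollifier (n : ℕ) (ρ : Dom n → ℝ) : Prop :=
  ContDiff ℝ (⊤ : ℕ∞) ρ ∧ (∀ x, 0 ≤ ρ x) ∧ tsupport ρ ⊆ closedUnitCube n ∧
    (∀ x ∈ unitCube n, 0 < ρ x) ∧ (∫ x : Dom n, ρ x) = 1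
/-- A mollifier (no interior positivity required). -/
def IsMollifier (n : ℕ) (ρ : Dom n → ℝ) : Prop :=
  ContDiff ℝ (⊤ : ℕ∞) ρ ∧ (∀ x, 0 ≤ ρ x) ∧ tsupport ρ ⊆ closedUnitCube n ∧
    (∫ x : Dom n, ρ x) = 1
/-- The rescaled mollifier kernel `φ_t(x) = t^{-n} φ(x/t)`. -/
def mollK {n : ℕ} (ρ : Dom n → ℝ) (t : ℝ) (x : Dom n) : ℝ := ((t : ℝ) ^ n)⁻¹ * ρ (t⁻¹ • x)
/-! ## Young measures -/
/-- A (generalized) Young measure `ν = ((ν_x), λ, (ν_x^∞))` on `Ω`. -/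
structure YoungMeasure (n : ℕ) (V : Type*) [NormedAddCommGroup V] [InnerProductSpace ℝ V]
    [FiniteDimensional ℝ V] [MeasurableSpace V] [BorelSpace V] (Ω : Set (Dom n)) where
  /-- the oscillation measures `(ν_x)` -/
  osc : Dom n → Measure V
  /-- the concentration measure `λ` -/
  conc : Measure (Dom n)
  /-- the concentration-angle measures `(ν_x^∞)` -/
  ang : Dom n → Measure (Metric.sphere (0:V) 1)
  osc_meas : Measurable osc
  osc_prob : ∀ᵐ x ∂(volume.restrict Ω), IsProbabilityMeasure (osc x)
  moment : (∫⁻ x in Ω, ∫⁻ z, ‖z‖₊ ∂(osc x)) < ⊤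
  conc_finite : IsFiniteMeasure conc
  conc_carrier : conc (closure Ω)ᶜ = 0
  ang_meas : Measurable ang
  ang_prob : ∀ᵐ x ∂conc, IsProbabilityMeasure (ang x)
namespace YoungMeasure
variable {n : ℕ} {V : Type*} [NormedAddCommGroup V] [InnerProductSpace ℝ V]
  [FiniteDimensional ℝ V] [MeasurableSpace V] [BorelSpace V] {Ω : Set (Dom n)}
/-- The barycentre `ν̄_x` of the oscillation measure. -/
def barOsc (Y : YoungMeasure n V Ω) (x : Dom n) : V := ∫ z, z ∂(Y.osc x)
/-- The barycentre `ν̄_x^∞` of the concentration-angle measure. -/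
def barAng (Y : YoungMeasure n V Ω) (x : Dom n) : V := ∫ w, (w : V) ∂(Y.ang x)
/-- The density `λ^a` of the absolutely continuous part of `λ`. -/
def lamA (Y : YoungMeasure n V Ω) (x : Dom n) : ℝ := (Y.conc.rnDeriv volume x).toReal
/-- The singular part `λ^s` of `λ`. -/
def lamS (Y : YoungMeasure n V Ω) : Measure (Dom n) := Y.conc.singularPart volume
/-- The density `ν̄_x + λ^a(x) ν̄_x^∞` of the absolutely continuous part of the barycentre. -/
def baryAC (Y : YoungMeasure n V Ω) (x : Dom n) : V := Y.barOsc x + Y.lamA x • Y.barAng x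
/-- The mollification at scale `t` of the absolutely continuous part of the barycentre
(extended by zero outside `Ω`). -/
def mollACpart (Y : YoungMeasure n V Ω) (ρ : Dom n → ℝ) (t : ℝ) (x : Dom n) : V :=
  ∫ y in Ω, mollK ρ t (x - y) • Y.baryAC y
/-- The mollification at scale `t` of the singular part `ν̄^∞ λ^s` of the barycentre. -/
def mollSingPart (Y : YoungMeasure n V Ω) (ρ : Dom n → ℝ) (t : ℝ) (x : Dom n) : V :=
  ∫ y, mollK ρ t (x - y) • Y.barAng y ∂Y.lamS
/-- The mollification at scale `t` of the barycentre `v` of `Y`. -/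
def mollBary (Y : YoungMeasure n V Ω) (ρ : Dom n → ℝ) (t : ℝ) (x : Dom n) : V :=
  Y.mollACpart ρ t x + Y.mollSingPart ρ t x
/-- The formal adjoint `𝒜^*` applied to a test function. -/
def adjOp {W : Type*} [NormedAddCommGroup W] [InnerProductSpace ℝ W] [FiniteDimensional ℝ W]
    (A : (Fin n → ℕ) → (V →L[ℝ] W)) (k : ℕ) (φ : Dom n → W) (x : Dom n) : V :=
  ∑ α ∈ degSet n k, (ContinuousLinearMap.adjoint (A α)) (mderiv α φ x)
/-- `𝒜 v = 0` in the sense of distributions on `Ω`, where `v` is the barycentre of `Y`. -/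
def AFree {W : Type*} [NormedAddCommGroup W] [InnerProductSpace ℝ W] [FiniteDimensional ℝ W]
    (A : (Fin n → ℕ) → (V →L[ℝ] W)) (k : ℕ) (Y : YoungMeasure n V Ω) : Prop :=
  ∀ φ : Dom n → W, ContDiff ℝ (⊤ : ℕ∞) φ → HasCompactSupport φ → tsupport φ ⊆ Ω →
    (∫ x in Ω, (inner ℝ (adjOp A k φ x) (Y.baryAC x) : ℝ)) +
      (∫ x, (inner ℝ (adjOp A k φ x) (Y.barAng x) : ℝ) ∂Y.lamS) = 0
/-- The a.e. Jensen-type inequalities for `𝒜`-quasiconvex integrands of linear growth. -/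
def JensenAE {W : Type*} [NormedAddCommGroup W] [NormedSpace ℝ W]
    (A : (Fin n → ℕ) → (V →L[ℝ] W)) (k : ℕ) (Y : YoungMeasure n V Ω) : Prop :=
  ∀ f : V → ℝ, AQuasiconvex A k f → LinearGrowth f →
    ∀ᵐ x ∂(volume.restrict Ω),
      f (Y.baryAC x) ≤ (∫ z, f z ∂(Y.osc x)) + Y.lamA x * ∫ w, urec f (w : V) ∂(Y.ang x)
end YoungMeasure
/-- The recession function in the second variable of a non-autonomous integrand. -/
def urecx {n : ℕ} {V : Type*} [NormedAddCommGroup V] [NormedSpace ℝ V]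
    (Φ : Dom n → V → ℝ) (x : Dom n) (z : V) : ℝ :=
  limsup (fun t : ℝ => Φ x (t • z) / t) atTop
/-- Membership in the class `𝔼(Ω, 𝕍)` of non-autonomous integrands. -/
def MemE {n : ℕ} {V : Type*} [NormedAddCommGroup V] [NormedSpace ℝ V]
    (Ω : Set (Dom n)) (Φ : Dom n → V → ℝ) : Prop :=
  Continuous (fun p : Dom n × V => Φ p.1 p.2) ∧
  (∃ c, ∀ x ∈ closure Ω, ∀ z, |Φ x z| ≤ c * (1 + ‖z‖)) ∧
  ∃ g : Dom n → V → ℝ,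
    TendstoUniformlyOn (fun (t : ℝ) (p : Dom n × V) => Φ p.1 (t • p.2) / t)
      (fun p => g p.1 p.2) atTop ((closure Ω) ×ˢ {z : V | ‖z‖ = 1})
/-- A sequence `(w_j 𝓛ⁿ⌞Ω)` of absolutely continuous measures generates the Young measure `Y`. -/
def GeneratesYM {n : ℕ} {V : Type*} [NormedAddCommGroup V] [InnerProductSpace ℝ V]
    [FiniteDimensional ℝ V] [MeasurableSpace V] [BorelSpace V] {Ω : Set (Dom n)}
    (w : ℕ → Dom n → V) (Y : YoungMeasure n V Ω) : Prop :=
  ∀ Φ : Dom n → V → ℝ, MemE Ω Φ →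
    Tendsto (fun j => ∫ x in Ω, Φ x (w j x)) atTop
      (𝓝 ((∫ x in Ω, ∫ z, Φ x z ∂(Y.osc x)) +
        ∫ x, (∫ ζ, urecx Φ x (ζ : V) ∂(Y.ang x)) ∂Y.conc))
section
abbrev Sm {n : ℕ} {E : Type*} [NormedAddCommGroup E] [NormedSpace ℝ E] (u : Dom n → E) : Prop :=
  ContDiff ℝ (⊤ : ℕ∞) u
section calcl
variable {n : ℕ} {E F : Type*} [NormedAddCommGroup E] [NormedSpace ℝ E]
  [NormedAddCommGroup F] [NormedSpace ℝ F]
def wd : List (Fin n) → (Dom n → E) → Dom n → E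
  | [], u => u
  | j :: w, u => pderivDir j (wd w u)
lemma Sm.diff {u : Dom n → E} (hu : Sm u) : Differentiable ℝ u :=
  hu.differentiable (by simp)
lemma Sm.pd {u : Dom n → E} (hu : Sm u) (j : Fin n) : Sm (pderivDir j u) := by
  have h : ContDiff ℝ (⊤ : ℕ∞) (fderiv ℝ u) := hu.fderiv_right (by simp)
  exact h.clm_apply contDiff_const
lemma Sm.wd {u : Dom n → E} (hu : Sm u) (w : List (Fin n)) : Sm (wd w u) := by
  induction w with
  | nil => exact hu
  | cons j w ih => exact ih.pd j
lemma wd_append (w w' : List (Fin n)) (u : Dom n → E) : wd (w ++ w') u = wd w (wd w' u) := by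
  induction w with
  | nil => rfl
  | cons j w ih => simp [wd, ih]
def word (α : Fin n → ℕ) : List (Fin n) := (List.finRange n).flatMap fun j => List.replicate (α j) j
lemma wd_replicate (j : Fin n) (a : ℕ) (u : Dom n → E) :
    wd (List.replicate a j) u = (pderivDir j)^[a] u := by
  induction a with
  | zero => rfl
  | succ a ih => rw [Function.iterate_succ_apply', ← ih]; rfl
lemma mderiv_eq_wd (α : Fin n → ℕ) (u : Dom n → E) : mderiv α u = wd (word α) u := by
  unfold mderiv word
  induction (List.finRange n) with
  | nil => rfl
  | cons j L ih => rw [List.foldr_cons, ih, List.flatMap_cons, wd_append, wd_replicate]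
lemma word_prod (α : Fin n → ℕ) (ξ : Dom n) : ((word α).map ξ).prod = ∏ i, ξ i ^ α i := by
  unfold word
  rw [← List.prod_ofFn, List.ofFn_eq_map]
  induction (List.finRange n) with
  | nil => rfl
  | cons j L ih => simp [List.flatMap_cons, ih]
lemma word_length (α : Fin n → ℕ) : (word α).length = ∑ i, α i := by
  unfold word
  rw [← List.sum_ofFn, List.ofFn_eq_map]
  induction (List.finRange n) with
  | nil => rfl
  | cons j L ih => simp [List.flatMap_cons]
lemma word_len {k : ℕ} {α : Fin n → ℕ} (h : α ∈ degSet n k) : (word α).length = k := by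
  rw [word_length]; simp only [degSet, Finset.mem_filter] at h; exact h.2
lemma wd_clm (L : E →L[ℝ] F) {u : Dom n → E} (hu : Sm u) (w : List (Fin n)) :
    wd w (fun x => L (u x)) = fun x => L (wd w u x) := by
  induction w with
  | nil => rfl
  | cons j w ih =>
    funext x
    simp only [wd, pderivDir, ih]
    have := L.hasFDerivAt.comp x ((hu.wd w).diff x).hasFDerivAt
    have h2 := this.fderiv
    change fderiv ℝ (L ∘ wd w u) x _ = _
    rw [h2]; rfl
lemma wd_smul_vec {f : Dom n → ℝ} (hf : Sm f) (v : E) (w : List (Fin n)) :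
    wd w (fun x => f x • v) = fun x => wd w f x • v := by
  exact wd_clm ((ContinuousLinearMap.id ℝ ℝ).smulRight v) hf w
lemma wd_const_smul {u : Dom n → E} (hu : Sm u) (c : ℝ) (w : List (Fin n)) :
    wd w (fun x => c • u x) = fun x => c • wd w u x :=
  wd_clm (c • ContinuousLinearMap.id ℝ E) hu w
lemma wd_add {u v : Dom n → E} (hu : Sm u) (hv : Sm v) (w : List (Fin n)) :
    wd w (fun x => u x + v x) = fun x => wd w u x + wd w v x := by
  induction w with
  | nil => rfl
  | cons j w ih =>
    funext x
    simp only [wd, pderivDir, ih]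
    rw [fderiv_fun_add ((hu.wd w).diff x) ((hv.wd w).diff x)]; rfl
lemma wd_sum {ι : Type*} (s : Finset ι) {u : ι → Dom n → E} (hu : ∀ i ∈ s, Sm (u i))
    (w : List (Fin n)) : wd w (fun x => ∑ i ∈ s, u i x) = fun x => ∑ i ∈ s, wd w (u i) x := by
  induction w with
  | nil => rfl
  | cons j w ih =>
    funext x
    simp only [wd, pderivDir, ih]
    rw [fderiv_fun_sum (fun i hi => ((hu i hi).wd w).diff x)]
    simp
lemma wd_eventuallyEq {u v : Dom n → E} {x : Dom n} (h : u =ᶠ[𝓝 x] v) (w : List (Fin n)) :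
    wd w u =ᶠ[𝓝 x] wd w v := by
  induction w with
  | nil => exact h
  | cons j w ih =>
    have := ih.fderiv (𝕜 := ℝ)
    filter_upwards [this] with y hy
    simp [wd, pderivDir, hy]
lemma wd_zero (w : List (Fin n)) : wd w (fun _ => (0:E)) = fun _ => (0:E) := by
  induction w with
  | nil => rfl
  | cons j w ih => simp only [wd, ih]; funext x; simp [pderivDir]
lemma wd_tsupport (u : Dom n → E) (w : List (Fin n)) : tsupport (wd w u) ⊆ tsupport u := by
  apply closure_minimal _ (isClosed_tsupport u)
  intro x hx
  by_contra h
  have h1 : u =ᶠ[𝓝 x] fun _ => 0 := notMem_tsupport_iff_eventuallyEq.1 h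
  have := (wd_eventuallyEq h1 w).eq_of_nhds
  rw [wd_zero] at this
  exact hx this
lemma wd_affine {u : Dom n → E} (hu : Sm u) (c : ℝ) (a : Dom n) (w : List (Fin n)) :
    wd w (fun x => u (c • (x - a))) = fun x => c ^ w.length • wd w u (c • (x - a)) := by
  induction w with
  | nil => simp [wd]
  | cons j w ih =>
    funext x
    simp only [wd, pderivDir, ih]
    have h1 : HasFDerivAt (fun x : Dom n => c • (x - a)) (c • ContinuousLinearMap.id ℝ (Dom n)) x :=
      ((hasFDerivAt_id x).sub_const a).const_smul c
    have h2 := (((hu.wd w).diff (c • (x - a))).hasFDerivAt.comp x h1).const_smul (c ^ w.length)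
    have h3 : fderiv ℝ (fun x => c ^ w.length • wd w u (c • (x - a))) x = _ := h2.fderiv
    rw [h3]
    simp [pow_succ, smul_smul]
lemma Sm.affine {u : Dom n → E} (hu : Sm u) (c : ℝ) (a : Dom n) : Sm (fun x => u (c • (x - a))) :=
  hu.comp ((contDiff_id.sub contDiff_const).const_smul c)
/-- plane waves -/
lemma wd_wave {g : ℝ → ℝ} (hg : ContDiff ℝ (⊤ : ℕ∞) g) (a : Dom n) (τ : ℝ) (w : List (Fin n)) :
    wd w (fun x => g ((∑ i, a i * x i) + τ)) =
      fun x => (w.map a).prod * iteratedDeriv w.length g ((∑ i, a i * x i) + τ) := by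
  induction w with
  | nil => simp [wd]
  | cons j w ih =>
    funext x
    simp only [wd, pderivDir, ih]
    have h1 : HasFDerivAt (fun x : Dom n => (∑ i, a i * x i) + τ)
        (∑ i, a i • ContinuousLinearMap.proj (R := ℝ) (φ := fun _ : Fin n => ℝ) i) x := by
      apply HasFDerivAt.add_const
      apply HasFDerivAt.fun_sum
      intro i _
      exact ((ContinuousLinearMap.proj (R := ℝ) (φ := fun _ : Fin n => ℝ) i).hasFDerivAt).const_mul _
    have hd : Differentiable ℝ (iteratedDeriv w.length g) :=
      hg.differentiable_iteratedDeriv _ (by exact_mod_cast WithTop.coe_lt_top _)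
    have h2 := ((hd ((∑ i, a i * x i) + τ)).hasDerivAt.comp_hasFDerivAt x h1).const_mul (w.map a).prod
    have h3 : fderiv ℝ (fun x => (w.map a).prod * iteratedDeriv w.length g ((∑ i, a i * x i) + τ)) x = _ := h2.fderiv
    rw [h3]
    simp [iteratedDeriv_succ, Pi.single_apply]
    ring
/-- boundedness of compactly supported smooth derivatives -/
lemma wd_bdd {u : Dom n → E} (hu : Sm u) (hc : HasCompactSupport u) (w : List (Fin n)) :
    ∃ C, 0 ≤ C ∧ ∀ x, ‖wd w u x‖ ≤ C := by
  have h1 : HasCompactSupport (wd w u) := hc.of_isClosed_subset (isClosed_tsupport _) (wd_tsupport u w)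
  obtain ⟨C, hC⟩ := h1.exists_bound_of_continuous (hu.wd w).continuous
  exact ⟨C, (norm_nonneg _).trans (hC 0), hC⟩
lemma pd_mul {χ W : Dom n → ℝ} (hχ : Sm χ) (hW : Sm W) (j : Fin n) (x : Dom n) :
    pderivDir j (fun x => χ x * W x) x = χ x * pderivDir j W x + pderivDir j χ x * W x := by
  unfold pderivDir
  rw [fderiv_fun_mul (hχ.diff x) (hW.diff x)]
  simp [mul_comm]
lemma wd_concat (w : List (Fin n)) (j : Fin n) (u : Dom n → E) :
    wd (w ++ [j]) u = wd w (pderivDir j u) := by rw [wd_append]; rfl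
lemma leibniz (w : List (Fin n)) : ∀ (χ : Dom n → ℝ), Sm χ → HasCompactSupport χ →
    ∃ C, 0 ≤ C ∧ ∀ (W : Dom n → ℝ) (M : ℝ), Sm W →
      (∀ w' : List (Fin n), w'.length < w.length → ∀ x, |wd w' W x| ≤ M) →
      ∀ x, |wd w (fun x => χ x * W x) x - χ x * wd w W x| ≤ C * M := by
  induction w using List.reverseRecOn with
  | nil => intro χ _ _; exact ⟨0, le_rfl, fun W M _ _ x => by simp [wd]⟩
  | append_singleton w j ih =>
    intro χ hχ hc
    obtain ⟨C1, hC1, h1⟩ := ih χ hχ hc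
    have hc' : HasCompactSupport (pderivDir j χ) :=
      hc.of_isClosed_subset (isClosed_tsupport _) (wd_tsupport χ [j])
    obtain ⟨C2, hC2, h2⟩ := ih _ (hχ.pd j) hc'
    obtain ⟨C3, hC3, h3⟩ := wd_bdd (hχ.pd j) hc' []
    refine ⟨C1 + C2 + C3, by positivity, fun W M hW hM x => ?_⟩
    have hM0 : 0 ≤ M := (abs_nonneg _).trans (hM [] (by simp) x)
    rw [wd_concat, wd_concat]
    have e1 : pderivDir j (fun x => χ x * W x) =
      fun x => χ x * pderivDir j W x + pderivDir j χ x * W x := funext (pd_mul hχ hW j)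
    rw [e1, wd_add (hχ.mul (hW.pd j)) ((hχ.pd j).mul hW)]
    have a1 := h1 _ M (hW.pd j) (fun w' hw' x => by
      have := hM (w' ++ [j]) (by simpa using hw') x
      rwa [wd_concat] at this) x
    have a2 := h2 W M hW (fun w' hw' x => hM w' (by simp; omega) x) x
    have a3 : |pderivDir j χ x * wd w W x| ≤ C3 * M := by
      rw [abs_mul]
      exact mul_le_mul (h3 x) (hM w (by simp) x) (abs_nonneg _) hC3
    rw [abs_le] at *
    constructor <;> nlinarith
/-- convolution with a finite measure -/
lemma conv_hasFDeriv {k : Dom n → ℝ} (hk : Sm k) {C1 : ℝ} {C0 : ℝ} (h0 : ∀ x, ‖k x‖ ≤ C0)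
    (h1 : ∀ x, ‖fderiv ℝ k x‖ ≤ C1)
    (s : Measure (Dom n)) [IsFiniteMeasure s] (x : Dom n) :
    HasFDerivAt (fun x => ∫ y, k (x - y) ∂s) (∫ y, fderiv ℝ k (x - y) ∂s) x := by
  have hkc := hk.continuous
  have hkc' : Continuous (fderiv ℝ k) := hk.continuous_fderiv (by simp)
  apply hasFDerivAt_integral_of_dominated_of_fderiv_le (bound := fun _ => C1) (s := Set.univ)
    (F := fun x y => k (x - y)) (F' := fun x y => fderiv ℝ k (x - y)) Filter.univ_mem
  · exact Eventually.of_forall fun x => (hkc.comp (continuous_const.sub continuous_id)).aestronglyMeasurable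
  · exact Integrable.mono' (integrable_const C0) (hkc.comp (continuous_const.sub continuous_id)).aestronglyMeasurable
      (Eventually.of_forall fun y => h0 _)
  · exact (hkc'.comp (continuous_const.sub continuous_id)).aestronglyMeasurable
  · exact Eventually.of_forall fun y x _ => h1 _
  · exact integrable_const _
  · refine Eventually.of_forall fun y x _ => ?_
    have := ((hk.diff (x - y)).hasFDerivAt).comp x ((hasFDerivAt_id x).sub_const y)
    simp only [ContinuousLinearMap.comp_id] at this
    exact this
def BddDer (k : Dom n → ℝ) : Prop := Sm k ∧ ∀ w : List (Fin n), ∃ C, ∀ x, |wd w k x| ≤ C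
lemma BddDer.pd {k : Dom n → ℝ} (hk : BddDer k) (j : Fin n) : BddDer (pderivDir j k) :=
  ⟨hk.1.pd j, fun w => by
    obtain ⟨C, hC⟩ := hk.2 (w ++ [j]); exact ⟨C, by simpa [wd_concat] using hC⟩⟩
lemma BddDer.wd {k : Dom n → ℝ} (hk : BddDer k) (w : List (Fin n)) : BddDer (wd w k) := by
  induction w with
  | nil => exact hk
  | cons j w ih => exact ih.pd j
lemma clm_eq_sum (L : Dom n →L[ℝ] E) :
    L = ∑ j, (ContinuousLinearMap.proj (R := ℝ) (φ := fun _ : Fin n => ℝ) j).smulRight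
      (L (Pi.single j 1)) := by
  ext x
  rw [_root_.sum_apply]
  simp only [ContinuousLinearMap.smulRight_apply, ContinuousLinearMap.proj_apply]
  conv_lhs => rw [pi_eq_sum_univ' x, map_sum]
  refine Finset.sum_congr rfl fun j _ => ?_
  rw [map_smul]
lemma clm_norm_le (L : Dom n →L[ℝ] E) : ‖L‖ ≤ ∑ j, ‖L (Pi.single j 1)‖ := by
  apply L.opNorm_le_bound (by positivity)
  intro x
  conv_lhs => rw [clm_eq_sum L]
  simp only [_root_.sum_apply, ContinuousLinearMap.smulRight_apply, ContinuousLinearMap.proj_apply]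
  refine (norm_sum_le _ _).trans ?_
  rw [Finset.sum_mul]
  refine Finset.sum_le_sum fun j _ => ?_
  rw [norm_smul, mul_comm]
  exact mul_le_mul_of_nonneg_left (norm_le_pi_norm x j) (norm_nonneg _)
def convm (k : Dom n → ℝ) (s : Measure (Dom n)) (x : Dom n) : ℝ := ∫ y, k (x - y) ∂s
lemma BddDer.fd {k : Dom n → ℝ} (hk : BddDer k) : ∃ C, ∀ x, ‖fderiv ℝ k x‖ ≤ C := by
  choose C hC using fun j : Fin n => hk.2 [j]
  refine ⟨∑ j, C j, fun x => (clm_norm_le _).trans (Finset.sum_le_sum fun j _ => hC j x)⟩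
lemma convm_fderiv {k : Dom n → ℝ} (hk : BddDer k) (s : Measure (Dom n)) [IsFiniteMeasure s]
    (x : Dom n) : HasFDerivAt (convm k s) (∫ y, fderiv ℝ k (x - y) ∂s) x := by
  obtain ⟨C0, h0⟩ := hk.2 []
  obtain ⟨C1, h1⟩ := hk.fd
  exact conv_hasFDeriv hk.1 h0 h1 s x
lemma convm_pd {k : Dom n → ℝ} (hk : BddDer k) (s : Measure (Dom n)) [IsFiniteMeasure s]
    (j : Fin n) : pderivDir j (convm k s) = convm (pderivDir j k) s := by
  funext x
  obtain ⟨C1, h1⟩ := hk.fd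
  unfold pderivDir
  rw [(convm_fderiv hk s x).fderiv, ContinuousLinearMap.integral_apply]
  · rfl
  · have hkc' : Continuous (fderiv ℝ k) := hk.1.continuous_fderiv (by simp)
    exact Integrable.mono' (integrable_const C1) (hkc'.comp (continuous_const.sub continuous_id)).aestronglyMeasurable
      (Eventually.of_forall fun y => h1 _)
lemma convm_smooth_nat (N : ℕ) : ∀ {k : Dom n → ℝ} (_ : BddDer k) (s : Measure (Dom n)) [IsFiniteMeasure s],
    ContDiff ℝ N (convm k s) := by
  induction N with
  | zero =>
    intro k hk s _
    exact_mod_cast contDiff_zero.2 (continuous_iff_continuousAt.2 fun x => (convm_fderiv hk s x).continuousAt)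
  | succ N ih =>
    intro k hk s _
    push_cast
    rw [contDiff_succ_iff_fderiv]
    refine ⟨fun x => (convm_fderiv hk s x).differentiableAt, by simp, ?_⟩
    have : fderiv ℝ (convm k s) = fun x => ∑ j, (ContinuousLinearMap.proj (R := ℝ) (φ := fun _ : Fin n => ℝ) j).smulRight
      (convm (pderivDir j k) s x) := by
      funext x
      rw [clm_eq_sum (fderiv ℝ (convm k s) x)]
      refine Finset.sum_congr rfl fun j _ => ?_
      rw [← convm_pd hk]; rfl
    rw [this]
    apply ContDiff.sum
    intro j _
    exact contDiff_const.smulRight (ih (hk.pd j) s)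
lemma convm_smooth {k : Dom n → ℝ} (hk : BddDer k) (s : Measure (Dom n)) [IsFiniteMeasure s] :
    Sm (convm k s) := contDiff_infty.2 fun N => convm_smooth_nat N hk s
lemma convm_wd {k : Dom n → ℝ} (hk : BddDer k) (s : Measure (Dom n)) [IsFiniteMeasure s]
    (w : List (Fin n)) : wd w (convm k s) = convm (wd w k) s := by
  induction w with
  | nil => rfl
  | cons j w ih => simp only [_root_.wd, ih, convm_pd (hk.wd w)]
lemma op_scalar {V : Type*} [NormedAddCommGroup V] [NormedSpace ℝ V] {f : Dom n → ℝ} (hf : Sm f) (v : E)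
    (B : (Fin n → ℕ) → (E →L[ℝ] V)) (l : ℕ) (x : Dom n) :
    opApply B l (fun x => f x • v) x = ∑ α ∈ degSet n l, wd (word α) f x • B α v := by
  unfold opApply
  refine Finset.sum_congr rfl fun α _ => ?_
  rw [mderiv_eq_wd, wd_smul_vec hf]; simp
end calcl
section
section fourierl
open SchwartzMap FourierTransform LineDeriv
variable {n : ℕ}
abbrev Eu (n : ℕ) := EuclideanSpace ℝ (Fin n)
def eL : Dom n ≃L[ℝ] Eu n := (EuclideanSpace.equiv (Fin n) ℝ).symm
lemma eL_apply (x : Dom n) (i : Fin n) : eL x i = x i := rfl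
def swd : List (Fin n) → 𝓢(Eu n, ℂ) → 𝓢(Eu n, ℂ)
  | [], f => f
  | j :: w, f => ∂_{(eL (Pi.single j 1) : Eu n)} (swd w f)
lemma wd_re (w : List (Fin n)) (f : 𝓢(Eu n, ℂ)) :
    wd w (fun x => (f (eL x)).re) = fun x => (swd w f (eL x)).re := by
  induction w with
  | nil => rfl
  | cons j w ih =>
    funext x
    simp only [wd, pderivDir, ih, swd]
    rw [SchwartzMap.lineDerivOp_apply_eq_fderiv]
    have h1 := ((swd w f).differentiable (eL x)).hasFDerivAt.comp x (eL (n := n)).hasFDerivAt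
    have h2 := Complex.reCLM.hasFDerivAt.comp x h1
    have h3 : fderiv ℝ (fun x => (swd w f (eL x)).re) x = _ := h2.fderiv
    rw [h3]; rfl
def Sch (k : Dom n → ℝ) : Prop := ∃ f : 𝓢(Eu n, ℂ), ∀ x, k x = (f (eL x)).re
lemma Sch.wd {k : Dom n → ℝ} (hk : Sch k) (w : List (Fin n)) : Sch (wd w k) := by
  obtain ⟨f, hf⟩ := hk
  refine ⟨swd w f, fun x => ?_⟩
  rw [show k = fun x => (f (eL x)).re from funext hf, wd_re]
lemma Sch.sm {k : Dom n → ℝ} (hk : Sch k) : Sm k := by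
  obtain ⟨f, hf⟩ := hk
  rw [show k = fun x => (f (eL x)).re from funext hf]
  exact Complex.reCLM.contDiff.comp ((f.smooth _).comp eL.contDiff)
lemma norm_le_eL (x : Dom n) : ‖x‖ ≤ ‖eL x‖ := by
  rw [pi_norm_le_iff_of_nonneg (norm_nonneg _)]
  intro i
  exact PiLp.norm_apply_le (p := 2) (eL x) i
lemma Sch.decay {k : Dom n → ℝ} (hk : Sch k) (N : ℕ) :
    ∃ C, 0 ≤ C ∧ ∀ x, |k x| * (1 + ‖x‖) ^ N ≤ C := by
  obtain ⟨f, hf⟩ := hk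
  refine ⟨2 ^ N * ((Finset.Iic (N, 0)).sup fun m => SchwartzMap.seminorm ℂ m.1 m.2) f, by positivity, fun x => ?_⟩
  have := SchwartzMap.one_add_le_sup_seminorm_apply (𝕜 := ℂ) (m := (N, 0)) (k := N) (n := 0) le_rfl le_rfl f (eL x)
  refine le_trans ?_ this
  rw [norm_iteratedFDeriv_zero, hf, mul_comm]
  gcongr
  · exact norm_le_eL x
  · exact Complex.abs_re_le_norm _
lemma Sch.bdd {k : Dom n → ℝ} (hk : Sch k) : BddDer k := by
  refine ⟨hk.sm, fun w => ?_⟩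
  obtain ⟨C, _, hC⟩ := (hk.wd w).decay 0
  exact ⟨C, by simpa using hC⟩
lemma integral_eL {F : Type*} [NormedAddCommGroup F] [NormedSpace ℝ F] (f : Eu n → F) :
    ∫ x, f (eL x) = ∫ y, f y := by
  have h := (EuclideanSpace.volume_preserving_symm_measurableEquiv_toLp (Fin n)).symm
  have := h.integral_comp (MeasurableEquiv.measurableEmbedding _) f
  exact this
lemma Sch.integrable {k : Dom n → ℝ} (hk : Sch k) : Integrable k := by
  obtain ⟨f, hf⟩ := hk
  have h := (EuclideanSpace.volume_preserving_symm_measurableEquiv_toLp (Fin n)).symm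
  have h2 := (h.integrable_comp_emb (MeasurableEquiv.measurableEmbedding _)).2 (f.integrable (μ := volume))
  have := h2.re
  rw [show k = fun x => (f (eL x)).re from funext hf]
  exact this
lemma swd_fourier (w : List (Fin n)) (f : 𝓢(Eu n, ℂ)) (ξ : Eu n) :
    𝓕 (swd w f) ξ = (2 * Real.pi * Complex.I) ^ w.length * ((w.map (fun j => ξ j)).prod : ℝ) * 𝓕 f ξ := by
  induction w with
  | nil => simp [swd]
  | cons j w ih =>
    simp only [swd]
    rw [SchwartzMap.fourier_lineDerivOp_eq]
    have ht : (fun x : Eu n => inner ℝ x (eL (Pi.single j 1) : Eu n)).HasTemperateGrowth :=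
      ((innerSL ℝ).flip (eL (Pi.single j 1) : Eu n)).hasTemperateGrowth
    rw [_root_.smul_apply, smulLeftCLM_apply_apply ht, ih]
    have : inner ℝ ξ (eL (Pi.single j 1) : Eu n) = ξ j := by
      rw [show (eL (Pi.single j 1) : Eu n) = EuclideanSpace.single j 1 from rfl]
      rw [EuclideanSpace.inner_single_right]; simp
    rw [this]
    simp [pow_succ]
    ring
/-- L1-normalised dilation -/
def sc (R : ℝ) (hR : R ≠ 0) (f : 𝓢(Eu n, ℂ)) : 𝓢(Eu n, ℂ) :=
  ((R ^ n : ℝ) : ℂ) • compCLMOfContinuousLinearEquiv ℂ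
    (ContinuousLinearEquiv.smulLeft (Units.mk0 R hR) : Eu n ≃L[ℝ] Eu n) f
lemma sc_apply (R : ℝ) (hR : R ≠ 0) (f : 𝓢(Eu n, ℂ)) (x : Eu n) :
    sc R hR f x = ((R ^ n : ℝ) : ℂ) * f (R • x) := by
  simp [sc]
lemma sc_fourier (R : ℝ) (hR : 0 < R) (f : 𝓢(Eu n, ℂ)) (ξ : Eu n) :
    𝓕 (sc R hR.ne' f) ξ = 𝓕 f (R⁻¹ • ξ) := by
  rw [SchwartzMap.fourier_coe, SchwartzMap.fourier_coe, Real.fourier_eq, Real.fourier_eq]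
  have := Measure.integral_comp_smul (volume : Measure (Eu n))
    (fun v => 𝐞 (-inner ℝ v (R⁻¹ • ξ)) • f v) R
  simp only [finrank_euclideanSpace, Fintype.card_fin, inner_smul_left, inner_smul_right] at this
  have hRn : (0:ℝ) < R ^ n := by positivity
  rw [abs_of_pos (by positivity)] at this
  have h2 : ∫ v, 𝐞 (-inner ℝ v ξ) • (sc R hR.ne' f) v =
      (R^n : ℝ) • ∫ x : Eu n, 𝐞 (-(R⁻¹ * ((starRingEnd ℝ) R * inner ℝ x ξ))) • f (R • x) := by
    rw [← integral_smul]
    congr 1; funext v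
    rw [sc_apply]
    have : R⁻¹ * ((starRingEnd ℝ) R * inner ℝ v ξ) = inner ℝ v ξ := by
      simp; field_simp
    rw [this, smul_comm]
    congr 1
  rw [h2, this, smul_smul, mul_inv_cancel₀ hRn.ne', one_smul]
  simp [inner_smul_right]
lemma L2_bound (K h : 𝓢(Eu n, ℂ)) (C : ℝ) (hC : ∀ ξ, ‖𝓕 K ξ‖ ≤ C) :
    ∫ x, ‖SchwartzMap.convolution (ContinuousLinearMap.mul ℂ ℂ) K h x‖ ^ 2 ≤ C ^ 2 * ∫ x, ‖h x‖ ^ 2 := by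
  have hC0 : 0 ≤ C := (norm_nonneg _).trans (hC 0)
  rw [← SchwartzMap.integral_norm_sq_fourier, ← SchwartzMap.integral_norm_sq_fourier h, ← integral_const_mul]
  have hi : ∀ f : 𝓢(Eu n, ℂ), Integrable (fun x => ‖f x‖ ^ 2) := fun f => by
    have := f.memLp 2 (μ := volume)
    exact this.integrable_norm_pow (by norm_num)
  apply integral_mono (hi _) ((hi _).const_mul _)
  intro ξ
  have : 𝓕 (SchwartzMap.convolution (ContinuousLinearMap.mul ℂ ℂ) K h) ξ = 𝓕 K ξ * 𝓕 h ξ := by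
    rw [SchwartzMap.fourier_convolution]; simp
  simp only [this, norm_mul, mul_pow]
  have := hC ξ
  gcongr
def dsum (K : Dom n → ℝ) (J : ℕ) (x : Dom n) : ℝ :=
  ∑ j ∈ Finset.range J, ((2:ℝ) ^ j) ^ n * K ((2:ℝ) ^ j • x)
lemma L2_real (K : 𝓢(Eu n, ℂ)) (C : ℝ) (hC : ∀ ξ, ‖𝓕 K ξ‖ ≤ C) (h : Dom n → ℝ) (hh : Sm h)
    (hc : HasCompactSupport h) :
    Integrable (fun x => (∫ y, (K (eL (x - y))).re * h y) ^ 2) ∧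
    ∫ x, (∫ y, (K (eL (x - y))).re * h y) ^ 2 ≤ C ^ 2 * ∫ x, h x ^ 2 := by
  have hs : ContDiff ℝ (⊤ : ℕ∞) (fun x : Eu n => ((h (eL.symm x) : ℝ) : ℂ)) :=
    Complex.ofRealCLM.contDiff.comp (hh.comp eL.symm.contDiff)
  have hs2 : HasCompactSupport (fun x : Eu n => ((h (eL.symm x) : ℝ) : ℂ)) := by
    have := hc.comp_homeomorph (eL (n := n)).symm.toHomeomorph
    exact this.comp_left (g := fun r : ℝ => (r : ℂ)) (by simp)
  set H : 𝓢(Eu n, ℂ) := hs2.toSchwartzMap hs with hH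
  have hHa : ∀ x, H x = ((h (eL.symm x) : ℝ) : ℂ) := fun x => rfl
  set F := SchwartzMap.convolution (ContinuousLinearMap.mul ℂ ℂ) K H with hF
  have e1 : ∀ x : Dom n, ∫ y, (K (eL (x - y))).re * h y = (F (eL x)).re := by
    intro x
    rw [hF, SchwartzMap.convolution_apply, MeasureTheory.convolution_def,
      ← integral_sub_left_eq_self _ volume (eL x), ← integral_eL]
    obtain ⟨C', -, hC'⟩ := K.decay 0 0
    have hint : Integrable (fun y : Dom n => ((ContinuousLinearMap.mul ℂ ℂ) (K (eL x - eL y))) (H (eL x - (eL x - eL y)))) := by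
      have hi : Integrable h := hh.continuous.integrable_of_hasCompactSupport hc
      have : Integrable (fun y : Dom n => K (eL (x - y)) * ((h y : ℝ) : ℂ)) := by
        apply Integrable.bdd_mul (c := C') hi.ofReal
        · exact (K.continuous.comp (eL.continuous.comp (continuous_const.sub continuous_id))).aestronglyMeasurable
        · exact Eventually.of_forall fun y => by simpa using hC' (eL (x - y))
      refine this.congr (Eventually.of_forall fun y => ?_)
      simp [hHa, map_sub]
    have := Complex.reCLM.integral_comp_comm hint
    simp only [Complex.reCLM_apply] at this
    rw [← this]
    congr 1; funext y
    simp [hHa, map_sub]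
  simp only [e1]
  have hFi : Integrable (fun x => ‖F x‖ ^ 2) := by
    have := F.memLp 2 (μ := volume)
    exact this.integrable_norm_pow (by norm_num)
  have hFi2 : Integrable (fun x : Dom n => ‖F (eL x)‖ ^ 2) := by
    have h := (EuclideanSpace.volume_preserving_symm_measurableEquiv_toLp (Fin n)).symm
    exact (h.integrable_comp_emb (MeasurableEquiv.measurableEmbedding _)).2 hFi
  have hle : ∀ x : Dom n, (F (eL x)).re ^ 2 ≤ ‖F (eL x)‖ ^ 2 := fun x => by
    rw [← sq_abs]; gcongr; exact Complex.abs_re_le_norm _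
  have hI : Integrable (fun x : Dom n => (F (eL x)).re ^ 2) := by
    refine Integrable.mono' hFi2 ?_ (Eventually.of_forall fun x => ?_)
    · exact ((Complex.continuous_re.comp (F.continuous.comp eL.continuous)).pow 2).aestronglyMeasurable
    · rw [Real.norm_of_nonneg (sq_nonneg _)]; exact hle x
  refine ⟨hI, (integral_mono hI hFi2 hle).trans ?_⟩
  rw [integral_eL (fun y => ‖F y‖ ^ 2)]
  refine (L2_bound K H C hC).trans (le_of_eq ?_)
  rw [← integral_eL (fun y => ‖H y‖ ^ 2)]
  congr 2; funext x
  simp [hHa]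
end fourierl
section
section fourierk
open SchwartzMap FourierTransform LineDeriv
variable {n : ℕ}
def wmono (w : List (Fin n)) (ξ : Eu n) : ℝ := (w.map (fun j => ξ j)).prod
lemma mono_smul (w : List (Fin n)) (R : ℝ) (ξ : Eu n) : wmono w (R • ξ) = R ^ w.length * wmono w ξ := by
  unfold wmono
  induction w with
  | nil => simp
  | cons j w ih => simp [ih, pow_succ]; ring
lemma mono_smooth (w : List (Fin n)) : ContDiff ℝ (⊤ : ℕ∞) (wmono w) := by
  unfold wmono
  induction w with
  | nil => simpa using contDiff_const
  | cons j w ih =>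
    simp only [List.map_cons, List.prod_cons]
    exact (EuclideanSpace.proj (𝕜 := ℝ) j).contDiff.mul ih
lemma fourier_kernel {k : ℕ} (c : (Fin n → ℕ) → (Fin n → ℕ) → ℝ)
    (hP : ∀ ξ : Dom n, ξ ≠ 0 → 0 < ∑ α ∈ degSet n k, ∑ β ∈ degSet n k,
      c α β * ((∏ i, ξ i ^ α i) * (∏ i, ξ i ^ β i))) :
    ∃ G ψ : Dom n → ℝ, Sch G ∧ Sch ψ ∧ ∫ x, ψ x = 1 ∧
      (∀ x, ∑ α ∈ degSet n k, ∑ β ∈ degSet n k, c α β * wd (word α ++ word β) G x =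
        ψ x - (2⁻¹:ℝ) ^ n * ψ ((2⁻¹:ℝ) • x)) ∧
      ∀ α ∈ degSet n k, ∀ β ∈ degSet n k, (∫ x, wd (word α ++ word β) G x = 0) ∧
        ∃ C, 0 ≤ C ∧ ∀ (J : ℕ) (h : Dom n → ℝ), Sm h → HasCompactSupport h →
          Integrable (fun x => (∫ y, dsum (wd (word α ++ word β) G) J (x - y) * h y) ^ 2) ∧
          ∫ x, (∫ y, dsum (wd (word α ++ word β) G) J (x - y) * h y) ^ 2 ≤ C * ∫ x, h x ^ 2 := by
  classical
  set P : Eu n → ℝ := fun ξ => ∑ α ∈ degSet n k, ∑ β ∈ degSet n k,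
      c α β * wmono (word α ++ word β) ξ with hPdef
  have lpapp : ∀ (α β : Fin n → ℕ) (ξ : Eu n), wmono (word α ++ word β) ξ =
      (∏ i, ξ i ^ α i) * (∏ i, ξ i ^ β i) := by
    intro α β ξ
    rw [← word_prod, ← word_prod]; simp [wmono]
  have hPpos : ∀ ξ : Eu n, ξ ≠ 0 → 0 < P ξ := by
    intro ξ hξ
    have := hP (eL.symm ξ) (by simpa using hξ)
    simp only [hPdef, lpapp]
    exact this
  have hPs : ContDiff ℝ (⊤ : ℕ∞) P := by
    apply ContDiff.sum; intro α _
    apply ContDiff.sum; intro β _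
    exact contDiff_const.mul (mono_smooth _)
  have hPh : ∀ (R : ℝ) ξ, P (R • ξ) = R ^ (2 * k) * P ξ := by
    intro R ξ
    simp only [hPdef, Finset.mul_sum]
    refine Finset.sum_congr rfl fun α hα => Finset.sum_congr rfl fun β hβ => ?_
    rw [mono_smul, List.length_append, word_len hα, word_len hβ, ← two_mul]; ring
  let η : ContDiffBump (0 : Eu n) := ⟨1, 2, by norm_num, by norm_num⟩
  have hη1 : ∀ ξ : Eu n, ‖ξ‖ ≤ 1 → η ξ = 1 := fun ξ h => η.one_of_mem_closedBall (by simpa using h)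
  have hηs : ContDiff ℝ (⊤ : ℕ∞) (fun ξ : Eu n => η ξ) := η.contDiff
  set D : Eu n → ℝ := fun ξ => η ξ - η ((2:ℝ) • ξ) with hD
  have hDs : ContDiff ℝ (⊤ : ℕ∞) D := hηs.sub (hηs.comp (contDiff_id.const_smul (2:ℝ)))
  have hD0 : ∀ ξ : Eu n, ‖ξ‖ ≤ 1/2 → D ξ = 0 := by
    intro ξ h
    simp only [hD]
    rw [hη1 _ (by linarith), hη1 _ (by rw [norm_smul]; norm_num; linarith)]; simp
  have hDc : ∀ ξ : Eu n, 2 ≤ ‖ξ‖ → D ξ = 0 := by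
    intro ξ h
    simp only [hD]
    rw [η.zero_of_le_dist (by simpa using h), η.zero_of_le_dist (by
      simp [norm_smul]; show (2:ℝ) ≤ _; linarith)]; simp
  set κ : ℂ := (2 * Real.pi * Complex.I) ^ (2 * k) with hκ
  have hκ0 : κ ≠ 0 := pow_ne_zero _ Complex.two_pi_I_ne_zero
  set M : Eu n → ℂ := fun ξ => ((D ξ / P ξ : ℝ) : ℂ) * κ⁻¹ with hM
  have hMs : ContDiff ℝ (⊤ : ℕ∞) M := by
    apply ContDiff.mul _ contDiff_const
    apply Complex.ofRealCLM.contDiff.comp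
    rw [contDiff_iff_contDiffAt]
    intro ξ
    by_cases h : ξ = 0
    · subst h
      have : (fun ξ => D ξ / P ξ) =ᶠ[𝓝 (0 : Eu n)] fun _ => 0 := by
        filter_upwards [Metric.ball_mem_nhds (0 : Eu n) (by norm_num : (0:ℝ) < 1/2)] with ξ hξ
        rw [hD0 ξ (by simpa using (mem_ball_zero_iff.1 hξ).le)]; simp
      exact contDiffAt_const.congr_of_eventuallyEq this
    · exact hDs.contDiffAt.div hPs.contDiffAt (hPpos ξ h).ne'
  have hMc : HasCompactSupport M := by
    apply HasCompactSupport.of_support_subset_isCompact (isCompact_closedBall (0 : Eu n) 2)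
    intro ξ hξ
    by_contra h
    have : 2 ≤ ‖ξ‖ := by simp at h; exact h.le
    apply hξ
    simp [hM, hDc ξ this]
  have hηc : HasCompactSupport (fun ξ : Eu n => ((η ξ : ℝ) : ℂ)) :=
    η.hasCompactSupport.comp_left (g := fun r : ℝ => (r : ℂ)) (by simp)
  have hηs' : ContDiff ℝ (⊤ : ℕ∞) (fun ξ : Eu n => ((η ξ : ℝ) : ℂ)) := Complex.ofRealCLM.contDiff.comp hηs
  set Gc : 𝓢(Eu n, ℂ) := 𝓕⁻ (hMc.toSchwartzMap hMs) with hGc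
  set ψc : 𝓢(Eu n, ℂ) := 𝓕⁻ (hηc.toSchwartzMap hηs') with hψc
  have hFG : ∀ ξ, 𝓕 Gc ξ = M ξ := fun ξ => by rw [hGc, fourier_fourierInv_eq]; rfl
  have hFψ : ∀ ξ, 𝓕 ψc ξ = ((η ξ : ℝ) : ℂ) := fun ξ => by rw [hψc, fourier_fourierInv_eq]; rfl
  have hFK : ∀ α ∈ degSet n k, ∀ β ∈ degSet n k, ∀ ξ, 𝓕 (swd (word α ++ word β) Gc) ξ =
      ((wmono (word α ++ word β) ξ / P ξ * D ξ : ℝ) : ℂ) := by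
    intro α hα β hβ ξ
    rw [swd_fourier, hFG, List.length_append, word_len hα, word_len hβ, ← two_mul, ← hκ, hM]
    change κ * ((wmono (word α ++ word β) ξ : ℝ) : ℂ) * _ = _
    push_cast
    field_simp
  refine ⟨fun x => (Gc (eL x)).re, fun x => (ψc (eL x)).re, ⟨Gc, fun _ => rfl⟩, ⟨ψc, fun _ => rfl⟩, ?_, ?_, ?_⟩
  · have h1 : ∫ y, ψc y = 1 := by
      have := hFψ 0
      rw [SchwartzMap.fourier_coe, Real.fourier_eq, hη1 0 (by simp)] at this
      simpa using this
    have h2 := Complex.reCLM.integral_comp_comm (ψc.integrable (μ := volume))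
    simp only [Complex.reCLM_apply] at h2
    rw [integral_eL (fun y => (ψc y).re), h2, h1]; simp
  · have key : ∑ α ∈ degSet n k, ∑ β ∈ degSet n k, ((c α β : ℝ) : ℂ) • swd (word α ++ word β) Gc =
        ψc - sc (2⁻¹:ℝ) (by norm_num) ψc := by
      have inj : ∀ a b : 𝓢(Eu n, ℂ), 𝓕 a = 𝓕 b → a = b := fun a b h => by
        have h2 := congrArg (fun f : 𝓢(Eu n, ℂ) => (𝓕⁻ f : 𝓢(Eu n, ℂ))) h
        simpa only [fourierInv_fourier_eq] using h2
      apply inj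
      ext ξ
      rw [show 𝓕 (ψc - sc (2⁻¹:ℝ) (by norm_num) ψc) = 𝓕 ψc - 𝓕 (sc (2⁻¹:ℝ) (by norm_num) ψc) from
        (fourierTransformCLM ℂ).map_sub _ _]
      rw [show 𝓕 (∑ α ∈ degSet n k, ∑ β ∈ degSet n k, ((c α β : ℝ) : ℂ) • swd (word α ++ word β) Gc) =
        ∑ α ∈ degSet n k, ∑ β ∈ degSet n k, ((c α β : ℝ) : ℂ) • 𝓕 (swd (word α ++ word β) Gc) by
        change fourierTransformCLM ℂ _ = _
        simp only [map_sum, map_smul]; rfl]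
      simp only [_root_.sum_apply, _root_.smul_apply, _root_.sub_apply]
      rw [hFψ, sc_fourier _ (by norm_num), hFψ, inv_inv]
      rw [show ((η ξ : ℝ) : ℂ) - ((η ((2:ℝ) • ξ) : ℝ) : ℂ) = ((D ξ : ℝ) : ℂ) by simp [hD]]
      have : ∀ α ∈ degSet n k, ∀ β ∈ degSet n k, ((c α β : ℝ) : ℂ) • 𝓕 (swd (word α ++ word β) Gc) ξ =
          ((c α β * wmono (word α ++ word β) ξ * (D ξ / P ξ) : ℝ) : ℂ) := by
        intro α hα β hβ
        rw [hFK α hα β hβ]; push_cast; simp; ring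
      rw [Finset.sum_congr rfl fun α hα => Finset.sum_congr rfl fun β hβ => this α hα β hβ]
      norm_cast
      simp only [← Finset.sum_mul]
      change P ξ * (D ξ / P ξ) = D ξ
      by_cases h : ξ = 0
      · rw [hD0 ξ (by simp [h])]; simp
      · have := (hPpos ξ h).ne'
        field_simp
    intro x
    have h1 := congrArg (fun f : 𝓢(Eu n, ℂ) => (f (eL x)).re) key
    simp only [_root_.sum_apply, _root_.smul_apply, _root_.sub_apply, Complex.re_sum, sc_apply,
      Complex.sub_re, smul_eq_mul, Complex.re_ofReal_mul] at h1
    simp only [wd_re, map_smul]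
    exact h1
  · intro α hα β hβ
    set K := swd (word α ++ word β) Gc with hK
    have hKre : wd (word α ++ word β) (fun x => (Gc (eL x)).re) = fun x => (K (eL x)).re := wd_re _ _
    rw [hKre]
    constructor
    · have h1 : ∫ y, K y = 0 := by
        have := hFK α hα β hβ 0
        rw [SchwartzMap.fourier_coe, Real.fourier_eq, hD0 0 (by simp)] at this
        simpa using this
      have h2 := Complex.reCLM.integral_comp_comm (K.integrable (μ := volume))
      simp only [Complex.reCLM_apply] at h2
      rw [integral_eL (fun y => (K y).re), h2, h1]; simp
    · set q : Eu n → ℝ := fun ξ => wmono (word α ++ word β) ξ / P ξ with hq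
      have hqh : ∀ R : ℝ, 0 < R → ∀ ξ, q (R • ξ) = q ξ := by
        intro R hR ξ
        simp only [hq]
        rw [hPh, mono_smul, List.length_append, word_len hα, word_len hβ, ← two_mul,
          mul_div_mul_left _ _ (by positivity)]
      obtain ⟨C, hC⟩ : ∃ C, ∀ ξ ∈ Metric.sphere (0 : Eu n) 1, ‖q ξ‖ ≤ C := by
        apply (isCompact_sphere (0 : Eu n) 1).exists_bound_of_continuousOn
        apply ContinuousOn.div (mono_smooth _).continuous.continuousOn hPs.continuous.continuousOn
        intro ξ hξ
        exact (hPpos ξ (by rintro rfl; simp at hξ)).ne'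
      have hqb : ∀ ξ : Eu n, ξ ≠ 0 → |q ξ| ≤ |C| := by
        intro ξ h
        have hp : 0 < ‖ξ‖ := norm_pos_iff.2 h
        rw [← hqh (‖ξ‖⁻¹) (by positivity) ξ]
        exact (hC _ (by simp [norm_smul, hp.ne'])).trans (le_abs_self C)
      refine ⟨|C| ^ 2, by positivity, fun J h hh hc => ?_⟩
      set KJ : 𝓢(Eu n, ℂ) := ∑ j ∈ Finset.range J, sc ((2:ℝ) ^ j) (by positivity) K with hKJ
      have hds : ∀ x, dsum (fun x => (K (eL x)).re) J x = (KJ (eL x)).re := by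
        intro x
        simp only [hKJ, dsum, _root_.sum_apply, Complex.re_sum, sc_apply, Complex.re_ofReal_mul, map_smul]
      simp only [hds]
      apply L2_real KJ |C| _ h hh hc
      intro ξ
      have e1 : 𝓕 KJ ξ = ∑ j ∈ Finset.range J, 𝓕 (sc ((2:ℝ) ^ j) (by positivity) K) ξ := by
        rw [hKJ]
        change fourierTransformCLM ℂ _ ξ = _
        simp only [map_sum, _root_.sum_apply]; rfl
      have e2 : 𝓕 KJ ξ = ((q ξ * (η ((2:ℝ) • ((2:ℝ)^J)⁻¹ • ξ) - η ((2:ℝ) • ξ)) : ℝ) : ℂ) := by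
        rw [e1]
        have : ∀ j, 𝓕 (sc ((2:ℝ) ^ j) (by positivity) K) ξ =
            ((q ξ * (η ((2:ℝ) • ((2:ℝ)^(j+1))⁻¹ • ξ) - η ((2:ℝ) • ((2:ℝ)^j)⁻¹ • ξ)) : ℝ) : ℂ) := by
          intro j
          rw [sc_fourier _ (by positivity), hFK α hα β hβ]
          congr 1
          have := hqh (((2:ℝ)^j)⁻¹) (by positivity) ξ
          simp only [hq] at this
          rw [this]
          congr 1
          simp only [hD]
          congr 2
          rw [smul_smul]
          congr 1
          rw [pow_succ]; field_simp
        rw [Finset.sum_congr rfl fun j _ => this j]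
        rw [← Complex.ofReal_sum]
        congr 1
        rw [← Finset.mul_sum, Finset.sum_range_sub (fun j => η ((2:ℝ) • ((2:ℝ)^j)⁻¹ • ξ))]
        simp
      rw [e2, Complex.norm_real, Real.norm_eq_abs, abs_mul]
      by_cases hξ : ξ = 0
      · simp [hξ]
      · have a1 := hqb ξ hξ
        have a2 : |η ((2:ℝ) • ((2:ℝ)^J)⁻¹ • ξ) - η ((2:ℝ) • ξ)| ≤ 1 := by
          have b1 := η.nonneg' ((2:ℝ) • ((2:ℝ)^J)⁻¹ • ξ)
          have b2 := η.le_one (x := (2:ℝ) • ((2:ℝ)^J)⁻¹ • ξ)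
          have b3 := η.nonneg' ((2:ℝ) • ξ)
          have b4 := η.le_one (x := (2:ℝ) • ξ)
          rw [abs_le]; constructor <;> linarith
        calc _ ≤ |C| * 1 := mul_le_mul a1 a2 (abs_nonneg _) (abs_nonneg _)
          _ = |C| := mul_one _
end fourierk
section
section dyadic
open scoped ENNReal
variable {n : ℕ}
def dix (j : ℕ) (x : Dom n) : Fin n → ℤ := fun i => ⌊(2:ℝ) ^ j * x i⌋
def dcell (j : ℕ) (v : Fin n → ℤ) : Set (Dom n) := {x | dix j x = v}
def tcell (j : ℕ) (v : Fin n → ℤ) : Set (Dom n) :=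
  {x | ∀ i, (v i : ℝ) - 1 < 2 ^ j * x i ∧ 2 ^ j * x i < v i + 2}
lemma mem_dcell {j : ℕ} {v : Fin n → ℤ} {x : Dom n} :
    x ∈ dcell j v ↔ ∀ i, (v i : ℝ) ≤ 2 ^ j * x i ∧ 2 ^ j * x i < v i + 1 := by
  simp only [dcell, dix, Set.mem_ofPred_eq, funext_iff, Int.floor_eq_iff]
lemma dcell_eq_pi (j : ℕ) (v : Fin n → ℤ) :
    dcell j v = Set.univ.pi fun i => Set.Ico ((v i : ℝ) / 2 ^ j) ((v i + 1) / 2 ^ j) := by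
  ext x
  rw [mem_dcell]
  simp only [Set.mem_pi, Set.mem_univ, true_imp_iff, Set.mem_Ico]
  refine forall_congr' fun i => ?_
  rw [div_le_iff₀ (by positivity), lt_div_iff₀ (by positivity), mul_comm]
lemma tcell_eq_pi (j : ℕ) (v : Fin n → ℤ) :
    tcell j v = Set.univ.pi fun i => Set.Ioo (((v i : ℝ) - 1) / 2 ^ j) ((v i + 2) / 2 ^ j) := by
  ext x
  simp only [tcell, Set.mem_ofPred_eq, Set.mem_pi, Set.mem_univ, true_imp_iff, Set.mem_Ioo]
  refine forall_congr' fun i => ?_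
  rw [div_lt_iff₀ (by positivity), lt_div_iff₀ (by positivity), mul_comm]
lemma dcell_meas (j : ℕ) (v : Fin n → ℤ) : MeasurableSet (dcell j v) := by
  rw [dcell_eq_pi]; exact MeasurableSet.univ_pi fun i => measurableSet_Ico
lemma tcell_open (j : ℕ) (v : Fin n → ℤ) : IsOpen (tcell j v) := by
  rw [tcell_eq_pi]; exact isOpen_set_pi Set.finite_univ fun i _ => isOpen_Ioo
lemma dcell_vol (j : ℕ) (v : Fin n → ℤ) : volume (dcell j v) = ENNReal.ofReal (((2:ℝ) ^ j)⁻¹) ^ n := by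
  rw [dcell_eq_pi, volume_pi_pi]
  simp only [Real.volume_Ico]
  rw [Finset.prod_congr rfl (g := fun _ => ENNReal.ofReal (((2:ℝ) ^ j)⁻¹)) fun i _ => by
    congr 1; field_simp; ring]
  simp
lemma tcell_vol (j : ℕ) (v : Fin n → ℤ) : volume (tcell j v) = 3 ^ n * volume (dcell j v) := by
  rw [tcell_eq_pi, volume_pi_pi, dcell_vol, ← mul_pow]
  simp only [Real.volume_Ioo]
  rw [Finset.prod_congr rfl (g := fun _ => 3 * ENNReal.ofReal (((2:ℝ) ^ j)⁻¹)) fun i _ => by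
    rw [show (3:ℝ≥0∞) = ENNReal.ofReal 3 by simp, ← ENNReal.ofReal_mul (by norm_num)]
    congr 1; field_simp; ring]
  simp
lemma dcell_vol_succ (j : ℕ) (v v' : Fin n → ℤ) :
    volume (dcell j v) = 2 ^ n * volume (dcell (j+1) v') := by
  rw [dcell_vol, dcell_vol, ← mul_pow]
  congr 1
  rw [show (2:ℝ≥0∞) = ENNReal.ofReal 2 by simp, ← ENNReal.ofReal_mul (by norm_num)]
  congr 1; rw [pow_succ]; field_simp
lemma dcell_pos (j : ℕ) (v : Fin n → ℤ) : volume (dcell j v) ≠ 0 := by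
  rw [dcell_vol]; exact pow_ne_zero _ (by simp)
lemma dcell_top (j : ℕ) (v : Fin n → ℤ) : volume (dcell j v) ≠ ⊤ := by
  rw [dcell_vol]; exact ENNReal.pow_ne_top (by simp)
lemma dcell_sub_tcell (j : ℕ) (v : Fin n → ℤ) : dcell j v ⊆ tcell j v := by
  intro x hx i
  have := mem_dcell.1 hx i
  constructor <;> linarith
lemma dix_anc {i j : ℕ} (h : i ≤ j) {x y : Dom n} (hxy : dix j x = dix j y) : dix i x = dix i y := by
  obtain ⟨d, rfl⟩ := Nat.exists_eq_add_of_le h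
  have key : ∀ z : Dom n, ∀ k, dix i z k = dix (i+d) z k / (2 ^ d : ℕ) := by
    intro z k
    simp only [dix]
    rw [← Int.floor_div_natCast]
    congr 1; push_cast; rw [pow_add]; field_simp
  funext k
  rw [key x, key y, hxy]
lemma dcell_dist {j : ℕ} {v : Fin n → ℤ} {x y : Dom n} (hx : x ∈ dcell j v) (hy : y ∈ dcell j v) :
    ‖x - y‖ ≤ ((2:ℝ) ^ j)⁻¹ := by
  rw [pi_norm_le_iff_of_nonneg (by positivity)]
  intro i
  have h1 := mem_dcell.1 hx i
  have h2 := mem_dcell.1 hy i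
  rw [Pi.sub_apply, Real.norm_eq_abs, inv_eq_one_div, le_div_iff₀ (by positivity)]
  rw [← abs_of_pos (show (0:ℝ) < 2 ^ j by positivity), ← abs_mul, abs_le]
  constructor <;> nlinarith
lemma ball_sub_tcell {j : ℕ} {v : Fin n → ℤ} {x y : Dom n} (hx : x ∈ dcell j v)
    (hy : ‖x - y‖ < ((2:ℝ) ^ j)⁻¹) : y ∈ tcell j v := by
  intro i
  have h1 := mem_dcell.1 hx i
  have h2 := (norm_le_pi_norm (x - y) i).trans_lt hy
  rw [Pi.sub_apply, Real.norm_eq_abs, inv_eq_one_div, lt_div_iff₀ (by positivity)] at h2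
  rw [← abs_of_pos (show (0:ℝ) < 2 ^ j by positivity), ← abs_mul, abs_lt] at h2
  constructor <;> nlinarith
lemma tcell_dist {j : ℕ} {v : Fin n → ℤ} {x y : Dom n} (hx : x ∈ dcell j v) (hy : y ∈ tcell j v) :
    ‖x - y‖ ≤ 2 * ((2:ℝ) ^ j)⁻¹ := by
  rw [pi_norm_le_iff_of_nonneg (by positivity)]
  intro i
  have h1 := mem_dcell.1 hx i
  have h2 := hy i
  rw [Pi.sub_apply, Real.norm_eq_abs, inv_eq_one_div, mul_one_div, le_div_iff₀ (by positivity)]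
  rw [← abs_of_pos (show (0:ℝ) < 2 ^ j by positivity), ← abs_mul, abs_le]
  constructor <;> nlinarith
lemma dix_mem (j : ℕ) (x : Dom n) : x ∈ dcell j (dix j x) := rfl
lemma tcell_anc {i j : ℕ} (h : i ≤ j) (x : Dom n) : tcell j (dix j x) ⊆ tcell i (dix i x) := by
  intro y hy k
  have h1 := hy k
  obtain ⟨d, rfl⟩ := Nat.exists_eq_add_of_le h
  have key : dix i x k = dix (i+d) x k / (2 ^ d : ℕ) := by
    simp only [dix]
    rw [← Int.floor_div_natCast]
    congr 1; push_cast; rw [pow_add]; field_simp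
  set m := dix (i+d) x k with hm
  set N : ℤ := ((2 ^ d : ℕ) : ℤ) with hN
  have hN0 : 0 < N := by simp [hN]
  have e1 := Int.mul_ediv_add_emod m N
  have e2 := Int.emod_nonneg m hN0.ne'
  have e3 := Int.emod_lt_of_pos m hN0
  rw [← key] at e1
  set a := dix i x k
  have f1 : N * a ≤ m := by linarith
  have f2 : m + 1 ≤ N * a + N := by linarith
  have f1' : (N:ℝ) * a ≤ m := by exact_mod_cast f1
  have f2' : (m:ℝ) + 1 ≤ N * a + N := by exact_mod_cast f2
  have hNr : (N : ℝ) = 2 ^ d := by simp [hN]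
  have hN1 : (1:ℝ) ≤ N := by exact_mod_cast hN0
  rw [pow_add, mul_assoc, mul_comm ((2:ℝ)^d), ← mul_assoc, ← hNr] at h1
  have hNp : (0:ℝ) < N := by linarith
  constructor
  · have : ((a:ℝ) - 1) * N < (2 ^ i * y k) * N := by nlinarith
    exact lt_of_mul_lt_mul_right this hNp.le
  · have : (2 ^ i * y k) * N < ((a:ℝ) + 2) * N := by nlinarith
    exact lt_of_mul_lt_mul_right this hNp.le
/-- maximal cells -/
def mcell (p : ℕ → (Fin n → ℤ) → Prop) (a : ℕ × (Fin n → ℤ)) : Set (Dom n) :=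
  {x | dix a.1 x = a.2 ∧ p a.1 a.2 ∧ ∀ i < a.1, ¬ p i (dix i x)}
lemma mcell_eq (p : ℕ → (Fin n → ℤ) → Prop) (a : ℕ × (Fin n → ℤ)) (hne : (mcell p a).Nonempty) :
    mcell p a = dcell a.1 a.2 := by
  obtain ⟨x, hx1, hx2, hx3⟩ := hne
  ext y
  constructor
  · intro h; exact h.1
  · intro h
    refine ⟨h, hx2, fun i hi => ?_⟩
    rw [dix_anc hi.le (show dix a.1 y = dix a.1 x from (show dix a.1 y = a.2 from h).trans hx1.symm)]
    exact hx3 i hi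
lemma mcell_meas (p : ℕ → (Fin n → ℤ) → Prop) (a : ℕ × (Fin n → ℤ)) : MeasurableSet (mcell p a) := by
  rcases (mcell p a).eq_empty_or_nonempty with h | h
  · rw [h]; exact MeasurableSet.empty
  · rw [mcell_eq p a h]; exact dcell_meas _ _
lemma mcell_disj (p : ℕ → (Fin n → ℤ) → Prop) : Pairwise (Function.onFun Disjoint (mcell p)) := by
  intro a b hab
  rw [Function.onFun, Set.disjoint_left]
  rintro x ⟨h1, h2, h3⟩ ⟨g1, g2, g3⟩
  rcases lt_trichotomy a.1 b.1 with h | h | h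
  · exact g3 _ h (h1 ▸ h2)
  · apply hab
    have : a.2 = b.2 := by rw [← h1, ← g1, h]
    exact Prod.ext h this
  · exact h3 _ h (g1 ▸ g2)
lemma mcell_union (p : ℕ → (Fin n → ℤ) → Prop) : ⋃ a, mcell p a = {x | ∃ j, p j (dix j x)} := by
  classical
  ext x
  simp only [Set.mem_iUnion, Set.mem_ofPred_eq]
  constructor
  · rintro ⟨a, h1, h2, _⟩; exact ⟨a.1, h1 ▸ h2⟩
  · intro h
    exact ⟨(Nat.find h, dix (Nat.find h) x), rfl, Nat.find_spec h, fun i hi => Nat.find_min h hi⟩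
variable (σ : Measure (Dom n)) (lam : ℝ≥0∞)
def heavy (j : ℕ) (v : Fin n → ℤ) : Prop := lam * volume (dcell j v) < σ (dcell j v)
def heavyS : Set (Dom n) := ⋃ (j : ℕ) (v : Fin n → ℤ) (_ : heavy σ lam j v), tcell j v
lemma heavyS_open : IsOpen (heavyS σ lam) :=
  isOpen_iUnion fun j => isOpen_iUnion fun v => isOpen_iUnion fun _ => tcell_open j v
lemma tsum_mcell_le (p : ℕ → (Fin n → ℤ) → Prop) : ∑' a, σ (mcell p a) ≤ σ Set.univ := by
  rw [← measure_iUnion (mcell_disj p) (mcell_meas p)]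
  exact measure_mono (Set.subset_univ _)
lemma heavyS_vol :
    lam * volume (heavyS σ lam) ≤ 3 ^ n * σ Set.univ := by
  classical
  have h1 : heavyS σ lam ⊆ ⋃ a : ℕ × (Fin n → ℤ), if (mcell (heavy σ lam) a).Nonempty then tcell a.1 a.2 else ∅ := by
    intro y hy
    simp only [heavyS, Set.mem_iUnion] at hy
    obtain ⟨j, v, hjv, hy⟩ := hy
    have hne : (dcell j v).Nonempty := by
      by_contra h
      rw [Set.not_nonempty_iff_eq_empty] at h
      exact dcell_pos j v (by rw [h]; simp)
    obtain ⟨x, hx⟩ := hne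
    have hx' : dix j x = v := hx
    subst hx'
    have hex : ∃ i, heavy σ lam i (dix i x) := ⟨j, hjv⟩
    rw [Set.mem_iUnion]
    refine ⟨(Nat.find hex, dix (Nat.find hex) x), ?_⟩
    rw [if_pos]
    · exact tcell_anc (Nat.find_min' hex hjv) x hy
    · exact ⟨x, rfl, Nat.find_spec hex, fun i hi => Nat.find_min hex hi⟩
  calc lam * volume (heavyS σ lam)
      ≤ lam * ∑' a : ℕ × (Fin n → ℤ), volume (if (mcell (heavy σ lam) a).Nonempty then tcell a.1 a.2 else ∅) := by
        gcongr
        exact (measure_mono h1).trans (measure_iUnion_le _)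
    _ = ∑' a : ℕ × (Fin n → ℤ), lam * volume (if (mcell (heavy σ lam) a).Nonempty then tcell a.1 a.2 else ∅) := by
        rw [ENNReal.tsum_mul_left]
    _ ≤ ∑' a : ℕ × (Fin n → ℤ), 3 ^ n * σ (mcell (heavy σ lam) a) := by
        refine ENNReal.tsum_le_tsum fun a => ?_
        split_ifs with h
        · rw [tcell_vol, mcell_eq _ _ h, ← mul_assoc, mul_comm lam, mul_assoc]
          gcongr
          obtain ⟨x, h1, h2, h3⟩ := h
          exact h2.le
        · simp
    _ ≤ 3 ^ n * σ Set.univ := by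
        rw [ENNReal.tsum_mul_left]
        gcongr
        exact tsum_mcell_le σ _
lemma heavyS_compl (ht : lam ≠ ⊤) (E : Set (Dom n)) (hE : E ∩ heavyS σ lam = ∅) :
    σ E ≤ lam * volume E := by
  classical
  have key : ∀ G : Set (Dom n), IsOpen G → E ⊆ G → σ E ≤ lam * volume G := by
    intro G hG hEG
    set p : ℕ → (Fin n → ℤ) → Prop := fun j v => dcell j v ⊆ G ∧ (dcell j v ∩ E).Nonempty with hp
    have hcov : E ⊆ ⋃ a, mcell p a := by
      rw [mcell_union]
      intro x hx
      obtain ⟨r, hr, hb⟩ := Metric.isOpen_iff.1 hG x (hEG hx)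
      obtain ⟨j, hj⟩ := exists_pow_lt_of_lt_one hr (show (2⁻¹:ℝ) < 1 by norm_num)
      refine ⟨j, ?_, ⟨x, rfl, hx⟩⟩
      intro y hy
      apply hb
      rw [Metric.mem_ball, dist_eq_norm]
      exact (dcell_dist hy (dix_mem j x)).trans_lt (by rwa [← inv_pow])
    calc σ E ≤ ∑' a, σ (mcell p a) := (measure_mono hcov).trans (measure_iUnion_le _)
      _ ≤ ∑' a, lam * volume (mcell p a) := by
        refine ENNReal.tsum_le_tsum fun a => ?_
        rcases (mcell p a).eq_empty_or_nonempty with h | h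
        · simp [h]
        · rw [mcell_eq _ _ h]
          obtain ⟨x, h1, ⟨h2, y, hy1, hy2⟩, h3⟩ := h
          by_contra hc
          push Not at hc
          have : y ∈ E ∩ heavyS σ lam := ⟨hy2, by
            simp only [heavyS, Set.mem_iUnion]
            exact ⟨a.1, a.2, hc, dcell_sub_tcell _ _ hy1⟩⟩
          rw [hE] at this; exact this
      _ = lam * volume (⋃ a, mcell p a) := by
        rw [ENNReal.tsum_mul_left, measure_iUnion (mcell_disj p) (mcell_meas p)]
      _ ≤ lam * volume G := by
        gcongr
        refine Set.iUnion_subset fun a x hx => hx.2.1.1 hx.1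
  rcases eq_or_ne lam 0 with h0 | h0
  · have := key Set.univ isOpen_univ (Set.subset_univ _)
    simpa [h0] using this
  · rw [mul_comm, ← ENNReal.div_le_iff_le_mul (Or.inl h0) (Or.inl ht), Set.measure_eq_iInf_isOpen E volume]
    refine le_iInf fun G => le_iInf fun h1 => le_iInf fun h2 => ?_
    rw [ENNReal.div_le_iff_le_mul (Or.inl h0) (Or.inl ht), mul_comm]
    exact key G h2 h1
end dyadic
section
section oscl
open scoped ENNReal
variable {n : ℕ}
def ksc (R : ℝ) (K : Dom n → ℝ) (x : Dom n) : ℝ := R ^ n * K (R • x)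
lemma integral_ksc {R : ℝ} (hR : 0 < R) (f : Dom n → ℝ) : ∫ x, R ^ n * f (R • x) = ∫ x, f x := by
  rw [integral_const_mul, Measure.integral_comp_smul]
  simp only [Module.finrank_fin_fun, smul_eq_mul]
  rw [abs_of_pos (by positivity), ← mul_assoc, mul_inv_cancel₀ (by positivity), one_mul]
lemma integrable_ksc {R : ℝ} (hR : 0 < R) {f : Dom n → ℝ} (hf : Integrable f) :
    Integrable (fun x => R ^ n * f (R • x)) :=
  (hf.comp_smul hR.ne').const_mul _
lemma ksc_bdd {K : Dom n → ℝ} (hK : BddDer K) (R : ℝ) : BddDer (ksc R K) := by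
  have e : (fun x => K (R • x)) = fun x => K (R • (x - 0)) := by simp
  have hs : Sm (fun x => K (R • x)) := by rw [e]; exact hK.1.affine R 0
  have e2 : ksc R K = fun x => R ^ n • (fun x => K (R • x)) x := rfl
  refine ⟨contDiff_const.mul hs, fun w => ?_⟩
  obtain ⟨C, hC⟩ := hK.2 w
  refine ⟨|R ^ n| * (|R ^ w.length| * C), fun x => ?_⟩
  rw [e2, wd_const_smul hs, e, wd_affine hK.1]
  simp only [smul_eq_mul, abs_mul]
  gcongr
  exact hC _
lemma ksc_wd {K : Dom n → ℝ} (hK : Sm K) (R : ℝ) (w : List (Fin n)) :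
    wd w (ksc R K) = fun x => R ^ w.length * ksc R (wd w K) x := by
  have e : (fun x => K (R • x)) = fun x => K (R • (x - 0)) := by simp
  have hs : Sm (fun x => K (R • x)) := by rw [e]; exact hK.affine R 0
  have e2 : ksc R K = fun x => R ^ n • (fun x => K (R • x)) x := rfl
  rw [e2, wd_const_smul hs, e, wd_affine hK]
  funext x
  simp [ksc]; ring
lemma dsum_eq (K : Dom n → ℝ) (J : ℕ) (x : Dom n) : dsum K J x = ∑ j ∈ Finset.range J, ksc (2 ^ j) K x := by
  simp [dsum, ksc]
lemma BddDer.int {K : Dom n → ℝ} (hK : BddDer K) (s : Measure (Dom n)) [IsFiniteMeasure s] (x : Dom n) :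
    Integrable (fun y => K (x - y)) s := by
  obtain ⟨C, hC⟩ := hK.2 []
  exact Integrable.mono' (integrable_const C)
    (hK.1.continuous.comp (continuous_const.sub continuous_id)).aestronglyMeasurable
      (Eventually.of_forall fun y => hC _)
lemma convm_dsum {K : Dom n → ℝ} (hK : BddDer K) (J : ℕ) (s : Measure (Dom n)) [IsFiniteMeasure s] (x : Dom n) :
    convm (dsum K J) s x = ∑ j ∈ Finset.range J, convm (ksc (2 ^ j) K) s x := by
  simp only [convm, dsum_eq]
  rw [integral_finsetSum]
  intro j _
  exact (ksc_bdd hK _).int s x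
lemma convm_dsum_cont {K : Dom n → ℝ} (hK : BddDer K) (J : ℕ) (s : Measure (Dom n)) [IsFiniteMeasure s] :
    Continuous (convm (dsum K J) s) := by
  rw [show convm (dsum K J) s = _ from funext fun x => convm_dsum hK J s x]
  exact continuous_finsetSum _ fun j _ => (convm_smooth (ksc_bdd hK _) s).continuous
lemma int_bracket : Integrable (fun x : Dom n => ((1 + ‖x‖) ^ (n + 1))⁻¹) := by
  have := integrable_one_add_norm (E := Dom n) (μ := volume) (r := (n + 1 : ℕ)) (by simp)
  refine this.congr (Eventually.of_forall fun x => ?_)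
  simp only
  rw [Real.rpow_neg (by positivity), Real.rpow_natCast]
lemma Sch.transl {K : Dom n → ℝ} (hK : Sch K) : ∃ B, 0 ≤ B ∧ ∀ h : Dom n, ‖h‖ ≤ 1 →
    ∫ z, |K z - K (z + h)| ≤ B * ‖h‖ := by
  choose C hC0 hC using fun j : Fin n => (hK.wd [j]).decay (n + 1)
  set C1 := ∑ j, C j
  have hC1 : 0 ≤ C1 := Finset.sum_nonneg fun j _ => hC0 j
  have hd : ∀ x, ‖fderiv ℝ K x‖ ≤ C1 * ((1 + ‖x‖) ^ (n + 1))⁻¹ := by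
    intro x
    refine (clm_norm_le _).trans ?_
    rw [Finset.sum_mul]
    refine Finset.sum_le_sum fun j _ => ?_
    rw [← div_eq_mul_inv, le_div_iff₀ (by positivity)]
    exact hC j x
  refine ⟨∫ z : Dom n, C1 * 2 ^ (n+1) * ((1 + ‖z‖) ^ (n + 1))⁻¹, by positivity, fun h hh => ?_⟩
  rw [← integral_mul_const]
  refine integral_mono_of_nonneg (Eventually.of_forall fun z => abs_nonneg _)
    ((int_bracket.const_mul _).mul_const _) (Eventually.of_forall fun z => ?_)
  have := Convex.norm_image_sub_le_of_norm_fderiv_le (𝕜 := ℝ) (f := K) (s := segment ℝ z (z + h))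
    (C := C1 * 2 ^ (n+1) * ((1 + ‖z‖) ^ (n + 1))⁻¹) (x := z + h) (y := z)
    (fun x _ => hK.sm.diff x) ?_ (convex_segment _ _) (right_mem_segment _ _ _) (left_mem_segment _ _ _)
  · simpa [Real.norm_eq_abs] using this
  · intro x hx
    refine (hd x).trans ?_
    rw [mul_assoc]
    gcongr
    rw [← div_eq_mul_inv, inv_le_comm₀ (by positivity) (by positivity), inv_div, ← div_pow]
    gcongr
    rw [div_le_iff₀ (by norm_num)]
    obtain ⟨θ, ⟨h0, h1⟩, rfl⟩ := (segment_eq_image' ℝ z (z+h)) ▸ hx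
    have e : z = (z + θ • (z + h - z)) - θ • h := by simp
    have : ‖z‖ ≤ ‖z + θ • (z + h - z)‖ + ‖θ • h‖ := by
      conv_lhs => rw [e]
      exact norm_sub_le _ _
    rw [norm_smul, Real.norm_of_nonneg h0] at this
    have h3 : θ * ‖h‖ ≤ 1 := mul_le_one₀ h1 (norm_nonneg _) hh
    have h4 := norm_nonneg (z + θ • (z + h - z))
    linarith
lemma Sch.moment {K : Dom n → ℝ} (hK : Sch K) : Integrable (fun z => ‖z‖ * |K z|) := by
  obtain ⟨C, hC0, hC⟩ := hK.decay (n + 2)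
  refine Integrable.mono' (int_bracket.const_mul C)
    (continuous_norm.mul hK.sm.continuous.abs).aestronglyMeasurable (Eventually.of_forall fun z => ?_)
  rw [Real.norm_of_nonneg (by positivity), ← div_eq_mul_inv, le_div_iff₀ (by positivity)]
  refine le_trans ?_ (hC z)
  rw [pow_succ (1 + ‖z‖) (n+1)]
  have h1 : ‖z‖ ≤ 1 + ‖z‖ := by linarith
  have : 0 ≤ |K z| * (1 + ‖z‖) ^ (n+1) := by positivity
  nlinarith
lemma lev1 {K : Dom n → ℝ} (hK : Sch K) {B : ℝ} (hB : ∀ h : Dom n, ‖h‖ ≤ 1 →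
    ∫ z, |K z - K (z + h)| ≤ B * ‖h‖) {R : ℝ} (hR : 0 < R) (S : Set (Dom n)) (x x' : Dom n)
    (hx : R * ‖x' - x‖ ≤ 1) :
    |convm (ksc R K) (volume.restrict S) x - convm (ksc R K) (volume.restrict S) x'| ≤ B * (R * ‖x' - x‖) := by
  have hi : ∀ x, Integrable (fun y => ksc R K (x - y)) := fun x =>
    (integrable_ksc hR hK.integrable).comp_sub_left x
  unfold convm
  rw [← integral_sub (hi x).restrict (hi x').restrict]
  refine (abs_integral_le_integral_abs).trans ?_
  refine (setIntegral_le_integral ((hi x).sub (hi x')).abs (Eventually.of_forall fun y => abs_nonneg _)).trans ?_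
  have e1 : ∫ y, |ksc R K (x - y) - ksc R K (x' - y)| = ∫ y, |ksc R K y - ksc R K (y + (x' - x))| := by
    rw [← integral_sub_left_eq_self _ volume x]
    congr 1; funext y; congr 3 <;> abel
  have e2 : (fun y => |ksc R K y - ksc R K (y + (x' - x))|) =
      fun y => R ^ n * (fun z => |K z - K (z + R • (x' - x))|) (R • y) := by
    funext y
    simp only [ksc]
    rw [← mul_sub, abs_mul, abs_of_pos (pow_pos hR n), smul_add]
  refine (le_of_eq (?_ : _ = ∫ y, |ksc R K (x - y) - ksc R K (x' - y)|)).trans ?_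
  · rfl
  rw [e1, e2, integral_ksc hR (fun z => |K z - K (z + R • (x' - x))|)]
  have := hB (R • (x' - x)) (by rw [norm_smul, Real.norm_of_nonneg hR.le]; exact hx)
  rwa [norm_smul, Real.norm_of_nonneg hR.le] at this
lemma lev2 {K : Dom n → ℝ} (hK : Sch K) (h0 : ∫ z, K z = 0) {R r : ℝ} (hR : 0 < R) (hr : 0 < r)
    {S : Set (Dom n)} (hS : MeasurableSet S) (x : Dom n) (hb : ∀ y, ‖x - y‖ < r → y ∈ S) :
    |convm (ksc R K) (volume.restrict S) x| ≤ (∫ z, ‖z‖ * |K z|) * (R * r)⁻¹ := by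
  have hi : Integrable (fun y => ksc R K (x - y)) := (integrable_ksc hR hK.integrable).comp_sub_left x
  have h1 : ∫ y, ksc R K (x - y) = 0 := by
    rw [integral_sub_left_eq_self (ksc R K) volume x]
    exact (integral_ksc hR K).trans h0
  have h2 := integral_add_compl hS hi
  rw [h1] at h2
  have h3 : convm (ksc R K) (volume.restrict S) x = - ∫ y in Sᶜ, ksc R K (x - y) := by
    unfold convm; linarith
  rw [h3, abs_neg]
  have hm : Integrable (fun y => r⁻¹ * (‖x - y‖ * |ksc R K (x - y)|)) ∧
      ∫ y, r⁻¹ * (‖x - y‖ * |ksc R K (x - y)|) = (∫ z, ‖z‖ * |K z|) * (R * r)⁻¹ := by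
    have e : (fun y => ‖y‖ * |ksc R K y|) = fun y => R⁻¹ * (R ^ n * (fun z => ‖z‖ * |K z|) (R • y)) := by
      funext y
      simp only [ksc, norm_smul, abs_mul, abs_of_pos (pow_pos hR n), Real.norm_of_nonneg hR.le]
      field_simp
    have hI : Integrable (fun y => ‖y‖ * |ksc R K y|) := by
      rw [e]; exact (integrable_ksc hR hK.moment).const_mul _
    refine ⟨(hI.comp_sub_left x).const_mul _, ?_⟩
    rw [integral_const_mul, integral_sub_left_eq_self (fun y => ‖y‖ * |ksc R K y|) volume x, e, integral_const_mul,
      integral_ksc hR (fun z => ‖z‖ * |K z|), mul_inv]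
    ring
  rw [← hm.2]
  refine (abs_integral_le_integral_abs).trans ?_
  refine le_trans ?_ (setIntegral_le_integral (s := Sᶜ) hm.1 (Eventually.of_forall fun y => by positivity))
  refine setIntegral_mono_on hi.abs.integrableOn hm.1.integrableOn hS.compl fun y hy => ?_
  have : r ≤ ‖x - y‖ := by
    by_contra hc; exact hy (hb y (not_le.1 hc))
  rw [← mul_assoc]
  refine le_mul_of_one_le_left (abs_nonneg _) ?_
  rw [← div_eq_inv_mul, one_le_div hr]; exact this
lemma geo_sum (q J : ℕ) : ∑ j ∈ Finset.range J, (2⁻¹:ℝ) ^ ((q - j) + (j - q)) ≤ 4 := by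
  have hg : ∀ m, ∑ j ∈ Finset.range m, (2⁻¹:ℝ) ^ j ≤ 2 := by
    intro m
    rw [geom_sum_eq (by norm_num)]
    have : (0:ℝ) < 2⁻¹ ^ m := by positivity
    rw [div_le_iff_of_neg (by norm_num)]; linarith
  calc ∑ j ∈ Finset.range J, (2⁻¹:ℝ) ^ ((q - j) + (j - q))
      ≤ ∑ j ∈ Finset.range ((q+1) + J), (2⁻¹:ℝ) ^ ((q - j) + (j - q)) := by
        apply Finset.sum_le_sum_of_subset_of_nonneg
        · intro j hj; simp at hj ⊢; omega
        · intros; positivity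
    _ = ∑ j ∈ Finset.range (q+1), (2⁻¹:ℝ) ^ ((q - j) + (j - q)) + ∑ i ∈ Finset.range J, (2⁻¹:ℝ) ^ (i + 1) := by
        rw [Finset.sum_range_add]
        congr 1
        refine Finset.sum_congr rfl fun i _ => ?_
        congr 1; omega
    _ ≤ 2 + 2 := by
        gcongr
        · have e : ∑ j ∈ Finset.range (q+1), (2⁻¹:ℝ) ^ ((q - j) + (j - q)) = ∑ j ∈ Finset.range (q+1), (2⁻¹:ℝ) ^ j := by
            rw [← Finset.sum_range_reflect]
            refine Finset.sum_congr rfl fun i hi => ?_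
            simp at hi
            congr 1; omega
          rw [e]; exact hg _
        · refine le_trans (Finset.sum_le_sum fun i _ => ?_) (hg J)
          exact pow_le_pow_of_le_one (by norm_num) (by norm_num) (by omega)
    _ = 4 := by norm_num
lemma osc_bound {K : Dom n → ℝ} (hK : Sch K) (h0 : ∫ z, K z = 0) : ∃ B, 0 ≤ B ∧
    ∀ (S : Set (Dom n)), MeasurableSet S → volume S ≠ ⊤ → ∀ (q J : ℕ) (x x' : Dom n),
      (∀ y, ‖x - y‖ < ((2:ℝ) ^ q)⁻¹ → y ∈ S) → (∀ y, ‖x' - y‖ < ((2:ℝ) ^ q)⁻¹ → y ∈ S) →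
      ‖x' - x‖ ≤ ((2:ℝ) ^ q)⁻¹ →
      |convm (dsum K J) (volume.restrict S) x - convm (dsum K J) (volume.restrict S) x'| ≤ B := by
  obtain ⟨B1, hB1, hB⟩ := hK.transl
  set B2 := ∫ z, ‖z‖ * |K z| with hB2
  have hB2' : 0 ≤ B2 := by positivity
  refine ⟨(B1 + 2 * B2) * 4, by positivity, fun S hS hfin q J x x' hx hx' hxx => ?_⟩
  have : IsFiniteMeasure (volume.restrict S) := ⟨by rw [Measure.restrict_apply_univ]; exact hfin.lt_top⟩
  rw [convm_dsum hK.bdd, convm_dsum hK.bdd, ← Finset.sum_sub_distrib]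
  refine (Finset.abs_sum_le_sum_abs _ _).trans ?_
  refine le_trans (Finset.sum_le_sum (g := fun j => (B1 + 2 * B2) * (2⁻¹:ℝ) ^ ((q - j) + (j - q))) fun j _ => ?_) ?_
  · rcases le_total j q with h | h
    · have e : (2:ℝ) ^ j * ((2:ℝ)^q)⁻¹ = 2⁻¹ ^ ((q - j) + (j - q)) := by
        rw [show (q - j) + (j - q) = q - j by omega, inv_pow, pow_sub₀ _ (by norm_num) h]
        field_simp
      have h1 : (2:ℝ) ^ j * ‖x' - x‖ ≤ 2⁻¹ ^ ((q - j) + (j - q)) := by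
        rw [← e]; gcongr
      have h2 : (2⁻¹:ℝ) ^ ((q - j) + (j - q)) ≤ 1 := pow_le_one₀ (by norm_num) (by norm_num)
      refine (lev1 hK hB (by positivity) S x x' (h1.trans h2)).trans ?_
      gcongr
      linarith
    · have e : ((2:ℝ) ^ j * ((2:ℝ)^q)⁻¹)⁻¹ = 2⁻¹ ^ ((q - j) + (j - q)) := by
        rw [show (q - j) + (j - q) = j - q by omega, inv_pow, pow_sub₀ _ (by norm_num) h]
      refine (abs_sub _ _).trans ?_
      have l1 := lev2 hK h0 (R := 2 ^ j) (by positivity) (by positivity) hS x hx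
      have l2 := lev2 hK h0 (R := 2 ^ j) (by positivity) (by positivity) hS x' hx'
      rw [e] at l1 l2
      have : 0 ≤ B1 * (2⁻¹:ℝ) ^ ((q - j) + (j - q)) := by positivity
      rw [add_mul, mul_assoc 2]
      linarith
  · rw [← Finset.mul_sum]
    gcongr
    exact geo_sum q J
end oscl
section
section starl
open scoped ENNReal
variable {n : ℕ}
def L2Prop (K : Dom n → ℝ) (C : ℝ) : Prop := ∀ (J : ℕ) (h : Dom n → ℝ), Sm h → HasCompactSupport h →
  Integrable (fun x => (∫ y, dsum K J (x - y) * h y) ^ 2) ∧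
    ∫ x, (∫ y, dsum K J (x - y) * h y) ^ 2 ≤ C * ∫ x, h x ^ 2
lemma dsum_cont {K : Dom n → ℝ} (hK : Continuous K) (J : ℕ) : Continuous (dsum K J) := by
  unfold dsum; fun_prop
lemma dsum_bdd {K : Dom n → ℝ} (hK : BddDer K) (J : ℕ) : ∃ C, 0 ≤ C ∧ ∀ x, |dsum K J x| ≤ C := by
  choose C hC using fun j : ℕ => (ksc_bdd hK (2 ^ j)).2 []
  refine ⟨∑ j ∈ Finset.range J, |C j|, by positivity, fun x => ?_⟩
  rw [dsum_eq]
  exact (Finset.abs_sum_le_sum_abs _ _).trans (Finset.sum_le_sum fun j _ => (hC j x).trans (le_abs_self _))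
lemma smooth_approx {S : Set (Dom n)} (hS : IsOpen S) (hb : Bornology.IsBounded S) :
    ∃ h : ℕ → Dom n → ℝ, (∀ i, Sm (h i) ∧ HasCompactSupport (h i)) ∧ (∀ i x, 0 ≤ h i x ∧ h i x ≤ S.indicator (fun _ => 1) x) ∧
      ∀ x, Tendsto (fun i => h i x) atTop (𝓝 (S.indicator (fun _ => 1) x)) := by
  obtain ⟨f, hf1, hf2, hf3⟩ := hS.exists_contDiff_support_eq (n := ⊤)
  have hf0 : ∀ x, 0 ≤ f x := fun x => (hf3 ⟨x, rfl⟩).1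
  have hz : ∀ x, x ∉ S → f x = 0 := fun x hx => by
    rw [← hf1] at hx; exact Function.notMem_support.1 hx
  refine ⟨fun i x => Real.smoothTransition (i * f x), fun i => ⟨?_, ?_⟩, fun i x => ⟨Real.smoothTransition.nonneg _, ?_⟩, fun x => ?_⟩
  · exact Real.smoothTransition.contDiff.comp (contDiff_const.mul hf2)
  · refine HasCompactSupport.of_support_subset_isCompact (hb.isCompact_closure) ?_
    intro x hx
    apply subset_closure
    by_contra hc
    rw [Function.mem_support] at hx
    exact hx (by show Real.smoothTransition (i * f x) = 0; rw [hz x hc, mul_zero]; exact Real.smoothTransition.zero_of_nonpos le_rfl)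
  · by_cases h : x ∈ S
    · simp [h, Real.smoothTransition.le_one]
    · simp [h, hz x h, Real.smoothTransition.zero_of_nonpos]
  · by_cases h : x ∈ S
    · have hp : 0 < f x := lt_of_le_of_ne (hf0 x) (by rw [← hf1] at h; exact (Function.mem_support.1 h).symm)
      obtain ⟨N, hN⟩ := exists_nat_gt (1 / f x)
      refine tendsto_const_nhds.congr' ?_
      filter_upwards [eventually_ge_atTop N] with i hi
      simp only [h, Set.indicator_of_mem]
      rw [Real.smoothTransition.one_of_one_le]
      have : (N:ℝ) ≤ i := by exact_mod_cast hi
      rw [div_lt_iff₀ hp] at hN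
      nlinarith
    · simp [h, hz x h, Real.smoothTransition.zero_of_nonpos]
lemma L2_ind {K : Dom n → ℝ} (hK : Sch K) {C : ℝ} (hC0 : 0 ≤ C) (hL : L2Prop K C)
    {S : Set (Dom n)} (hS : IsOpen S) (hb : Bornology.IsBounded S) (J : ℕ) :
    ∫⁻ x, ENNReal.ofReal ((convm (dsum K J) (volume.restrict S) x) ^ 2) ≤ ENNReal.ofReal C * volume S := by
  obtain ⟨h, h1, h2, h3⟩ := smooth_approx hS hb
  have hfin : volume S ≠ ⊤ := hb.measure_lt_top.ne
  have hindI : Integrable (S.indicator (fun _ => (1:ℝ))) :=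
    (integrable_indicator_iff hS.measurableSet).2 (integrableOn_const hfin)
  obtain ⟨D, hD0, hD⟩ := dsum_bdd hK.bdd J
  have hdc := dsum_cont hK.sm.continuous J
  have hlim : ∀ x, Tendsto (fun i => ENNReal.ofReal ((∫ y, dsum K J (x - y) * h i y) ^ 2)) atTop
      (𝓝 (ENNReal.ofReal ((convm (dsum K J) (volume.restrict S) x) ^ 2))) := by
    intro x
    refine ENNReal.tendsto_ofReal (Tendsto.pow ?_ 2)
    have e : convm (dsum K J) (volume.restrict S) x = ∫ y, dsum K J (x - y) * S.indicator (fun _ => 1) y := by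
      unfold convm
      rw [← integral_indicator hS.measurableSet]
      congr 1; funext y
      by_cases hy : y ∈ S <;> simp [hy]
    rw [e]
    refine tendsto_integral_of_dominated_convergence (fun y => D * S.indicator (fun _ => 1) y) ?_ (hindI.const_mul D) ?_ ?_
    · intro i
      exact ((hdc.comp (continuous_const.sub continuous_id)).mul (h1 i).1.continuous).aestronglyMeasurable
    · intro i
      refine Eventually.of_forall fun y => ?_
      rw [norm_mul, Real.norm_eq_abs, Real.norm_of_nonneg (h2 i y).1]
      exact mul_le_mul (hD _) (h2 i y).2 (h2 i y).1 hD0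
    · exact Eventually.of_forall fun y => (h3 y).const_mul _
  have hbd : ∀ i, ∫⁻ x, ENNReal.ofReal ((∫ y, dsum K J (x - y) * h i y) ^ 2) ≤ ENNReal.ofReal C * volume S := by
    intro i
    obtain ⟨a, b⟩ := hL J (h i) (h1 i).1 (h1 i).2
    rw [← ofReal_integral_eq_lintegral_ofReal a (Eventually.of_forall fun x => sq_nonneg _)]
    have : ∫ x, h i x ^ 2 ≤ (volume S).toReal := by
      calc ∫ x, h i x ^ 2 ≤ ∫ x, S.indicator (fun _ => (1:ℝ)) x := by
            refine integral_mono_of_nonneg (Eventually.of_forall fun x => sq_nonneg _) hindI (Eventually.of_forall fun x => ?_)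
            have a1 := (h2 i x).1
            have a2 := (h2 i x).2
            have a3 : S.indicator (fun _ => (1:ℝ)) x ≤ 1 := Set.indicator_le_self' (fun _ _ => by norm_num) x
            simp only
            nlinarith
        _ = _ := by rw [integral_indicator hS.measurableSet]; simp [Measure.real]
    rw [← ENNReal.ofReal_toReal hfin, ← ENNReal.ofReal_mul hC0]
    exact ENNReal.ofReal_le_ofReal (b.trans (by gcongr))
  calc ∫⁻ x, ENNReal.ofReal ((convm (dsum K J) (volume.restrict S) x) ^ 2)
      = ∫⁻ x, liminf (fun i => ENNReal.ofReal ((∫ y, dsum K J (x - y) * h i y) ^ 2)) atTop := by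
        congr 1; funext x; exact (hlim x).liminf_eq.symm
    _ ≤ liminf (fun i => ∫⁻ x, ENNReal.ofReal ((∫ y, dsum K J (x - y) * h i y) ^ 2)) atTop := by
        refine lintegral_liminf_le' fun i => ?_
        exact (hL J (h i) (h1 i).1 (h1 i).2).1.aestronglyMeasurable.aemeasurable.ennreal_ofReal
    _ ≤ _ := by
        refine Filter.liminf_le_of_le (by isBoundedDefault) fun b hb => ?_
        obtain ⟨i, hi⟩ := hb.exists
        exact hi.trans (hbd i)
lemma heavyS_bdd (σ : Measure (Dom n)) (lam : ℝ≥0∞) {E : Set (Dom n)} (hE : Bornology.IsBounded E) (h : σ Eᶜ = 0) :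
    Bornology.IsBounded (heavyS σ lam) := by
  refine (hE.cthickening (δ := 3)).subset fun y hy => ?_
  simp only [heavyS, Set.mem_iUnion] at hy
  obtain ⟨j, v, hv, hy⟩ := hy
  have : (dcell j v ∩ E).Nonempty := by
    by_contra hc
    rw [Set.not_nonempty_iff_eq_empty] at hc
    have : σ (dcell j v) = 0 := by
      refine measure_mono_null (t := Eᶜ) (fun x hx => fun hxE => ?_) h
      exact (hc ▸ (⟨hx, hxE⟩ : x ∈ dcell j v ∩ E) : x ∈ (∅ : Set (Dom n)))
    unfold heavy at hv
    rw [this] at hv; exact not_lt_zero hv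
  obtain ⟨x, hx, hxE⟩ := this
  refine Metric.mem_cthickening_of_dist_le y x 3 E hxE ?_
  rw [dist_comm, dist_eq_norm]
  refine (tcell_dist hx hy).trans ?_
  have : ((2:ℝ)^j)⁻¹ ≤ 1 := inv_le_one_of_one_le₀ (one_le_pow₀ (by norm_num))
  linarith
lemma heavyS_whitney (σ : Measure (Dom n)) (lam : ℝ≥0∞) :
    ⋃ a, mcell (fun j v => tcell j v ⊆ heavyS σ lam) a = heavyS σ lam := by
  rw [mcell_union]
  apply Set.Subset.antisymm
  · rintro x ⟨j, hj⟩
    exact hj (dcell_sub_tcell _ _ (dix_mem j x))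
  · intro x hx
    obtain ⟨r, hr, hb⟩ := Metric.isOpen_iff.1 (heavyS_open σ lam) x hx
    obtain ⟨j, hj⟩ := exists_pow_lt_of_lt_one (show 0 < r / 2 by positivity) (show (2⁻¹:ℝ) < 1 by norm_num)
    refine ⟨j, fun y hy => hb ?_⟩
    rw [Metric.mem_ball, dist_comm, dist_eq_norm]
    refine (tcell_dist (dix_mem j x) hy).trans_lt ?_
    rw [← inv_pow]; linarith
lemma whitney_light (σ : Measure (Dom n)) (lam : ℝ≥0∞) (hl : σ Set.univ ≤ lam) (a : ℕ × (Fin n → ℤ))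
    (hne : (mcell (fun j v => tcell j v ⊆ heavyS σ lam) a).Nonempty) :
    σ (dcell a.1 a.2) ≤ 2 ^ n * (lam * volume (dcell a.1 a.2)) := by
  obtain ⟨x, h1, h2, h3⟩ := hne
  obtain ⟨j, v⟩ := a
  simp only at *
  cases j with
  | zero =>
    have : volume (dcell 0 v) = 1 := by rw [dcell_vol]; simp
    rw [this, mul_one]
    refine ((measure_mono (Set.subset_univ _)).trans hl).trans ?_
    refine le_mul_of_one_le_left (by simp) (one_le_pow₀ (by norm_num))
  | succ j =>
    have h4 := h3 j (Nat.lt_succ_self j)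
    have h5 : ¬ heavy σ lam j (dix j x) := by
      intro hh; apply h4
      intro y hy
      simp only [heavyS, Set.mem_iUnion]
      exact ⟨j, _, hh, hy⟩
    unfold heavy at h5
    push Not at h5
    have h6 : dcell (j+1) v ⊆ dcell j (dix j x) := by
      intro y hy
      exact dix_anc (Nat.le_succ j) ((show dix (j+1) y = v from hy).trans h1.symm)
    refine (measure_mono h6).trans (h5.trans (le_of_eq ?_))
    rw [dcell_vol_succ j _ v]; ring
lemma star {K : Dom n → ℝ} (hK : Sch K) (h0 : ∫ z, K z = 0) {C : ℝ} (hC0 : 0 ≤ C) (hL : L2Prop K C) :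
    ∃ C' : ℝ, 0 ≤ C' ∧ ∀ (σ : Measure (Dom n)) (lam : ℝ≥0∞), lam ≠ ⊤ → σ Set.univ ≤ lam →
      Bornology.IsBounded (heavyS σ lam) → ∀ J,
      ∫⁻ x, ENNReal.ofReal ((convm (dsum K J) (volume.restrict (heavyS σ lam)) x) ^ 2) ∂σ ≤
        ENNReal.ofReal C' * σ Set.univ := by
  obtain ⟨B, hB0, hB⟩ := osc_bound hK h0
  refine ⟨(1 + 2 ^ (n+1)) * (C * 3 ^ n) + 2 * B ^ 2, by positivity, fun σ lam ht hl hb J => ?_⟩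
  set S := heavyS σ lam with hS
  have hSo : IsOpen S := heavyS_open σ lam
  have hfin : volume S ≠ ⊤ := hb.measure_lt_top.ne
  have : IsFiniteMeasure (volume.restrict S) := ⟨by rw [Measure.restrict_apply_univ]; exact hfin.lt_top⟩
  set f := convm (dsum K J) (volume.restrict S) with hf
  have hfc : Continuous f := convm_dsum_cont hK.bdd J _
  set F : Dom n → ℝ≥0∞ := fun x => ENNReal.ofReal (f x ^ 2) with hF
  have hFm : Measurable F := (hfc.pow 2).measurable.ennreal_ofReal
  have hL2 : ∫⁻ x, F x ≤ ENNReal.ofReal C * volume S := L2_ind hK hC0 hL hSo hb J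
  have hlL2 : lam * ∫⁻ x, F x ≤ ENNReal.ofReal (C * 3 ^ n) * σ Set.univ := by
    calc lam * ∫⁻ x, F x ≤ lam * (ENNReal.ofReal C * volume S) := by gcongr
      _ = ENNReal.ofReal C * (lam * volume S) := by ring
      _ ≤ ENNReal.ofReal C * (3 ^ n * σ Set.univ) := by exact mul_le_mul_right (heavyS_vol σ lam) _
      _ = _ := by
        rw [ENNReal.ofReal_mul hC0, ENNReal.ofReal_pow (by norm_num)]; simp; ring
  have hout : ∫⁻ x in Sᶜ, F x ∂σ ≤ lam * ∫⁻ x, F x := by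
    have hle : σ.restrict Sᶜ ≤ lam • (volume : Measure (Dom n)) := by
      rw [Measure.le_iff]
      intro s hs
      rw [Measure.restrict_apply hs, Measure.smul_apply, smul_eq_mul]
      refine (heavyS_compl σ lam ht (s ∩ Sᶜ) ?_).trans ?_
      · rw [Set.inter_assoc, Set.compl_inter_self, Set.inter_empty]
      · gcongr; exact Set.inter_subset_left
    refine (lintegral_mono' hle le_rfl).trans ?_
    rw [lintegral_smul_measure, smul_eq_mul]
  set p : ℕ → (Fin n → ℤ) → Prop := fun j v => tcell j v ⊆ heavyS σ lam with hp
  have hin : ∫⁻ x in S, F x ∂σ ≤ 2 ^ (n+1) * (lam * ∫⁻ x, F x) + ENNReal.ofReal (2 * B ^ 2) * σ Set.univ := by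
    have hcell : ∀ a, ∫⁻ x in mcell p a, F x ∂σ ≤
        2 ^ (n+1) * (lam * ∫⁻ x in mcell p a, F x) + ENNReal.ofReal (2 * B ^ 2) * σ (mcell p a) := by
      intro a
      rcases (mcell p a).eq_empty_or_nonempty with h | h
      · simp [h]
      · have hw := whitney_light σ lam hl a h
        have hsub : tcell a.1 a.2 ⊆ S := by obtain ⟨x, h1, h2, h3⟩ := h; exact h2
        rw [mcell_eq p a h]
        set Q := dcell a.1 a.2 with hQ
        have hv0 : volume Q ≠ 0 := dcell_pos _ _
        have hvt : volume Q ≠ ⊤ := dcell_top _ _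
        have hpt : ∀ x ∈ Q, ∀ x' ∈ Q, F x ≤ 2 * F x' + ENNReal.ofReal (2 * B ^ 2) := by
          intro x hx x' hx'
          have := hB S hSo.measurableSet hfin a.1 J x x' (fun y hy => hsub (ball_sub_tcell hx hy))
            (fun y hy => hsub (ball_sub_tcell hx' hy)) (dcell_dist hx' hx)
          simp only [hF]
          rw [show (2:ℝ≥0∞) = ENNReal.ofReal 2 by simp, ← ENNReal.ofReal_mul (by norm_num),
            ← ENNReal.ofReal_add (by positivity) (by positivity)]
          apply ENNReal.ofReal_le_ofReal
          have h2 : (f x - f x') ^ 2 ≤ B ^ 2 := by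
            rw [← sq_abs]; exact pow_le_pow_left₀ (abs_nonneg _) this 2
          nlinarith [sq_nonneg (f x - 2 * f x')]
        have hx1 : ∀ x ∈ Q, F x * volume Q ≤ 2 * (∫⁻ x' in Q, F x') + ENNReal.ofReal (2 * B ^ 2) * volume Q := by
          intro x hx
          calc F x * volume Q = ∫⁻ x' in Q, F x := by rw [setLIntegral_const]
            _ ≤ ∫⁻ x' in Q, (2 * F x' + ENNReal.ofReal (2 * B ^ 2)) :=
              setLIntegral_mono' (dcell_meas _ _) fun x' hx' => hpt x hx x' hx'
            _ = _ := by
              rw [lintegral_add_right _ measurable_const, lintegral_const_mul _ hFm, setLIntegral_const]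
        have hx2 : (∫⁻ x in Q, F x ∂σ) * volume Q ≤
            (2 ^ (n+1) * (lam * ∫⁻ x in Q, F x) + ENNReal.ofReal (2 * B ^ 2) * σ Q) * volume Q := by
          calc (∫⁻ x in Q, F x ∂σ) * volume Q = ∫⁻ x in Q, F x * volume Q ∂σ := by
                rw [lintegral_mul_const _ hFm]
            _ ≤ ∫⁻ x in Q, (2 * (∫⁻ x' in Q, F x') + ENNReal.ofReal (2 * B ^ 2) * volume Q) ∂σ :=
              setLIntegral_mono' (dcell_meas _ _) fun x hx => hx1 x hx
            _ = 2 * (∫⁻ x' in Q, F x') * σ Q + ENNReal.ofReal (2 * B ^ 2) * volume Q * σ Q := by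
              rw [setLIntegral_const, add_mul]
            _ ≤ 2 * (∫⁻ x' in Q, F x') * (2 ^ n * (lam * volume Q)) + ENNReal.ofReal (2 * B ^ 2) * volume Q * σ Q := by
              gcongr
            _ = _ := by ring
        exact (ENNReal.mul_le_mul_iff_left hv0 hvt).1 hx2
    have hU : S = ⋃ a, mcell p a := (heavyS_whitney σ lam).symm
    rw [hU, lintegral_iUnion (mcell_meas p) (mcell_disj p)]
    refine (ENNReal.tsum_le_tsum hcell).trans ?_
    rw [ENNReal.tsum_add, ENNReal.tsum_mul_left, ENNReal.tsum_mul_left, ENNReal.tsum_mul_left,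
      ← lintegral_iUnion (mcell_meas p) (mcell_disj p)]
    gcongr
    · exact Measure.restrict_le_self
    · exact tsum_mcell_le σ p
  rw [← lintegral_add_compl F hSo.measurableSet]
  have e : ENNReal.ofReal ((1 + 2 ^ (n+1)) * (C * 3 ^ n) + 2 * B ^ 2) * σ Set.univ =
      2 ^ (n+1) * (ENNReal.ofReal (C * 3 ^ n) * σ Set.univ) + ENNReal.ofReal (2 * B ^ 2) * σ Set.univ
        + ENNReal.ofReal (C * 3 ^ n) * σ Set.univ := by
    rw [ENNReal.ofReal_add (by positivity) (by positivity), ENNReal.ofReal_mul (by positivity),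
      ENNReal.ofReal_add (by positivity) (by positivity), ENNReal.ofReal_pow (by norm_num)]
    simp only [ENNReal.ofReal_one, ENNReal.ofReal_ofNat]
    ring
  rw [e]
  refine add_le_add (hin.trans ?_) (hout.trans hlL2)
  gcongr
end starl
section
section dprl
open scoped ENNReal
variable {n : ℕ}
lemma half_sum (J : ℕ) : ∑ j ∈ Finset.range J, (2⁻¹:ℝ) ^ j ≤ 2 := by
  rw [geom_sum_eq (by norm_num)]
  have : (0:ℝ) < 2⁻¹ ^ J := by positivity
  rw [div_le_iff_of_neg (by norm_num)]; linarith
lemma sml_sum {A B e : ℝ} (hA : 0 ≤ A) (hB : 0 ≤ B) (he : 0 < e) : ∃ v0 > 0, ∀ v, 0 ≤ v → v ≤ v0 →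
    ∀ (J : ℕ) (a : ℕ → ℝ), (∀ j, a j ≤ A) → (∀ j, a j ≤ ((2:ℝ) ^ j) ^ n * (B * v)) →
      ∑ j ∈ Finset.range J, (2⁻¹:ℝ) ^ j * a j ≤ e := by
  obtain ⟨j0, hj0⟩ := exists_pow_lt_of_lt_one (show 0 < e / (4 * (A + 1)) by positivity) (show (2⁻¹:ℝ) < 1 by norm_num)
  have hb : 0 ≤ ((2:ℝ) ^ j0) ^ n * B := by positivity
  refine ⟨e / (4 * (((2:ℝ) ^ j0) ^ n * B + 1)), by positivity, fun v hv hv0 J a h1 h2 => ?_⟩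
  rw [le_div_iff₀ (by positivity)] at hv0
  rw [lt_div_iff₀ (by positivity)] at hj0
  have hX : ((2:ℝ) ^ j0) ^ n * (B * v) ≤ e / 4 := by nlinarith
  have hp : (0:ℝ) < 2⁻¹ ^ j0 := by positivity
  have hY : (2⁻¹:ℝ) ^ j0 * A ≤ e / 4 := by nlinarith
  calc ∑ j ∈ Finset.range J, (2⁻¹:ℝ) ^ j * a j ≤ ∑ j ∈ Finset.range (j0 + J), (2⁻¹:ℝ) ^ j * (if j < j0 then e/4 else A) := by
        refine le_trans (Finset.sum_le_sum (g := fun j => (2⁻¹:ℝ) ^ j * (if j < j0 then e/4 else A)) fun j _ => ?_) ?_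
        · gcongr
          split_ifs with h
          · refine (h2 j).trans (le_trans ?_ hX)
            gcongr
            norm_num
          · exact h1 j
        · apply Finset.sum_le_sum_of_subset_of_nonneg
          · intro j hj; simp at hj ⊢; omega
          · intros; positivity
    _ = ∑ j ∈ Finset.range j0, (2⁻¹:ℝ) ^ j * (e/4) + ∑ i ∈ Finset.range J, (2⁻¹:ℝ) ^ i * ((2⁻¹:ℝ) ^ j0 * A) := by
        rw [Finset.sum_range_add]
        congr 1
        · refine Finset.sum_congr rfl fun j hj => ?_
          rw [if_pos (by simpa using hj)]
        · refine Finset.sum_congr rfl fun j hj => ?_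
          rw [if_neg (by omega), pow_add]; ring
    _ ≤ 2 * (e/4) + 2 * (e/4) := by
        rw [← Finset.sum_mul, ← Finset.sum_mul]
        gcongr
        · exact half_sum _
        · exact half_sum _
    _ = e := by ring
def GJ (m : ℕ) (G : Dom n → ℝ) (J : ℕ) (x : Dom n) : ℝ :=
  ∑ j ∈ Finset.range J, ((2⁻¹:ℝ) ^ j) ^ m * ksc (2 ^ j) G x
lemma GJ_wd {G : Dom n → ℝ} (hG : BddDer G) (m J : ℕ) (w : List (Fin n)) :
    wd w (GJ m G J) = fun x => ∑ j ∈ Finset.range J, ((2⁻¹:ℝ) ^ j) ^ m * (((2:ℝ) ^ j) ^ w.length * ksc (2 ^ j) (wd w G) x) := by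
  have := wd_sum (Finset.range J) (u := fun j x => ((2⁻¹:ℝ) ^ j) ^ m • ksc (2 ^ j) G x)
    (fun j _ => by simp only [smul_eq_mul]; exact contDiff_const.mul (ksc_bdd hG _).1) w
  simp only [smul_eq_mul] at this
  unfold GJ
  rw [this]
  funext x
  refine Finset.sum_congr rfl fun j _ => ?_
  have h := wd_const_smul (ksc_bdd hG (2^j)).1 (((2⁻¹:ℝ) ^ j) ^ m) w
  simp only [smul_eq_mul] at h
  rw [h, ksc_wd hG.1]
lemma GJ_bdd {G : Dom n → ℝ} (hG : BddDer G) (m J : ℕ) : BddDer (GJ m G J) := by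
  refine ⟨?_, fun w => ?_⟩
  · unfold GJ
    exact ContDiff.sum fun j _ => contDiff_const.mul (ksc_bdd hG _).1
  · rw [GJ_wd hG]
    choose C hC using fun j : ℕ => (ksc_bdd (hG.wd w) (2 ^ j)).2 []
    refine ⟨∑ j ∈ Finset.range J, ((2⁻¹:ℝ) ^ j) ^ m * (((2:ℝ) ^ j) ^ w.length * C j), fun x => ?_⟩
    refine (Finset.abs_sum_le_sum_abs _ _).trans (Finset.sum_le_sum fun j _ => ?_)
    rw [abs_mul, abs_mul, abs_of_pos (by positivity), abs_of_pos (by positivity)]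
    gcongr
    exact hC j x
lemma convm_abs_le1 {K : Dom n → ℝ} (hK : Sch K) {R : ℝ} (hR : 0 < R) (S : Set (Dom n)) (x : Dom n) :
    |convm (ksc R K) (volume.restrict S) x| ≤ ∫ z, |K z| := by
  have hi : Integrable (fun y => ksc R K (x - y)) := (integrable_ksc hR hK.integrable).comp_sub_left x
  refine (abs_integral_le_integral_abs).trans ?_
  refine (setIntegral_le_integral hi.abs (Eventually.of_forall fun y => abs_nonneg _)).trans ?_
  rw [integral_sub_left_eq_self (fun y => |ksc R K y|) volume x]
  have : (fun y => |ksc R K y|) = fun y => R ^ n * (fun z => |K z|) (R • y) := by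
    funext y; simp [ksc, abs_mul, abs_of_pos hR]
  rw [this, integral_ksc hR (fun z => |K z|)]
lemma convm_abs_le2 {K : Dom n → ℝ} {C : ℝ} (hC : ∀ x, |K x| ≤ C) {R : ℝ} (hR : 0 < R)
    {S : Set (Dom n)} (hS : volume S ≠ ⊤) (x : Dom n) :
    |convm (ksc R K) (volume.restrict S) x| ≤ R ^ n * (C * (volume S).toReal) := by
  have := norm_setIntegral_le_of_norm_le_const (f := fun y => ksc R K (x - y)) (C := R ^ n * C) hS.lt_top
    (fun y _ => by
      simp only [ksc, norm_mul, Real.norm_eq_abs, abs_of_pos (pow_pos hR n)]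
      gcongr; exact hC _)
  rw [mul_assoc] at this
  exact this
lemma Wfamily {k : ℕ} (c : (Fin n → ℕ) → (Fin n → ℕ) → ℝ)
    (hP : ∀ ξ : Dom n, ξ ≠ 0 → 0 < ∑ α ∈ degSet n k, ∑ β ∈ degSet n k,
      c α β * ((∏ i, ξ i ^ α i) * (∏ i, ξ i ^ β i))) :
    ∃ ψ : Dom n → ℝ, Sch ψ ∧ ∫ x, ψ x = 1 ∧ ∃ C', 0 ≤ C' ∧ ∀ e > (0:ℝ), ∃ v0 > (0:ℝ),
      ∀ (σ : Measure (Dom n)) (lam : ℝ≥0∞), lam ≠ ⊤ → σ Set.univ ≤ lam → Bornology.IsBounded (heavyS σ lam) →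
        (volume (heavyS σ lam)).toReal ≤ v0 → ∀ J, ∃ W : Dom n → ℝ, Sm W ∧
          (∀ w : List (Fin n), w.length < k + k → ∀ x, |wd w W x| ≤ e) ∧
          (∀ x, |(∑ α ∈ degSet n k, ∑ β ∈ degSet n k, c α β * wd (word α ++ word β) W x) -
            convm (ksc (2 ^ J / 2) ψ) (volume.restrict (heavyS σ lam)) x| ≤ e) ∧
          ∀ α ∈ degSet n k, ∀ β ∈ degSet n k,
            ∫⁻ x, ENNReal.ofReal ((wd (word α ++ word β) W x) ^ 2) ∂σ ≤ ENNReal.ofReal C' * σ Set.univ := by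
  classical
  obtain ⟨G, ψ, hG, hψ, hψ1, hGψ, hαβ⟩ := fourier_kernel c hP
  refine ⟨ψ, hψ, hψ1, ?_⟩
  have hst : ∀ α : Fin n → ℕ, ∀ β : Fin n → ℕ, ∃ C' : ℝ, 0 ≤ C' ∧ (α ∈ degSet n k → β ∈ degSet n k → ∀ (σ : Measure (Dom n)) (lam : ℝ≥0∞), lam ≠ ⊤ → σ Set.univ ≤ lam →
      Bornology.IsBounded (heavyS σ lam) → ∀ J,
      ∫⁻ x, ENNReal.ofReal ((convm (dsum (wd (word α ++ word β) G) J) (volume.restrict (heavyS σ lam)) x) ^ 2) ∂σ ≤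
        ENNReal.ofReal C' * σ Set.univ) := by
    intro α β
    by_cases h : α ∈ degSet n k ∧ β ∈ degSet n k
    · obtain ⟨h0, C, hC0, hC⟩ := hαβ α h.1 β h.2
      obtain ⟨C', h1, h2⟩ := star (hG.wd _) h0 hC0 hC
      exact ⟨C', h1, fun _ _ => h2⟩
    · exact ⟨0, le_rfl, fun h1 h2 => absurd ⟨h1, h2⟩ h⟩
  choose C' hC'0 hC' using hst
  refine ⟨∑ α ∈ degSet n k, ∑ β ∈ degSet n k, C' α β, Finset.sum_nonneg fun α _ => Finset.sum_nonneg fun β _ => hC'0 α β, ?_⟩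
  intro e he
  have hfw : {w : List (Fin n) | w.length < k + k}.Finite := List.finite_length_lt _ _
  set F := hfw.toFinset with hF
  choose D hD0 hD using fun w : List (Fin n) => (hG.wd w).decay 0
  set A := ∑ w ∈ F, ∫ z, |wd w G z| with hA
  set B := ∑ w ∈ F, D w with hB
  obtain ⟨v1, hv1, hv1'⟩ := sml_sum (n := n) (A := A) (B := B) (Finset.sum_nonneg fun w _ => by positivity)
    (Finset.sum_nonneg fun w _ => hD0 w) he
  obtain ⟨E, hE0, hE⟩ := hψ.decay 0
  refine ⟨min v1 (e / (E + 1)), by positivity, fun σ lam ht hl hb hv J => ?_⟩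
  set S := heavyS σ lam with hS
  have hfin : volume S ≠ ⊤ := hb.measure_lt_top.ne
  have : IsFiniteMeasure (volume.restrict S) := ⟨by rw [Measure.restrict_apply_univ]; exact hfin.lt_top⟩
  have hbd := GJ_bdd hG.bdd (k + k) J
  have hWw : ∀ w x, wd w (convm (GJ (k+k) G J) (volume.restrict S)) x =
      ∑ j ∈ Finset.range J, ((2⁻¹:ℝ) ^ j) ^ (k+k) * (((2:ℝ) ^ j) ^ w.length * convm (ksc (2 ^ j) (wd w G)) (volume.restrict S) x) := by
    intro w x
    rw [convm_wd hbd, GJ_wd hG.bdd]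
    simp only [convm]
    rw [integral_finsetSum]
    · simp only [integral_const_mul]
    · intro j _
      exact (((ksc_bdd (hG.wd w).bdd _).int _ x).const_mul _).const_mul _
  have hWm : ∀ w x, w.length = k + k → wd w (convm (GJ (k+k) G J) (volume.restrict S)) x =
      convm (dsum (wd w G) J) (volume.restrict S) x := by
    intro w x hw
    rw [hWw, convm_dsum (hG.wd w).bdd, hw]
    refine Finset.sum_congr rfl fun j _ => ?_
    rw [← mul_assoc, ← mul_pow, ← mul_pow]; norm_num
  have hlen : ∀ α ∈ degSet n k, ∀ β ∈ degSet n k, (word α ++ word β).length = k + k := by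
    intro α hα β hβ
    rw [List.length_append, word_len hα, word_len hβ]
  refine ⟨convm (GJ (k+k) G J) (volume.restrict S), convm_smooth hbd _, ?_, ?_, ?_⟩
  · intro w hw x
    rw [hWw]
    have hwF : w ∈ F := by simp [hF, hw]
    refine (Finset.abs_sum_le_sum_abs _ _).trans ?_
    refine le_trans (Finset.sum_le_sum (g := fun j => (2⁻¹:ℝ) ^ j * |convm (ksc (2 ^ j) (wd w G)) (volume.restrict S) x|) fun j _ => ?_)
      (hv1' _ ENNReal.toReal_nonneg (hv.trans (min_le_left _ _)) J _ (fun j => ?_) fun j => ?_)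
    · rw [abs_mul, abs_mul, abs_of_pos (by positivity), abs_of_pos (by positivity), ← mul_assoc]
      gcongr
      obtain ⟨d, hd⟩ := Nat.exists_eq_add_of_lt hw
      have : k + k = (d + 1) + w.length := by omega
      rw [this, pow_add, mul_assoc, ← mul_pow, ← mul_pow, inv_mul_cancel₀ (by norm_num), one_pow, one_pow, mul_one, pow_succ]
      refine mul_le_of_le_one_left (by positivity) (pow_le_one₀ (by positivity) (pow_le_one₀ (by norm_num) (by norm_num)))
    · refine (convm_abs_le1 (hG.wd w) (by positivity) S x).trans ?_
      exact Finset.single_le_sum (f := fun w => ∫ z, |wd w G z|) (fun w _ => by positivity) hwF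
    · refine (convm_abs_le2 (C := D w) (fun x => by simpa using hD w x) (by positivity) hfin x).trans ?_
      gcongr
      exact Finset.single_le_sum (f := D) (fun w _ => hD0 w) hwF
  · intro x
    have h1 : ∑ α ∈ degSet n k, ∑ β ∈ degSet n k, c α β * wd (word α ++ word β) (convm (GJ (k+k) G J) (volume.restrict S)) x =
        convm (ksc (2 ^ J / 2) ψ) (volume.restrict S) x - convm (ksc (2⁻¹) ψ) (volume.restrict S) x := by
      have e1 : ∀ α ∈ degSet n k, ∀ β ∈ degSet n k, c α β * wd (word α ++ word β) (convm (GJ (k+k) G J) (volume.restrict S)) x =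
          ∑ j ∈ Finset.range J, ∫ y, c α β * ksc (2 ^ j) (wd (word α ++ word β) G) (x - y) ∂(volume.restrict S) := by
        intro α hα β hβ
        rw [hWm _ _ (hlen α hα β hβ), convm_dsum (hG.wd _).bdd, Finset.mul_sum]
        simp only [integral_const_mul]; rfl
      rw [Finset.sum_congr rfl fun α hα => Finset.sum_congr rfl fun β hβ => e1 α hα β hβ]
      have e2 : ∑ α ∈ degSet n k, ∑ β ∈ degSet n k, ∑ j ∈ Finset.range J, ∫ y, c α β * ksc (2 ^ j) (wd (word α ++ word β) G) (x - y) ∂(volume.restrict S)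
         = ∑ j ∈ Finset.range J, (convm (ksc (2 ^ (j+1) / 2) ψ) (volume.restrict S) x - convm (ksc (2 ^ j / 2) ψ) (volume.restrict S) x) := by
        rw [Finset.sum_congr rfl fun α _ => Finset.sum_comm, Finset.sum_comm]
        refine Finset.sum_congr rfl fun j _ => ?_
        have hI : ∀ α β, Integrable (fun y => c α β * ksc (2 ^ j) (wd (word α ++ word β) G) (x - y)) (volume.restrict S) :=
          fun α β => ((ksc_bdd (hG.wd _).bdd _).int _ x).const_mul _
        rw [Finset.sum_congr rfl fun α _ => (integral_finsetSum _ fun β _ => hI α β).symm,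
          ← integral_finsetSum _ fun α _ => integrable_finsetSum _ fun β _ => hI α β]
        simp only [convm]
        rw [← integral_sub ((ksc_bdd hψ.bdd _).int _ x) ((ksc_bdd hψ.bdd _).int _ x)]
        congr 1; funext y
        have := hGψ ((2:ℝ)^j • (x - y))
        simp only [ksc]
        calc _ = ((2:ℝ)^j)^n * ∑ α ∈ degSet n k, ∑ β ∈ degSet n k, c α β * wd (word α ++ word β) G ((2:ℝ)^j • (x - y)) := by
              rw [Finset.mul_sum]
              refine Finset.sum_congr rfl fun α _ => ?_
              rw [Finset.mul_sum]
              exact Finset.sum_congr rfl fun β _ => by ring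
          _ = _ := by
              rw [this, mul_sub, ← mul_assoc, ← mul_pow, smul_smul]
              congr 3
              · congr 1; rw [pow_succ]; ring
              · congr 1; rw [pow_succ]; ring
              · congr 1; ring
      rw [e2, Finset.sum_range_sub (fun j => convm (ksc (2 ^ j / 2) ψ) (volume.restrict S) x)]
      simp
    rw [h1, sub_sub_cancel_left, abs_neg]
    refine (convm_abs_le2 (C := E) (fun x => by simpa using hE x) (by norm_num) hfin x).trans ?_
    have h2 := hv.trans (min_le_right _ _)
    rw [le_div_iff₀ (by positivity)] at h2
    have h3 : (2⁻¹:ℝ) ^ n ≤ 1 := pow_le_one₀ (by norm_num) (by norm_num)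
    have h4 : 0 ≤ E * (volume S).toReal := by positivity
    calc (2⁻¹:ℝ) ^ n * (E * (volume S).toReal) ≤ 1 * (E * (volume S).toReal) := by gcongr
      _ ≤ e := by nlinarith [ENNReal.toReal_nonneg (a := volume S)]
  · intro α hα β hβ
    have := hC' α β hα hβ σ lam ht hl hb J
    simp only [hWm _ _ (hlen α hα β hβ)]
    refine this.trans ?_
    gcongr
    exact (Finset.single_le_sum (f := fun β => C' α β) (fun β _ => hC'0 α β) hβ).trans
      (Finset.single_le_sum (f := fun α => ∑ β ∈ degSet n k, C' α β) (fun α _ => Finset.sum_nonneg fun β _ => hC'0 α β) hα)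
end dprl
section
section dpr2
open scoped ENNReal
variable {n k : ℕ} {V W : Type*} [NormedAddCommGroup V] [InnerProductSpace ℝ V] [FiniteDimensional ℝ V]
    [MeasurableSpace V] [BorelSpace V]
    [NormedAddCommGroup W] [InnerProductSpace ℝ W] [FiniteDimensional ℝ W]
def tphi (A : (Fin n → ℕ) → (V →L[ℝ] W)) (k : ℕ) (z0 : V) (u : Dom n → ℝ) : Dom n → W :=
  fun x => ∑ β ∈ degSet n k, wd (word β) u x • A β z0
lemma tphi_sm (A : (Fin n → ℕ) → (V →L[ℝ] W)) (z0 : V) {u : Dom n → ℝ} (hu : Sm u) : Sm (tphi A k z0 u) :=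
  ContDiff.sum fun β _ => (hu.wd (word β)).smul contDiff_const
lemma tphi_supp (A : (Fin n → ℕ) → (V →L[ℝ] W)) (z0 : V) (u : Dom n → ℝ) :
    tsupport (tphi A k z0 u) ⊆ tsupport u := by
  refine closure_minimal ?_ (isClosed_tsupport u)
  intro x hx
  by_contra hc
  apply hx
  refine Finset.sum_eq_zero fun β _ => ?_
  rw [image_eq_zero_of_notMem_tsupport (fun h => hc (wd_tsupport u _ h)), zero_smul]
lemma tphi_adj (A : (Fin n → ℕ) → (V →L[ℝ] W)) (z0 : V) {u : Dom n → ℝ} (hu : Sm u) (x : Dom n) (v : V) :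
    (inner ℝ (YoungMeasure.adjOp A k (tphi A k z0 u) x) v : ℝ) =
      ∑ α ∈ degSet n k, ∑ β ∈ degSet n k, wd (word α ++ word β) u x * (inner ℝ (A β z0) (A α v) : ℝ) := by
  unfold YoungMeasure.adjOp
  rw [sum_inner]
  refine Finset.sum_congr rfl fun α _ => ?_
  rw [ContinuousLinearMap.adjoint_inner_left, mderiv_eq_wd]
  unfold tphi
  rw [wd_sum (degSet n k) (u := fun β x => wd (word β) u x • A β z0) (fun β _ => by exact (hu.wd (word β)).smul contDiff_const) (word α)]
  rw [sum_inner]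
  refine Finset.sum_congr rfl fun β _ => ?_
  rw [wd_smul_vec (hu.wd (word β))]
  simp only [inner_smul_left, wd_append]
  simp
lemma conv_lim {ψ : Dom n → ℝ} (hψ : Sch ψ) (h1 : ∫ x, ψ x = 1) {S : Set (Dom n)} (hS : IsOpen S)
    (x : Dom n) (hx : x ∈ S) :
    Tendsto (fun J : ℕ => convm (ksc (2 ^ J / 2) ψ) (volume.restrict S) x) atTop (𝓝 1) := by
  obtain ⟨r, hr, hb⟩ := Metric.isOpen_iff.1 hS x hx
  set B := ∫ z, ‖z‖ * |ψ z|
  have hest : ∀ J : ℕ, |convm (ksc (2 ^ J / 2) ψ) (volume.restrict S) x - 1| ≤ B * (2 ^ J / 2 * r)⁻¹ := by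
    intro J
    have hR : (0:ℝ) < 2 ^ J / 2 := by positivity
    set R : ℝ := 2 ^ J / 2
    have hi : Integrable (fun y => ksc R ψ (x - y)) := (integrable_ksc hR hψ.integrable).comp_sub_left x
    have h2 : ∫ y, ksc R ψ (x - y) = 1 := by
      rw [integral_sub_left_eq_self (ksc R ψ) volume x]
      exact (integral_ksc hR ψ).trans h1
    have h3 := integral_add_compl hS.measurableSet hi
    rw [h2] at h3
    have h4 : convm (ksc R ψ) (volume.restrict S) x - 1 = - ∫ y in Sᶜ, ksc R ψ (x - y) := by
      unfold convm; linarith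
    rw [h4, abs_neg]
    have e : (fun y => ‖y‖ * |ksc R ψ y|) = fun y => R⁻¹ * (R ^ n * (fun z => ‖z‖ * |ψ z|) (R • y)) := by
      funext y
      simp only [ksc, norm_smul, abs_mul, abs_of_pos (pow_pos hR n), Real.norm_of_nonneg hR.le]
      field_simp
    have hI : Integrable (fun y => ‖y‖ * |ksc R ψ y|) := by
      rw [e]; exact (integrable_ksc hR hψ.moment).const_mul _
    have hm1 : Integrable (fun y => r⁻¹ * (‖x - y‖ * |ksc R ψ (x - y)|)) := (hI.comp_sub_left x).const_mul _
    have hm2 : ∫ y, r⁻¹ * (‖x - y‖ * |ksc R ψ (x - y)|) = B * (R * r)⁻¹ := by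
      rw [integral_const_mul, integral_sub_left_eq_self (fun y => ‖y‖ * |ksc R ψ y|) volume x, e, integral_const_mul,
        integral_ksc hR (fun z => ‖z‖ * |ψ z|), mul_inv]
      ring
    rw [← hm2]
    refine (abs_integral_le_integral_abs).trans ?_
    refine le_trans ?_ (setIntegral_le_integral (s := Sᶜ) hm1 (Eventually.of_forall fun y => by positivity))
    refine setIntegral_mono_on hi.abs.integrableOn hm1.integrableOn hS.measurableSet.compl fun y hy => ?_
    have : r ≤ ‖x - y‖ := by
      by_contra hc
      exact hy (hb (by rw [Metric.mem_ball, dist_comm, dist_eq_norm]; exact not_le.1 hc))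
    rw [← mul_assoc]
    refine le_mul_of_one_le_left (abs_nonneg _) ?_
    rw [← div_eq_inv_mul, one_le_div hr]; exact this
  rw [tendsto_iff_norm_sub_tendsto_zero]
  refine squeeze_zero (fun J => norm_nonneg _) hest ?_
  have : Tendsto (fun J : ℕ => (2⁻¹:ℝ) ^ J) atTop (𝓝 0) := tendsto_pow_atTop_nhds_zero_of_lt_one (by norm_num) (by norm_num)
  have := this.const_mul (B * (2 * r⁻¹))
  rw [mul_zero] at this
  refine this.congr fun J => ?_
  rw [inv_pow]; field_simp
lemma leib_unif {χ : Dom n → ℝ} (hχ : Sm χ) (hχc : HasCompactSupport χ) (k : ℕ) :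
    ∃ C, 0 ≤ C ∧ ∀ (W : Dom n → ℝ) (e : ℝ), Sm W → 0 ≤ e →
      (∀ w : List (Fin n), w.length < k + k → ∀ x, |wd w W x| ≤ e) →
      ∀ α ∈ degSet n k, ∀ β ∈ degSet n k, ∀ x,
        |wd (word α ++ word β) (fun x => χ x * W x) x - χ x * wd (word α ++ word β) W x| ≤ C * e := by
  choose C hC0 hC using fun w : List (Fin n) => leibniz w χ hχ hχc
  refine ⟨∑ α ∈ degSet n k, ∑ β ∈ degSet n k, C (word α ++ word β),
    Finset.sum_nonneg fun α _ => Finset.sum_nonneg fun β _ => hC0 _, ?_⟩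
  intro W e hW he hw α hα β hβ x
  refine (hC (word α ++ word β) W e hW (fun w' hw' => hw w' ?_) x).trans ?_
  · rwa [List.length_append, word_len hα, word_len hβ] at hw'
  · refine mul_le_mul_of_nonneg_right ?_ he
    refine (Finset.single_le_sum (f := fun β => C (word α ++ word β)) (fun β _ => hC0 _) hβ).trans ?_
    exact Finset.single_le_sum (f := fun α => ∑ β ∈ degSet n k, C (word α ++ word β))
      (fun α _ => Finset.sum_nonneg fun β _ => hC0 _) hα
lemma wdens {X : Type*} [MeasurableSpace X] (m : Measure X) {h ρ : X → ℝ} (hh : Measurable h) (h0 : ∀ x, 0 ≤ h x)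
    (hρ : AEMeasurable ρ m) (hρ0 : ∀ x, 0 ≤ ρ x) (hi : Integrable (fun x => ρ x * h x) m) :
    ∫⁻ x, ENNReal.ofReal (h x) ∂(m.withDensity fun x => ENNReal.ofReal (ρ x)) = ENNReal.ofReal (∫ x, ρ x * h x ∂m) := by
  rw [lintegral_withDensity_eq_lintegral_mul₀ hρ.ennreal_ofReal hh.ennreal_ofReal.aemeasurable,
    ofReal_integral_eq_lintegral_ofReal hi (Eventually.of_forall fun x => mul_nonneg (hρ0 x) (h0 x))]
  refine lintegral_congr fun x => ?_
  simp only [Pi.mul_apply]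
  rw [ENNReal.ofReal_mul (hρ0 x)]
set_option maxHeartbeats 1600000 in
lemma dpr_est (A : (Fin n → ℕ) → (V →L[ℝ] W)) (z0 : V) (hz0 : ∀ ξ : Dom n, ξ ≠ 0 → opSymbol A k ξ z0 ≠ 0) :
    ∃ C3 : ℝ, 0 ≤ C3 ∧ ∀ (Ω : Set (Dom n)) (μ : Measure (Dom n)) [IsFiniteMeasure μ] (z g : Dom n → V)
      (χ : Dom n → ℝ) (δ c1 : ℝ), μ ⟂ₘ (volume : Measure (Dom n)) → MeasurableSet Ω →
      Measurable z → (∀ x, ‖z x‖ ≤ 1) → IntegrableOn g Ω →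
      (∀ φ : Dom n → W, ContDiff ℝ (⊤ : ℕ∞) φ → HasCompactSupport φ → tsupport φ ⊆ Ω →
        (∫ x in Ω, (inner ℝ (YoungMeasure.adjOp A k φ x) (g x) : ℝ)) +
          (∫ x, (inner ℝ (YoungMeasure.adjOp A k φ x) (z x) : ℝ) ∂μ) = 0) →
      Sm χ → HasCompactSupport χ → tsupport χ ⊆ Ω → (∀ x, 0 ≤ χ x ∧ χ x ≤ 1) → 0 < δ →
      (∫ x, χ x * ‖z x - z0‖ ∂μ) + (∫ x in Ω, χ x * ‖g x‖) ≤ c1 * δ * ∫ x, χ x ∂μ →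
      ∫ x, χ x ∂μ ≤ C3 * δ * ((1 + c1) * ∫ x, χ x ∂μ) := by
  classical
  set c : (Fin n → ℕ) → (Fin n → ℕ) → ℝ := fun α β => inner ℝ (A β z0) (A α z0) with hc
  have hP : ∀ ξ : Dom n, ξ ≠ 0 → 0 < ∑ α ∈ degSet n k, ∑ β ∈ degSet n k,
      c α β * ((∏ i, ξ i ^ α i) * (∏ i, ξ i ^ β i)) := by
    intro ξ hξ
    have : (inner ℝ (opSymbol A k ξ z0) (opSymbol A k ξ z0) : ℝ) = ∑ α ∈ degSet n k, ∑ β ∈ degSet n k,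
      c α β * ((∏ i, ξ i ^ α i) * (∏ i, ξ i ^ β i)) := by
      unfold opSymbol
      simp only [_root_.sum_apply, smul_apply]
      rw [inner_sum]
      refine Finset.sum_congr rfl fun α _ => ?_
      rw [sum_inner]
      refine Finset.sum_congr rfl fun β _ => ?_
      rw [inner_smul_left, inner_smul_right]
      simp [hc]; ring
    rw [← this]
    exact real_inner_self_pos.2 (hz0 ξ hξ)
  obtain ⟨ψ, hψ, hψ1, C', hC'0, hW⟩ := Wfamily c hP
  set N : ℝ := ∑ α ∈ degSet n k, ∑ β ∈ degSet n k, ‖A β z0‖ * ‖A α‖ with hN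
  have hN0 : 0 ≤ N := by positivity
  refine ⟨N * (1 + C'), by positivity, ?_⟩
  intro Ω μ _ z g χ δ c1 hsing hΩ hzm hz1 hg hfree hχ hχc hχΩ hχ01 hδ hκ
  set M := ∫ x, χ x ∂μ with hM
  obtain ⟨Cχ, hCχ0, hCχ⟩ := leib_unif hχ hχc k
  have hχcont : Continuous χ := hχ.continuous
  have hgm : AEStronglyMeasurable g (volume.restrict Ω) := hg.aestronglyMeasurable
  have hzm' : Measurable fun x => ‖z x - z0‖ := (hzm.sub_const z0).norm
  have hzb : ∀ x, ‖z x - z0‖ ≤ 1 + ‖z0‖ := fun x => (norm_sub_le _ _).trans (by linarith [hz1 x])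
  have hzI : Integrable (fun x => ‖z x - z0‖) μ :=
    (integrable_const (1 + ‖z0‖)).mono' hzm'.aestronglyMeasurable
      (Eventually.of_forall fun x => by rw [norm_norm]; exact hzb x)
  have hcs : ∀ h : Dom n → ℝ, Continuous h → HasCompactSupport (fun x => χ x * h x) := fun h _ => hχc.mul_right
  have I1 : ∀ h : Dom n → ℝ, Continuous h → Integrable (fun x => χ x * h x) μ := fun h hh =>
    (hχcont.mul hh).integrable_of_hasCompactSupport (hcs h hh)
  have hbd : ∀ h : Dom n → ℝ, Continuous h → ∃ C, ∀ x, ‖χ x * h x‖ ≤ C := fun h hh =>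
    (hcs h hh).exists_bound_of_continuous (hχcont.mul hh)
  have I2 : ∀ h : Dom n → ℝ, Continuous h → Integrable (fun x => χ x * ‖z x - z0‖ * h x) μ := by
    intro h hh
    obtain ⟨C, hC⟩ := hbd h hh
    have := hzI.bdd_mul (c := C) (hχcont.mul hh).aestronglyMeasurable (Eventually.of_forall hC)
    exact this.congr (Eventually.of_forall fun x => by simp only [Pi.mul_apply]; ring)
  have I3 : ∀ h : Dom n → ℝ, Continuous h → Integrable (fun x => χ x * ‖g x‖ * h x) (volume.restrict Ω) := by
    intro h hh
    obtain ⟨C, hC⟩ := hbd h hh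
    have := hg.norm.bdd_mul (c := C) (hχcont.mul hh).aestronglyMeasurable (Eventually.of_forall hC)
    exact this.congr (Eventually.of_forall fun x => by simp only [Pi.mul_apply]; ring)
  set κ1 := μ.withDensity fun x => ENNReal.ofReal (χ x * ‖z x - z0‖) with hκ1
  set κ2 := (volume.restrict Ω).withDensity fun x => ENNReal.ofReal (χ x * ‖g x‖) with hκ2
  set σ1 := μ.withDensity fun x => ENNReal.ofReal (χ x) with hσ1
  set σ := σ1 + ENNReal.ofReal δ⁻¹ • (κ1 + κ2) with hσ
  have hδi : 0 ≤ δ⁻¹ := inv_nonneg.2 hδ.le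
  have hint : ∀ h : Dom n → ℝ, Continuous h → (∀ x, 0 ≤ h x) → ∫⁻ x, ENNReal.ofReal (h x) ∂σ =
      ENNReal.ofReal ((∫ x, χ x * h x ∂μ) + δ⁻¹ * ((∫ x, χ x * ‖z x - z0‖ * h x ∂μ) + ∫ x in Ω, χ x * ‖g x‖ * h x)) := by
    intro h hh h0
    have p1 : 0 ≤ ∫ x, χ x * h x ∂μ := integral_nonneg fun x => mul_nonneg (hχ01 x).1 (h0 x)
    have p2 : 0 ≤ ∫ x, χ x * ‖z x - z0‖ * h x ∂μ :=
      integral_nonneg fun x => mul_nonneg (mul_nonneg (hχ01 x).1 (norm_nonneg _)) (h0 x)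
    have p3 : 0 ≤ ∫ x in Ω, χ x * ‖g x‖ * h x :=
      integral_nonneg fun x => mul_nonneg (mul_nonneg (hχ01 x).1 (norm_nonneg _)) (h0 x)
    rw [hσ, lintegral_add_measure, lintegral_smul_measure, lintegral_add_measure,
      wdens μ hh.measurable h0 hχcont.measurable.aemeasurable (fun x => (hχ01 x).1) (I1 h hh),
      wdens (ρ := fun x => χ x * ‖z x - z0‖) μ hh.measurable h0 (hχcont.measurable.mul hzm').aemeasurable
        (fun x => mul_nonneg (hχ01 x).1 (norm_nonneg _)) (I2 h hh),
      wdens (ρ := fun x => χ x * ‖g x‖) _ hh.measurable h0 (hχcont.measurable.aemeasurable.mul hgm.norm.aemeasurable)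
        (fun x => mul_nonneg (hχ01 x).1 (norm_nonneg _)) (I3 h hh),
      ENNReal.ofReal_add p1 (mul_nonneg hδi (add_nonneg p2 p3)), ENNReal.ofReal_mul hδi, ENNReal.ofReal_add p2 p3,
      smul_eq_mul]
  set κ0 := (∫ x, χ x * ‖z x - z0‖ ∂μ) + (∫ x in Ω, χ x * ‖g x‖) with hκ0
  have hκ00 : 0 ≤ κ0 := add_nonneg (integral_nonneg fun x => mul_nonneg (hχ01 x).1 (norm_nonneg _))
    (integral_nonneg fun x => mul_nonneg (hχ01 x).1 (norm_nonneg _))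
  have hM0 : 0 ≤ M := integral_nonneg fun x => (hχ01 x).1
  set σ0 := M + δ⁻¹ * κ0 with hσ0
  have hσ00 : 0 ≤ σ0 := by positivity
  have hσu : σ Set.univ = ENNReal.ofReal σ0 := by
    have := hint (fun _ => 1) continuous_const (fun _ => zero_le_one)
    simpa using this
  have hσle : σ0 ≤ (1 + c1) * M := by
    have : δ⁻¹ * κ0 ≤ δ⁻¹ * (c1 * δ * M) := mul_le_mul_of_nonneg_left hκ hδi
    have h2 : δ⁻¹ * (c1 * δ * M) = c1 * M := by field_simp
    rw [hσ0]; linarith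
  have hcarr : σ (tsupport χ)ᶜ = 0 := by
    have hm : MeasurableSet (tsupport χ)ᶜ := (isClosed_tsupport χ).measurableSet.compl
    have hz : ∀ (m : Measure (Dom n)) (f : Dom n → ℝ),
        (m.withDensity fun x => ENNReal.ofReal (χ x * f x)) (tsupport χ)ᶜ = 0 := by
      intro m f
      rw [withDensity_apply _ hm, setLIntegral_congr_fun (g := fun _ => 0) hm]
      · simp
      · intro x hx
        simp [image_eq_zero_of_notMem_tsupport hx]
    have h1 := hz μ (fun _ => 1)
    simp only [mul_one] at h1
    rw [hσ, Measure.add_apply, Measure.smul_apply, Measure.add_apply, hκ1, hκ2, hz, hz, hσ1, h1]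
    simp
  set Kc := (1 + Cχ * ∑ α ∈ degSet n k, ∑ β ∈ degSet n k, |c α β|) * μ.real Set.univ +
    N * Cχ * ((∫ x in Ω, ‖g x‖) + ∫ x, ‖z x - z0‖ ∂μ) with hKc
  have hstep : ∀ e > (0:ℝ), M ≤ N * (δ * (1 + C') * σ0) + e * Kc := by
    intro e he
    obtain ⟨v0, hv0, hW⟩ := hW e he
    obtain ⟨lam, hlt, hlσ, hlv⟩ : ∃ lam : ℝ≥0∞, lam ≠ ⊤ ∧ σ Set.univ ≤ lam ∧ (volume (heavyS σ lam)).toReal ≤ v0 := by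
      set q := 3 ^ n * σ0 / v0 with hq
      have hq0 : 0 ≤ q := by positivity
      refine ⟨ENNReal.ofReal (σ0 + q + 1), ENNReal.ofReal_ne_top, ?_, ?_⟩
      · rw [hσu]; exact ENNReal.ofReal_le_ofReal (by linarith)
      · have h1 := heavyS_vol σ (ENNReal.ofReal (σ0 + q + 1))
        have h2 := ENNReal.toReal_mono (by rw [hσu]; exact ENNReal.mul_ne_top (by simp) ENNReal.ofReal_ne_top) h1
        rw [hσu, ENNReal.toReal_mul, ENNReal.toReal_mul, ENNReal.toReal_ofReal (by linarith),
          ENNReal.toReal_ofReal hσ00] at h2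
        simp only [ENNReal.toReal_pow, ENNReal.toReal_ofNat] at h2
        have h3 : 3 ^ n * σ0 = q * v0 := by rw [hq]; field_simp
        rw [h3] at h2
        by_contra hcon
        push Not at hcon
        have : (σ0 + q + 1) * v0 < (σ0 + q + 1) * (volume (heavyS σ (ENNReal.ofReal (σ0 + q + 1)))).toReal :=
          mul_lt_mul_of_pos_left hcon (by linarith)
        nlinarith
    have hbS := heavyS_bdd σ lam hχc.isCompact.isBounded hcarr
    have hSo := heavyS_open σ lam
    set S := heavyS σ lam with hS
    have hfinS : IsFiniteMeasure (volume.restrict S) := ⟨by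
      rw [Measure.restrict_apply_univ]; exact hbS.measure_lt_top⟩
    have hcc : ∀ J : ℕ, Continuous (convm (ksc (2 ^ J / 2) ψ) (volume.restrict S)) := fun J =>
      (convm_smooth (ksc_bdd hψ.bdd _) _).continuous
    have hJ : ∀ J : ℕ, ∫ x, χ x * convm (ksc (2 ^ J / 2) ψ) (volume.restrict S) x ∂μ ≤
        N * (δ * (1 + C') * σ0) + e * Kc := by
      intro J
      obtain ⟨Wf, hWs, hWl, hWc, hW2⟩ := hW σ lam hlt hlσ hbS hlv J
      have hu : Sm (fun x => χ x * Wf x) := by exact hχ.mul hWs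
      have hD := hCχ Wf e hWs he.le hWl
      set u := fun x => χ x * Wf x with hud
      set φ := tphi A k z0 u with hφ
      have hφs : Sm φ := tphi_sm A z0 hu
      have hus : tsupport u ⊆ tsupport χ := tsupport_mul_subset_left
      have hφc : HasCompactSupport φ := hχc.of_isClosed_subset (isClosed_tsupport _) ((tphi_supp A z0 u).trans hus)
      have hfr := hfree φ hφs hφc (((tphi_supp A z0 u).trans hus).trans hχΩ)
      have hadjc : Continuous (YoungMeasure.adjOp A k φ) := by
        refine continuous_finsetSum _ fun α _ => ?_
        rw [mderiv_eq_wd]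
        exact (ContinuousLinearMap.continuous _).comp (hφs.wd (word α)).continuous
      obtain ⟨Ca, hCa⟩ : ∃ Ca, ∀ x, ‖YoungMeasure.adjOp A k φ x‖ ≤ Ca := by
        choose C0 h0 h1 using fun w => wd_bdd hφs hφc w
        refine ⟨∑ α ∈ degSet n k, ‖ContinuousLinearMap.adjoint (A α)‖ * C0 (word α), fun x => ?_⟩
        refine (norm_sum_le _ _).trans (Finset.sum_le_sum fun α _ => ?_)
        rw [mderiv_eq_wd]
        exact (ContinuousLinearMap.le_opNorm _ _).trans (mul_le_mul_of_nonneg_left (h1 _ x) (norm_nonneg _))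
      have hIin : ∀ (m : Measure (Dom n)) (v : Dom n → V), Integrable v m →
          Integrable (fun x => (inner ℝ (YoungMeasure.adjOp A k φ x) (v x) : ℝ)) m := by
        intro m v hv
        refine (hv.norm.const_mul Ca).mono' (hadjc.aestronglyMeasurable.inner hv.aestronglyMeasurable)
          (Eventually.of_forall fun x => ?_)
        refine (norm_inner_le_norm _ _).trans (mul_le_mul_of_nonneg_right (hCa x) (norm_nonneg _))
      have hzi : Integrable z μ := (integrable_const (1:ℝ)).mono' hzm.aestronglyMeasurable
        (Eventually.of_forall hz1)
      have hfc : ∀ α β : Fin n → ℕ, Continuous (fun x => 1 + (wd (word α ++ word β) Wf x) ^ 2) := fun α β =>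
        continuous_const.add ((hWs.wd _).continuous.pow 2)
      have pt1 : ∀ x, χ x * convm (ksc (2 ^ J / 2) ψ) (volume.restrict S) x ≤
          (inner ℝ (YoungMeasure.adjOp A k φ x) z0 : ℝ) +
            e * (1 + Cχ * ∑ α ∈ degSet n k, ∑ β ∈ degSet n k, |c α β|) := by
        intro x
        rw [hφ, tphi_adj A z0 hu x z0]
        have h1 := (abs_le.1 (hWc x)).1
        have h2 := hχ01 x
        have h3 : χ x * (∑ α ∈ degSet n k, ∑ β ∈ degSet n k, c α β * wd (word α ++ word β) Wf x) ≤
            (∑ α ∈ degSet n k, ∑ β ∈ degSet n k, wd (word α ++ word β) u x * (inner ℝ (A β z0) (A α z0) : ℝ)) +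
            ∑ α ∈ degSet n k, ∑ β ∈ degSet n k, e * Cχ * |c α β| := by
          rw [Finset.mul_sum, ← Finset.sum_add_distrib]
          refine Finset.sum_le_sum fun α hα => ?_
          rw [Finset.mul_sum, ← Finset.sum_add_distrib]
          refine Finset.sum_le_sum fun β hβ => ?_
          have h4 := hD α hα β hβ x
          have h5 : |(χ x * wd (word α ++ word β) Wf x - wd (word α ++ word β) u x) * c α β| ≤ (Cχ * e) * |c α β| := by
            rw [abs_mul, abs_sub_comm]; exact mul_le_mul_of_nonneg_right h4 (abs_nonneg _)
          have h6 := (abs_le.1 h5).2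
          have h7 : (inner ℝ (A β z0) (A α z0) : ℝ) = c α β := rfl
          rw [h7]; linarith
        simp only [← Finset.mul_sum] at h3
        nlinarith
      have pt2 : ∀ (x : Dom n) (v : V), -(inner ℝ (YoungMeasure.adjOp A k φ x) v : ℝ) ≤
          ∑ α ∈ degSet n k, ∑ β ∈ degSet n k, (‖A β z0‖ * ‖A α‖) *
            (χ x * ‖v‖ * (1 + (wd (word α ++ word β) Wf x) ^ 2) + Cχ * e * ‖v‖) := by
        intro x v
        rw [hφ, tphi_adj A z0 hu x v, ← Finset.sum_neg_distrib]
        refine Finset.sum_le_sum fun α hα => ?_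
        rw [← Finset.sum_neg_distrib]
        refine Finset.sum_le_sum fun β hβ => ?_
        have h4 := hD α hα β hβ x
        set f := wd (word α ++ word β) Wf x
        set d := wd (word α ++ word β) u x
        have h5 : |d| ≤ χ x * (1 + f ^ 2) + Cχ * e := by
          have : |d| ≤ |d - χ x * f| + |χ x * f| := by
            have := abs_add_le (d - χ x * f) (χ x * f); simpa using this
          rw [abs_mul, abs_of_nonneg (hχ01 x).1] at this
          have h6 : |f| ≤ 1 + f ^ 2 := by
            rw [← sq_abs]; nlinarith [sq_nonneg (|f| - 1), abs_nonneg f]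
          have := mul_le_mul_of_nonneg_left h6 (hχ01 x).1
          linarith
        have h7 : |(inner ℝ (A β z0) (A α v) : ℝ)| ≤ ‖A β z0‖ * (‖A α‖ * ‖v‖) :=
          (abs_real_inner_le_norm _ _).trans (mul_le_mul_of_nonneg_left ((A α).le_opNorm v) (norm_nonneg _))
        calc -(d * (inner ℝ (A β z0) (A α v) : ℝ)) ≤ |d| * |(inner ℝ (A β z0) (A α v) : ℝ)| := by
              rw [← abs_mul]; exact neg_le_abs _
          _ ≤ (χ x * (1 + f ^ 2) + Cχ * e) * (‖A β z0‖ * (‖A α‖ * ‖v‖)) :=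
              mul_le_mul h5 h7 (abs_nonneg _) ((abs_nonneg _).trans h5)
          _ = _ := by ring
      have int1 : ∫ x, χ x * convm (ksc (2 ^ J / 2) ψ) (volume.restrict S) x ∂μ ≤
          (∫ x, (inner ℝ (YoungMeasure.adjOp A k φ x) z0 : ℝ) ∂μ) +
            e * (1 + Cχ * ∑ α ∈ degSet n k, ∑ β ∈ degSet n k, |c α β|) * μ.real Set.univ := by
        have := integral_mono (μ := μ) (I1 _ (hcc J)) ((hIin μ (fun _ => z0) (integrable_const z0)).add
          (integrable_const (e * (1 + Cχ * ∑ α ∈ degSet n k, ∑ β ∈ degSet n k, |c α β|)))) pt1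
        refine this.trans (le_of_eq ?_)
        simp only [Pi.add_apply]
        rw [integral_add (hIin μ (fun _ => z0) (integrable_const z0)) (integrable_const _), integral_const, smul_eq_mul]
        ring
      have int2 : (∫ x, (inner ℝ (YoungMeasure.adjOp A k φ x) z0 : ℝ) ∂μ) =
          (∫ x in Ω, -(inner ℝ (YoungMeasure.adjOp A k φ x) (g x) : ℝ)) +
          ∫ x, -(inner ℝ (YoungMeasure.adjOp A k φ x) (z x - z0) : ℝ) ∂μ := by
        simp only [inner_sub_right]
        rw [integral_neg, integral_neg, integral_sub (hIin μ z hzi) (hIin μ (fun _ => z0) (integrable_const z0))]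
        linarith
      have gen : ∀ (m : Measure (Dom n)) (v : Dom n → V), Integrable v m →
          (∀ h : Dom n → ℝ, Continuous h → Integrable (fun x => χ x * ‖v x‖ * h x) m) →
          ∫ x, -(inner ℝ (YoungMeasure.adjOp A k φ x) (v x) : ℝ) ∂m ≤
          ∑ α ∈ degSet n k, ∑ β ∈ degSet n k, (‖A β z0‖ * ‖A α‖) *
            ((∫ x, χ x * ‖v x‖ * (1 + (wd (word α ++ word β) Wf x) ^ 2) ∂m) + Cχ * e * ∫ x, ‖v x‖ ∂m) := by
        intro m v hv hI
        have hII : ∀ α β, Integrable (fun x => (‖A β z0‖ * ‖A α‖) *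
            (χ x * ‖v x‖ * (1 + (wd (word α ++ word β) Wf x) ^ 2) + Cχ * e * ‖v x‖)) m := fun α β =>
          ((hI _ (hfc α β)).add (hv.norm.const_mul _)).const_mul _
        have hI2 : ∀ α ∈ degSet n k, Integrable (fun x => ∑ β ∈ degSet n k, (‖A β z0‖ * ‖A α‖) *
            (χ x * ‖v x‖ * (1 + (wd (word α ++ word β) Wf x) ^ 2) + Cχ * e * ‖v x‖)) m := fun α _ =>
          integrable_finsetSum _ fun β _ => hII α β
        refine (integral_mono (hIin m v hv).neg (integrable_finsetSum _ hI2)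
          (fun x => pt2 x (v x))).trans (le_of_eq ?_)
        rw [integral_finsetSum _ hI2]
        refine Finset.sum_congr rfl fun α _ => ?_
        rw [integral_finsetSum _ fun β _ => hII α β]
        refine Finset.sum_congr rfl fun β _ => ?_
        rw [integral_const_mul, integral_add (hI _ (hfc α β)) (hv.norm.const_mul _), integral_const_mul]
      have g1 := gen (volume.restrict Ω) g hg I3
      have g2 := gen μ (fun x => z x - z0) (hzi.sub (integrable_const z0)) I2
      have hab : ∀ α ∈ degSet n k, ∀ β ∈ degSet n k,
          (∫ x in Ω, χ x * ‖g x‖ * (1 + (wd (word α ++ word β) Wf x) ^ 2)) +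
          (∫ x, χ x * ‖z x - z0‖ * (1 + (wd (word α ++ word β) Wf x) ^ 2) ∂μ) ≤ δ * (1 + C') * σ0 := by
        intro α hα β hβ
        have hf2 : Continuous (fun x => (wd (word α ++ word β) Wf x) ^ 2) := (hWs.wd _).continuous.pow 2
        have h1 := hW2 α hα β hβ
        rw [hint _ hf2 (fun x => sq_nonneg _), hσu, ← ENNReal.ofReal_mul hC'0,
          ENNReal.ofReal_le_ofReal_iff (by positivity)] at h1
        have h2 : 0 ≤ ∫ x, χ x * (wd (word α ++ word β) Wf x) ^ 2 ∂μ :=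
          integral_nonneg fun x => mul_nonneg (hχ01 x).1 (sq_nonneg _)
        have e1 : (∫ x in Ω, χ x * ‖g x‖ * (1 + (wd (word α ++ word β) Wf x) ^ 2)) =
            (∫ x in Ω, χ x * ‖g x‖) + ∫ x in Ω, χ x * ‖g x‖ * (wd (word α ++ word β) Wf x) ^ 2 := by
          rw [← integral_add (by simpa using I3 (fun _ => 1) continuous_const) (I3 _ hf2)]
          congr 1; funext x; ring
        have e2 : (∫ x, χ x * ‖z x - z0‖ * (1 + (wd (word α ++ word β) Wf x) ^ 2) ∂μ) =
            (∫ x, χ x * ‖z x - z0‖ ∂μ) + ∫ x, χ x * ‖z x - z0‖ * (wd (word α ++ word β) Wf x) ^ 2 ∂μ := by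
          rw [← integral_add (by simpa using I2 (fun _ => 1) continuous_const) (I2 _ hf2)]
          congr 1; funext x; ring
        rw [e1, e2]
        set a1 := ∫ x in Ω, χ x * ‖g x‖ * (wd (word α ++ word β) Wf x) ^ 2
        set a2 := ∫ x, χ x * ‖z x - z0‖ * (wd (word α ++ word β) Wf x) ^ 2 ∂μ
        have h3 : δ⁻¹ * (a2 + a1) ≤ C' * σ0 := by linarith
        have h4 : δ⁻¹ * κ0 ≤ σ0 := by rw [hσ0]; linarith
        have h5 := mul_le_mul_of_nonneg_left (add_le_add h3 h4) hδ.le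
        have h6 : δ * (δ⁻¹ * (a2 + a1) + δ⁻¹ * κ0) = a2 + a1 + κ0 := by field_simp
        rw [h6] at h5
        rw [hκ0] at h5
        linarith
      have hsum : (∫ x in Ω, -(inner ℝ (YoungMeasure.adjOp A k φ x) (g x) : ℝ)) +
          (∫ x, -(inner ℝ (YoungMeasure.adjOp A k φ x) (z x - z0) : ℝ) ∂μ) ≤
          N * (δ * (1 + C') * σ0 + Cχ * e * ((∫ x in Ω, ‖g x‖) + ∫ x, ‖z x - z0‖ ∂μ)) := by
        refine (add_le_add g1 g2).trans ?_
        rw [← Finset.sum_add_distrib, hN, Finset.sum_mul]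
        refine Finset.sum_le_sum fun α hα => ?_
        rw [← Finset.sum_add_distrib, Finset.sum_mul]
        refine Finset.sum_le_sum fun β hβ => ?_
        rw [← mul_add]
        refine mul_le_mul_of_nonneg_left ?_ (by positivity)
        have := hab α hα β hβ
        linarith
      rw [hKc]
      rw [int2] at int1
      linarith
    have hlim : Tendsto (fun J : ℕ => ∫ x, χ x * convm (ksc (2 ^ J / 2) ψ) (volume.restrict S) x ∂μ) atTop (𝓝 M) := by
      refine tendsto_integral_of_dominated_convergence (fun x => χ x * ∫ z, |ψ z|)
        (fun J => (I1 _ (hcc J)).aestronglyMeasurable) (I1 (fun _ => ∫ z, |ψ z|) continuous_const) ?_ ?_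
      · intro J
        refine Eventually.of_forall fun x => ?_
        rw [norm_mul, Real.norm_of_nonneg (hχ01 x).1]
        exact mul_le_mul_of_nonneg_left (convm_abs_le1 hψ (by positivity) S x) (hχ01 x).1
      · obtain ⟨T, hTm, hT1, hT2⟩ := hsing
        have hz : σ (Sᶜ ∩ Tᶜ) = 0 := by
          have := heavyS_compl σ lam hlt (Sᶜ ∩ Tᶜ) (by
            ext x; simp only [Set.mem_inter_iff, Set.mem_compl_iff, Set.mem_empty_iff_false, iff_false]; tauto)
          refine le_antisymm (this.trans ?_) zero_le
          rw [measure_mono_null Set.inter_subset_right hT2, mul_zero]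
        have hz1 : σ1 (Sᶜ ∩ Tᶜ) = 0 := by
          rw [hσ, Measure.add_apply] at hz
          exact (add_eq_zero.1 hz).1
        rw [hσ1, withDensity_apply_eq_zero hχcont.measurable.ennreal_ofReal] at hz1
        have hzT : ∀ᵐ x ∂μ, x ∉ T := by rw [ae_iff]; simpa using hT1
        have hz2 : ∀ᵐ x ∂μ, x ∉ {x | ENNReal.ofReal (χ x) ≠ 0} ∩ (Sᶜ ∩ Tᶜ) := by rw [ae_iff]; simp only [not_not, Set.setOf_mem_eq]; exact hz1
        filter_upwards [hzT, hz2] with x hx1 hx2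
        by_cases hxS : x ∈ S
        · have := (conv_lim hψ hψ1 hSo x hxS).const_mul (χ x)
          rwa [mul_one] at this
        · have h0 : χ x = 0 := by
            by_contra hne
            exact hx2 ⟨by simpa using lt_of_le_of_ne (hχ01 x).1 (Ne.symm hne), hxS, hx1⟩
          simp [h0]
    exact le_of_tendsto' hlim hJ
  have hfin : M ≤ N * (δ * (1 + C') * σ0) := by
    have ht : Tendsto (fun e : ℝ => N * (δ * (1 + C') * σ0) + e * Kc) (𝓝[>] 0) (𝓝 (N * (δ * (1 + C') * σ0))) := by
      have : Tendsto (fun e : ℝ => N * (δ * (1 + C') * σ0) + e * Kc) (𝓝 0) (𝓝 (N * (δ * (1 + C') * σ0) + 0 * Kc)) :=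
        (tendsto_id.mul_const Kc).const_add _
      rw [zero_mul, add_zero] at this
      exact this.mono_left nhdsWithin_le_nhds
    refine ge_of_tendsto ht ?_
    filter_upwards [self_mem_nhdsWithin] with e he using hstep e he
  refine hfin.trans ?_
  have := mul_le_mul_of_nonneg_left hσle (show 0 ≤ N * (1 + C') * δ by positivity)
  linarith
end dpr2
section
section dpr3
open scoped ENNReal
lemma cutoff {n : ℕ} {K G : Set (Dom n)} (hK : IsCompact K) (hG : IsOpen G) (hKG : K ⊆ G) :
    ∃ χ : Dom n → ℝ, Sm χ ∧ HasCompactSupport χ ∧ tsupport χ ⊆ G ∧ (∀ x, 0 ≤ χ x ∧ χ x ≤ 1) ∧ ∀ x ∈ K, χ x = 1 := by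
  obtain ⟨L, hL, hKL, hLG⟩ := exists_compact_between hK hG hKG
  obtain ⟨f, h0, h1, h2⟩ := exists_contMDiffMap_zero_one_of_isClosed (n := (⊤ : ℕ∞)) (modelWithCornersSelf ℝ (Dom n))
    (isOpen_interior (s := L)).isClosed_compl hK.isClosed (Set.disjoint_left.2 fun x hx hx' => hx (hKL hx'))
  have hs : tsupport f ⊆ L := by
    refine closure_minimal (fun x hx => ?_) hL.isClosed
    by_contra hc
    exact hx (h0 (fun h => hc (interior_subset h)))
  exact ⟨f, f.contMDiff.contDiff, hL.of_isClosed_subset (isClosed_tsupport _) hs, hs.trans hLG,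
    fun x => h2 x, fun x hx => h1 hx⟩
variable {n k : ℕ} {V W : Type*} [NormedAddCommGroup V] [InnerProductSpace ℝ V] [FiniteDimensional ℝ V]
    [MeasurableSpace V] [BorelSpace V]
    [NormedAddCommGroup W] [InnerProductSpace ℝ W] [FiniteDimensional ℝ W]
lemma dpr_core (A : (Fin n → ℕ) → (V →L[ℝ] W)) (z0 : V) (hz0 : ∀ ξ : Dom n, ξ ≠ 0 → opSymbol A k ξ z0 ≠ 0)
    (Ω : Set (Dom n)) (μ : Measure (Dom n)) [IsFiniteMeasure μ] (z g : Dom n → V)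
    (hsing : μ ⟂ₘ (volume : Measure (Dom n))) (hΩ : IsOpen Ω)
    (hzm : Measurable z) (hz1 : ∀ x, ‖z x‖ ≤ 1) (hg : IntegrableOn g Ω)
    (hfree : ∀ φ : Dom n → W, ContDiff ℝ (⊤ : ℕ∞) φ → HasCompactSupport φ → tsupport φ ⊆ Ω →
        (∫ x in Ω, (inner ℝ (YoungMeasure.adjOp A k φ x) (g x) : ℝ)) +
          (∫ x, (inner ℝ (YoungMeasure.adjOp A k φ x) (z x) : ℝ) ∂μ) = 0) :
    ∃ δ > (0:ℝ), μ (Ω ∩ {x | ‖z x - z0‖ < δ}) = 0 := by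
  obtain ⟨C3, hC3, hest⟩ := dpr_est A z0 hz0
  set δ : ℝ := 1 / (2 * (C3 + 1) * (4 + ‖z0‖)) with hδd
  have hδ : 0 < δ := by positivity
  refine ⟨δ, hδ, ?_⟩
  by_contra hne
  obtain ⟨T, hTm, hT1, hT2⟩ := id hsing
  have hzm' : Measurable fun x => ‖z x - z0‖ := (hzm.sub_const z0).norm
  have hE : MeasurableSet ((Ω ∩ {x | ‖z x - z0‖ < δ}) ∩ Tᶜ) :=
    (hΩ.measurableSet.inter (measurableSet_lt hzm' measurable_const)).inter hTm.compl
  have hpos : 0 < μ ((Ω ∩ {x | ‖z x - z0‖ < δ}) ∩ Tᶜ) := by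
    rw [pos_iff_ne_zero, ← Set.diff_eq, measure_diff_null hT1]; exact hne
  obtain ⟨K, hKE, hK, hKpos⟩ := hE.exists_lt_isCompact_of_ne_top (measure_ne_top _ _) hpos
  have hKvol : volume K = 0 := measure_mono_null (fun x hx => (hKE hx).2) hT2
  set m := μ.real K with hm
  have hm0 : 0 < m := ENNReal.toReal_pos hKpos.ne' (measure_ne_top _ _)
  set κ := (volume.restrict Ω).withDensity fun x => ‖g x‖ₑ with hκ
  have hκf : IsFiniteMeasure κ := isFiniteMeasure_withDensity hg.2.ne
  have hκK : κ K = 0 := withDensity_absolutelyContinuous _ _ (by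
    exact measure_mono_null (le_refl K) (le_antisymm (hKvol ▸ Measure.restrict_apply_le _ _) zero_le))
  have hε : ENNReal.ofReal (δ * m) ≠ 0 := by simp; positivity
  obtain ⟨G0, hKG0, hG0, hlt⟩ := K.exists_isOpen_lt_add (μ := μ + κ) (measure_ne_top _ _) hε
  have hKΩ : K ⊆ Ω := fun x hx => (hKE hx).1.1
  obtain ⟨χ, hχ, hχc, hχG, hχ01, hχ1⟩ := cutoff hK (hG0.inter hΩ) (Set.subset_inter hKG0 hKΩ)
  have hdiff : (μ + κ) (G0 \ K) ≤ ENNReal.ofReal (δ * m) := by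
    rw [measure_diff hKG0 hK.measurableSet.nullMeasurableSet (measure_ne_top _ _)]
    exact tsub_le_iff_left.2 hlt.le
  rw [Measure.add_apply] at hdiff
  have hd1 : μ.real (G0 \ K) ≤ δ * m :=
    ENNReal.toReal_le_of_le_ofReal (by positivity) (le_self_add.trans hdiff)
  have hd2 : (κ G0).toReal ≤ δ * m := by
    refine ENNReal.toReal_le_of_le_ofReal (by positivity) ?_
    rw [← measure_diff_null hκK]
    exact le_add_self.trans hdiff
  have hχcont : Continuous χ := hχ.continuous
  have hχI : Integrable χ μ := hχcont.integrable_of_hasCompactSupport hχc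
  have hzb : ∀ x, ‖z x - z0‖ ≤ 1 + ‖z0‖ := fun x => (norm_sub_le _ _).trans (by linarith [hz1 x])
  have hχ0 : ∀ x, x ∉ G0 → χ x = 0 := fun x hx => image_eq_zero_of_notMem_tsupport fun h => hx (hχG h).1
  have hMm : m ≤ ∫ x, χ x ∂μ := by
    have : ∫ x, K.indicator (fun _ => (1:ℝ)) x ∂μ ≤ ∫ x, χ x ∂μ := by
      refine integral_mono ((integrable_const 1).indicator hK.measurableSet) hχI fun x => ?_
      by_cases h : x ∈ K
      · simp [h, hχ1 x h]
      · simp [h, (hχ01 x).1]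
    rwa [integral_indicator hK.measurableSet, setIntegral_const, smul_eq_mul, mul_one] at this
  have hA : ∫ x, χ x * ‖z x - z0‖ ∂μ ≤ δ * m + (1 + ‖z0‖) * (δ * m) := by
    have : ∫ x, χ x * ‖z x - z0‖ ∂μ ≤ ∫ x, (K.indicator (fun _ => δ) x + (G0 \ K).indicator (fun _ => 1 + ‖z0‖) x) ∂μ := by
      refine integral_mono_of_nonneg (Eventually.of_forall fun x => mul_nonneg (hχ01 x).1 (norm_nonneg _))
        (((integrable_const _).indicator hK.measurableSet).add
          ((integrable_const _).indicator (hG0.measurableSet.diff hK.measurableSet))) (Eventually.of_forall fun x => ?_)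
      dsimp only
      by_cases h : x ∈ K
      · have := (hKE h).1.2
        simp only [h, Set.indicator_of_mem, Set.mem_diff, not_true, and_false, not_false_eq_true, Set.indicator_of_notMem, hχ1 x h]
        simp only [Set.mem_setOf_eq] at this
        linarith
      · by_cases h2 : x ∈ G0
        · simp only [h, h2, Set.indicator_of_mem, Set.mem_diff, not_false_eq_true, and_self, Set.indicator_of_notMem, zero_add]
          have := mul_le_mul (hχ01 x).2 (hzb x) (norm_nonneg _) zero_le_one
          linarith
        · simp [h, h2, hχ0 x h2]
    rw [integral_add ((integrable_const _).indicator hK.measurableSet)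
          ((integrable_const _).indicator (hG0.measurableSet.diff hK.measurableSet)),
      integral_indicator hK.measurableSet, integral_indicator (hG0.measurableSet.diff hK.measurableSet),
      setIntegral_const, setIntegral_const, smul_eq_mul, smul_eq_mul] at this
    have h3 := mul_le_mul_of_nonneg_right hd1 (show 0 ≤ 1 + ‖z0‖ by positivity)
    linarith
  have hB : ∫ x in Ω, χ x * ‖g x‖ ≤ δ * m := by
    refine le_trans ?_ hd2
    rw [hκ, withDensity_apply _ hG0.measurableSet]
    rw [← integral_norm_eq_lintegral_enorm hg.aestronglyMeasurable.restrict, ← integral_indicator hG0.measurableSet]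
    refine integral_mono_of_nonneg (Eventually.of_forall fun x => mul_nonneg (hχ01 x).1 (norm_nonneg _))
      (hg.norm.indicator hG0.measurableSet) (Eventually.of_forall fun x => ?_)
    by_cases h2 : x ∈ G0
    · simp only [h2, Set.indicator_of_mem]
      exact mul_le_of_le_one_left (norm_nonneg _) (hχ01 x).2
    · simp [h2, hχ0 x h2]
  have hfin := hest Ω μ z g χ δ (3 + ‖z0‖) hsing hΩ.measurableSet hzm hz1 hg hfree hχ hχc
    (hχG.trans Set.inter_subset_right) hχ01 hδ (by
      have : (3 + ‖z0‖) * δ * m ≤ (3 + ‖z0‖) * δ * ∫ x, χ x ∂μ := mul_le_mul_of_nonneg_left hMm (by positivity)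
      linarith)
  set M := ∫ x, χ x ∂μ
  have h5 : C3 * δ * (1 + (3 + ‖z0‖)) ≤ 1 / 2 := by
    rw [hδd]
    have : C3 * (1 / (2 * (C3 + 1) * (4 + ‖z0‖))) * (1 + (3 + ‖z0‖)) = (C3 / (C3 + 1)) * (1/2) := by
      field_simp; ring
    rw [this]
    have : C3 / (C3 + 1) ≤ 1 := by rw [div_le_one (by linarith)]; linarith
    linarith
  nlinarith
theorem dpr (A : (Fin n → ℕ) → (V →L[ℝ] W))
    (Ω : Set (Dom n)) (μ : Measure (Dom n)) [IsFiniteMeasure μ] (z g : Dom n → V)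
    (hsing : μ ⟂ₘ (volume : Measure (Dom n))) (hΩ : IsOpen Ω) (hμ : μ Ωᶜ = 0)
    (hzm : Measurable z) (hz1 : ∀ x, ‖z x‖ ≤ 1) (hg : IntegrableOn g Ω)
    (hfree : ∀ φ : Dom n → W, ContDiff ℝ (⊤ : ℕ∞) φ → HasCompactSupport φ → tsupport φ ⊆ Ω →
        (∫ x in Ω, (inner ℝ (YoungMeasure.adjOp A k φ x) (g x) : ℝ)) +
          (∫ x, (inner ℝ (YoungMeasure.adjOp A k φ x) (z x) : ℝ) ∂μ) = 0) :
    ∀ᵐ x ∂μ, z x ∈ waveCone A k := by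
  have h : (μ.map z) (waveCone A k)ᶜ = 0 := by
    refine measure_null_of_locally_null _ fun z0 hz0 => ?_
    have hz0' : ∀ ξ : Dom n, ξ ≠ 0 → opSymbol A k ξ z0 ≠ 0 := fun ξ hξ h => hz0 ⟨ξ, hξ, h⟩
    obtain ⟨δ, hδ, h⟩ := dpr_core A z0 hz0' Ω μ z g hsing hΩ hzm hz1 hg hfree
    refine ⟨Metric.ball z0 δ, mem_nhdsWithin_of_mem_nhds (Metric.ball_mem_nhds _ hδ), ?_⟩
    rw [Measure.map_apply hzm Metric.isOpen_ball.measurableSet]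
    refine measure_mono_null (t := (Ω ∩ {x | ‖z x - z0‖ < δ}) ∪ Ωᶜ) (fun x hx => ?_) (measure_union_null h hμ)
    by_cases hx' : x ∈ Ω
    · left; refine ⟨hx', ?_⟩
      simpa [dist_eq_norm] using hx
    · right; exact hx'
  exact ae_of_ae_map hzm.aemeasurable (compl_mem_ae_iff.2 h |> fun h => by simpa using h)
end dpr3
section
section kk
variable {V : Type*} [NormedAddCommGroup V] [NormedSpace ℝ V]
structure KKGood (Lam : Set V) (L : ℝ) (h : V → ℝ) : Prop where
  lip : ∀ x y, |h x - h y| ≤ L * ‖x - y‖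
  hom : ∀ (t : ℝ) (x : V), 0 < t → h (t • x) = t * h x
  cvx : ∀ d ∈ Lam, ∀ w, ConvexOn ℝ Set.univ fun t : ℝ => h (w + t • d)
def AddDir (h : V → ℝ) (d : V) (a : ℝ) : Prop := ∀ w (s : ℝ), h (w + s • d) = h w + s * a
variable {Lam : Set V} {L : ℝ} {h : V → ℝ}
lemma KKGood.zero (H : KKGood Lam L h) : h 0 = 0 := by
  have := H.hom 2 0 (by norm_num)
  rw [smul_zero] at this; linarith
lemma KKGood.slope (H : KKGood Lam L h) {e : V} (he : e ∈ Lam) (w : V) {s : ℝ} (hs : 0 ≤ s) :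
    h (w + s • e) ≤ h w + s * h e := by
  have key : ∀ T : ℝ, 0 < T → s ≤ T → h (w + s • e) ≤ h w + s * h e + s / T * (L * ‖w‖ - h w) := by
    intro T hT hsT
    have hc := (H.cvx e he w).2 (Set.mem_univ (0:ℝ)) (Set.mem_univ T)
      (show 0 ≤ 1 - s / T by rw [sub_nonneg, div_le_one hT]; exact hsT) (show 0 ≤ s / T by positivity) (by ring)
    simp only [smul_eq_mul, mul_zero, zero_add, zero_smul, add_zero] at hc
    rw [div_mul_cancel₀ _ hT.ne'] at hc
    have h1 := (abs_le.1 (H.lip (w + T • e) (T • e))).2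
    rw [H.hom T e hT] at h1
    have h2 : w + T • e - T • e = w := by abel
    rw [h2] at h1
    have h3 : s / T * h (w + T • e) ≤ s / T * (T * h e + L * ‖w‖) := mul_le_mul_of_nonneg_left (by linarith) (by positivity)
    have h4 : s / T * (T * h e) = s * h e := by field_simp
    nlinarith
  have ht : Tendsto (fun T : ℝ => h w + s * h e + s / T * (L * ‖w‖ - h w)) atTop (𝓝 (h w + s * h e + 0 * (L * ‖w‖ - h w))) :=
    ((tendsto_const_nhds.div_atTop tendsto_id).mul_const _).const_add _
  rw [zero_mul, add_zero] at ht
  refine ge_of_tendsto ht ?_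
  filter_upwards [eventually_gt_atTop 0, eventually_ge_atTop s] with T h1 h2 using key T h1 h2
lemma KKGood.step (H : KKGood Lam L h) {e : V} (he : e ∈ Lam) :
    ∃ h', KKGood Lam L h' ∧ (∀ w, h' w ≤ h w) ∧ AddDir h' e (h e) ∧ ∀ d a, AddDir h d a → AddDir h' d a := by
  have hlim : ∀ w, ∃ l, Tendsto (fun t : ℝ => h (w + t • e) - t * h e) atTop (𝓝 l) ∧ l ≤ h w := by
    intro w
    have hanti : Antitone (fun t : ℝ => h (w + t • e) - t * h e) := by
      intro a b hab
      have := H.slope he (w + a • e) (sub_nonneg.2 hab)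
      rw [add_assoc, ← add_smul, add_sub_cancel] at this
      simp only; linarith
    have hb : BddBelow (Set.range fun t : ℝ => h (w + t • e) - t * h e) := by
      refine ⟨-(L * ‖w‖), ?_⟩
      rintro _ ⟨t, rfl⟩
      have h0 : ∀ t : ℝ, 0 < t → -(L * ‖w‖) ≤ h (w + t • e) - t * h e := by
        intro t ht
        have h1 := (abs_le.1 (H.lip (w + t • e) (t • e))).1
        rw [H.hom t e ht, add_sub_cancel_right] at h1
        linarith
      rcases lt_or_ge 0 t with ht | ht
      · exact h0 t ht
      · exact (h0 1 one_pos).trans (hanti (by linarith))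
    refine ⟨_, tendsto_atTop_ciInf hanti hb, ?_⟩
    have := ciInf_le hb 0
    simpa using this
  choose h' hl hle using hlim
  refine ⟨h', ⟨?_, ?_, ?_⟩, hle, ?_, ?_⟩
  · intro x y
    refine le_of_tendsto ((hl x).sub (hl y)).abs (Eventually.of_forall fun t => ?_)
    have := H.lip (x + t • e) (y + t • e)
    rw [add_sub_add_right_eq_sub] at this
    rwa [sub_sub_sub_cancel_right]
  · intro s x hs
    have h1 := hl (s • x)
    have h2 : Tendsto (fun t : ℝ => s * (h (x + (t / s) • e) - (t / s) * h e)) atTop (𝓝 (s * h' x)) :=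
      ((hl x).comp (tendsto_id.atTop_div_const hs)).const_mul s
    refine tendsto_nhds_unique h1 (h2.congr fun t => ?_)
    rw [mul_sub, ← H.hom s _ hs, smul_add, smul_smul]
    congr 1
    · congr 2; rw [mul_div_cancel₀ _ hs.ne']
    · field_simp
  · intro d hd w
    refine ⟨convex_univ, fun a _ b _ α β hα hβ hαβ => ?_⟩
    have h1 := hl (w + (α • a + β • b) • d)
    have h2 := ((hl (w + a • d)).const_mul α).add ((hl (w + b • d)).const_mul β)
    refine le_of_tendsto_of_tendsto h1 h2 (Eventually.of_forall fun t => ?_)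
    have := (H.cvx d hd (w + t • e)).2 (Set.mem_univ a) (Set.mem_univ b) hα hβ hαβ
    simp only [smul_eq_mul] at this ⊢
    simp only [add_right_comm w _ (t • e)]
    have e1 : t * h e = α * (t * h e) + β * (t * h e) := by rw [← add_mul, hαβ, one_mul]
    rw [mul_sub, mul_sub]; linarith
  · intro w s
    have h1 := hl (w + s • e)
    have h2 : Tendsto (fun t : ℝ => (h (w + (s + t) • e) - (s + t) * h e) + s * h e) atTop (𝓝 (h' w + s * h e)) :=
      ((hl w).comp (tendsto_atTop_add_const_left _ s tendsto_id)).add_const _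
    refine tendsto_nhds_unique h1 (h2.congr fun t => ?_)
    rw [add_smul, add_assoc]; ring
  · intro d a hd w s
    have h1 := hl (w + s • d)
    refine tendsto_nhds_unique h1 (((hl w).add_const (s * a)).congr fun t => ?_)
    rw [add_right_comm, hd]; ring
theorem kk [FiniteDimensional ℝ V] (H : KKGood Lam L h) (hspan : Submodule.span ℝ Lam = ⊤) {z0 : V} (hz0 : z0 ∈ Lam) :
    ∃ ℓ : V →ₗ[ℝ] ℝ, (∀ w, ℓ w ≤ h w) ∧ ℓ z0 = h z0 := by
  classical
  have hfin : ∀ s : Finset V, ↑s ⊆ Lam → ∃ h', KKGood Lam L h' ∧ (∀ w, h' w ≤ h w) ∧ AddDir h' z0 (h z0) ∧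
      ∀ d ∈ s, ∃ a, AddDir h' d a := by
    intro s
    induction s using Finset.induction_on with
    | empty =>
      intro _
      obtain ⟨h', h1, h2, h3, _⟩ := H.step hz0
      exact ⟨h', h1, h2, h3, by simp⟩
    | insert e s _ ih =>
      intro hs
      rw [Finset.coe_insert, Set.insert_subset_iff] at hs
      obtain ⟨h', h1, h2, h3, h4⟩ := ih hs.2
      obtain ⟨h'', g1, g2, g3, g4⟩ := h1.step hs.1
      refine ⟨h'', g1, fun w => (g2 w).trans (h2 w), g4 _ _ h3, ?_⟩
      intro d hd
      rw [Finset.mem_insert] at hd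
      rcases hd with rfl | hd
      · exact ⟨_, g3⟩
      · obtain ⟨a, ha⟩ := h4 d hd
        exact ⟨a, g4 _ _ ha⟩
  obtain ⟨s, hs, hs2⟩ := (Submodule.fg_span_iff_fg_span_finset_subset Lam).1 (by rw [hspan]; exact Module.Finite.fg_top)
  obtain ⟨h', h1, h2, h3, h4⟩ := hfin s hs
  let P : Submodule ℝ V :=
    { carrier := {d | ∃ a, AddDir h' d a}
      zero_mem' := ⟨0, fun w s => by simp⟩
      add_mem' := by
        rintro a b ⟨p, hp⟩ ⟨q, hq⟩
        refine ⟨p + q, fun w s => ?_⟩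
        rw [smul_add, ← add_assoc, hq, hp]; ring
      smul_mem' := by
        rintro c a ⟨p, hp⟩
        refine ⟨c * p, fun w s => ?_⟩
        rw [smul_smul, hp]; ring }
  have hP : P = ⊤ := by
    rw [eq_top_iff, ← hspan, hs2, Submodule.span_le]
    exact fun d hd => h4 d hd
  have hall : ∀ d, AddDir h' d (h' d) := by
    intro d
    have : d ∈ P := hP ▸ Submodule.mem_top
    obtain ⟨a, ha⟩ := this
    have h5 := ha 0 1
    rw [h1.zero, zero_add, one_smul, zero_add, one_mul] at h5
    rwa [h5]
  refine ⟨{ toFun := h', map_add' := fun x y => ?_, map_smul' := fun c x => ?_ }, h2, ?_⟩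
  · have := hall y x 1; simpa using this
  · have := hall x 0 c
    simpa [h1.zero] using this
  · have := h3 0 1
    simpa [h1.zero] using this
end kk
section
section patch
open scoped ENNReal
variable {n : ℕ} {U V : Type*} [NormedAddCommGroup U] [NormedSpace ℝ U] [NormedAddCommGroup V] [NormedSpace ℝ V]
def ctr (j : ℕ) (v : Fin n → ℤ) : Dom n := fun i => (v i + 1/2) / 2 ^ j
def hcube (n : ℕ) : Set (Dom n) := Set.univ.pi fun _ => Set.Ico (-(1/2) : ℝ) (1/2)
lemma mem_hcube_iff {j : ℕ} {v : Fin n → ℤ} {x : Dom n} :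
    (2:ℝ)^j • (x - ctr j v) ∈ hcube n ↔ x ∈ dcell j v := by
  rw [mem_dcell]
  simp only [hcube, ctr, Set.mem_pi, Set.mem_univ, true_imp_iff, Set.mem_Ico, Pi.smul_apply, Pi.sub_apply, smul_eq_mul]
  refine forall_congr' fun i => ?_
  have : (2:ℝ)^j * (x i - (v i + 1/2)/2^j) = 2^j * x i - (v i + 1/2) := by field_simp
  rw [this]
  constructor <;> rintro ⟨a, b⟩ <;> constructor <;> linarith
lemma cube_sub_hcube : unitCube n ⊆ hcube n :=
  Set.pi_mono fun _ _ => Set.Ioo_subset_Ico_self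
lemma cube_ae_hcube : (unitCube n) =ᵐ[volume] hcube n := by
  have h1 := Measure.univ_pi_Ioo_ae_eq_Icc (μ := fun _ : Fin n => (volume : Measure ℝ)) (f := fun _ => -(1/2)) (g := fun _ => 1/2)
  have h2 := Measure.univ_pi_Ico_ae_eq_Icc (μ := fun _ : Fin n => (volume : Measure ℝ)) (f := fun _ => -(1/2)) (g := fun _ => 1/2)
  exact h1.trans h2.symm
lemma cube_vol : volume (unitCube n) = 1 := by
  rw [unitCube, volume_pi_pi]; simp [Real.volume_Ioo]; norm_num
lemma cube_real : (volume.restrict (unitCube n)).real Set.univ = 1 := by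
  simp [Measure.real, cube_vol]
lemma cube_open : IsOpen (unitCube n) := isOpen_set_pi Set.finite_univ fun _ _ => isOpen_Ioo
lemma cube_cov (j : ℕ) (v : Fin n → ℤ) {E : Type*} [NormedAddCommGroup E] [NormedSpace ℝ E] (G : Dom n → E) :
    ∫ x in dcell j v, G ((2:ℝ)^j • (x - ctr j v)) = (((2:ℝ)^j)⁻¹)^n • ∫ x in unitCube n, G x := by
  rw [setIntegral_congr_set cube_ae_hcube, ← integral_indicator (dcell_meas j v),
    ← integral_indicator (s := hcube n) (MeasurableSet.univ_pi fun _ => measurableSet_Ico)]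
  have : (dcell j v).indicator (fun x => G ((2:ℝ)^j • (x - ctr j v))) =
      fun x => (hcube n).indicator G ((2:ℝ)^j • (x - ctr j v)) := by
    ext x
    by_cases h : x ∈ dcell j v
    · rw [Set.indicator_of_mem h, Set.indicator_of_mem (mem_hcube_iff.2 h)]
    · rw [Set.indicator_of_notMem h, Set.indicator_of_notMem (fun h' => h (mem_hcube_iff.1 h'))]
  rw [this, integral_sub_right_eq_self (fun x => (hcube n).indicator G ((2:ℝ)^j • x)) (ctr j v),
    Measure.integral_comp_smul_of_nonneg _ _ _ (hR := by positivity)]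
  simp [hcube]
lemma int_cov (j : ℕ) (a : Dom n) {E : Type*} [NormedAddCommGroup E] [NormedSpace ℝ E] (G : Dom n → E) :
    ∫ x, G ((2:ℝ)^j • (x - a)) = (((2:ℝ)^j)⁻¹)^n • ∫ x, G x := by
  rw [integral_sub_right_eq_self (fun x => G ((2:ℝ)^j • x)) a,
    Measure.integral_comp_smul_of_nonneg _ _ _ (hR := by positivity)]
  simp
def cidx (n j : ℕ) : Finset (Fin n → ℤ) := Fintype.piFinset fun _ => Finset.Ico (-(2^j)) (2^j)
lemma cidx_card (j : ℕ) : (cidx n j).card = (2^(j+1))^n := by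
  simp [cidx, Fintype.card_piFinset]
  congr 1
  have : ((2:ℤ)^j + 2^j) = ((2^(j+1) : ℕ) : ℤ) := by push_cast; ring
  rw [this, Int.toNat_natCast]
lemma hcube_eq (j : ℕ) : hcube n = ⋃ v ∈ cidx n j, dcell (j+1) v := by
  ext x
  simp only [Set.mem_iUnion, exists_prop]
  constructor
  · intro hx
    refine ⟨dix (j+1) x, ?_, rfl⟩
    simp only [cidx, Fintype.mem_piFinset, Finset.mem_Ico, dix]
    intro i
    have h := hx i trivial
    rw [Set.mem_Ico] at h
    have hp : (0:ℝ) < 2^j := by positivity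
    rw [Int.le_floor, Int.floor_lt]
    push_cast
    rw [pow_succ]
    constructor <;> nlinarith [h.1, h.2]
  · rintro ⟨v, hv, hx⟩ i -
    have h := mem_dcell.1 hx i
    simp only [cidx, Fintype.mem_piFinset, Finset.mem_Ico] at hv
    obtain ⟨h1, h2⟩ := hv i
    have h1' : (-(2^j) : ℝ) ≤ v i := by exact_mod_cast h1
    have h2' : (v i : ℝ) + 1 ≤ 2^j := by exact_mod_cast h2
    rw [pow_succ] at h
    have hp : (0:ℝ) < 2^j := by positivity
    constructor
    · by_contra hc
      nlinarith
    · by_contra hc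
      nlinarith
lemma dcell_disj (j : ℕ) (s : Set (Fin n → ℤ)) : s.PairwiseDisjoint (dcell j) := by
  intro v _ w _ hvw
  rw [Function.onFun, Set.disjoint_left]
  intro x hx hy
  exact hvw (hx.symm.trans hy)
lemma cube_split (j : ℕ) (H : Dom n → ℝ) (hH : IntegrableOn H (hcube n)) :
    ∫ x in unitCube n, H x = ∑ v ∈ cidx n j, ∫ x in dcell (j+1) v, H x := by
  rw [setIntegral_congr_set cube_ae_hcube, hcube_eq j, integral_biUnion_finset _ (fun v _ => dcell_meas _ v) (dcell_disj _ _)]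
  intro v hv
  refine hH.mono_set ?_
  rw [hcube_eq j]
  exact Set.subset_biUnion_of_mem (u := fun v => dcell (j+1) v) hv
def patch (l j : ℕ) (s : Finset (Fin n → ℤ)) (φ : (Fin n → ℤ) → Dom n → U) : Dom n → U :=
  fun x => ∑ v ∈ s, (((2:ℝ)^j)^l)⁻¹ • φ v ((2:ℝ)^j • (x - ctr j v))
variable {l j : ℕ} {s : Finset (Fin n → ℤ)} {φ : (Fin n → ℤ) → Dom n → U} (B : (Fin n → ℕ) → (U →L[ℝ] V))
lemma op_tsupport {u : Dom n → U} : tsupport (opApply B l u) ⊆ tsupport u := by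
  refine closure_minimal ?_ (isClosed_tsupport _)
  intro x hx
  by_contra h
  apply hx
  refine Finset.sum_eq_zero fun α _ => ?_
  rw [mderiv_eq_wd, image_eq_zero_of_notMem_tsupport (fun h' => h (wd_tsupport _ _ h')), map_zero]
lemma op_cont {u : Dom n → U} (hu : Sm u) : Continuous (opApply B l u) := by
  unfold opApply
  simp_rw [mderiv_eq_wd]
  exact continuous_finset_sum _ fun α _ => (B α).continuous.comp (hu.wd _).continuous
lemma op_patch (h : ∀ v ∈ s, CcSmooth (unitCube n) (φ v)) (x : Dom n) : opApply B l (patch l j s φ) x =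
    if dix j x ∈ s then opApply B l (φ (dix j x)) ((2:ℝ)^j • (x - ctr j (dix j x))) else 0 := by
  have hp : ((2:ℝ)^j)^l ≠ 0 := by positivity
  have h1 : opApply B l (patch l j s φ) x = ∑ v ∈ s, opApply B l (φ v) ((2:ℝ)^j • (x - ctr j v)) := by
    unfold opApply patch
    rw [Finset.sum_comm]
    refine Finset.sum_congr rfl fun α hα => ?_
    rw [mderiv_eq_wd, wd_sum (u := fun v x => (((2:ℝ)^j)^l)⁻¹ • φ v ((2:ℝ)^j • (x - ctr j v))) s
      (fun v hv => (Sm.affine (h v hv).1 _ _).const_smul _), map_sum]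
    refine Finset.sum_congr rfl fun v hv => ?_
    rw [wd_const_smul (Sm.affine (h v hv).1 _ _), wd_affine (h v hv).1, word_len hα, mderiv_eq_wd]
    simp only [smul_smul, inv_mul_cancel₀ hp, one_smul]
  rw [h1]
  have h2 : ∀ v ∈ s, v ≠ dix j x → opApply B l (φ v) ((2:ℝ)^j • (x - ctr j v)) = 0 := by
    intro v hv hne
    refine image_eq_zero_of_notMem_tsupport fun h' => hne ?_
    exact (mem_hcube_iff.1 (cube_sub_hcube ((h v hv).2.2 (op_tsupport B h')))).symm
  split_ifs with hx
  · exact Finset.sum_eq_single_of_mem _ hx h2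
  · exact Finset.sum_eq_zero fun v hv => h2 v hv fun e => hx (e ▸ hv)
lemma patch_sm (h : ∀ v ∈ s, CcSmooth (unitCube n) (φ v)) : Sm (patch l j s φ) :=
  ContDiff.sum fun v hv => (Sm.affine (h v hv).1 _ _).const_smul _
lemma patch_supp (h : ∀ v ∈ s, CcSmooth (unitCube n) (φ v)) :
    ∃ K, IsCompact K ∧ tsupport (patch l j s φ) ⊆ K ∧
      ∀ x ∈ K, ∃ v ∈ s, ∃ y ∈ unitCube n, x = ((2:ℝ)^j)⁻¹ • y + ctr j v := by
  have hp : (2:ℝ)^j ≠ 0 := by positivity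
  have hc : IsCompact (⋃ v ∈ s, (fun x : Dom n => ((2:ℝ)^j)⁻¹ • x + ctr j v) '' tsupport (φ v)) :=
    s.isCompact_biUnion fun v hv => (h v hv).2.1.isCompact.image (by fun_prop)
  refine ⟨_, hc, closure_minimal ?_ hc.isClosed, ?_⟩
  · intro x hx
    by_contra hn
    apply hx
    refine Finset.sum_eq_zero fun v hv => ?_
    rw [image_eq_zero_of_notMem_tsupport (f := φ v), smul_zero]
    intro h'
    refine hn (Set.mem_biUnion hv ⟨_, h', ?_⟩)
    simp [smul_smul, hp]
  · intro x hx
    simp only [Set.mem_iUnion, exists_prop] at hx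
    obtain ⟨v, hv, y, hy, rfl⟩ := hx
    exact ⟨v, hv, y, (h v hv).2.2 hy, rfl⟩
lemma patch_cc (h : ∀ v ∈ s, CcSmooth (unitCube n) (φ v)) {Ω : Set (Dom n)} (hΩ : ∀ v ∈ s, dcell j v ⊆ Ω) :
    CcSmooth Ω (patch l j s φ) := by
  obtain ⟨K, h1, h2, h3⟩ := patch_supp (l := l) (j := j) h
  refine ⟨patch_sm h, HasCompactSupport.of_support_subset_isCompact h1 (subset_closure.trans h2), fun x hx => ?_⟩
  obtain ⟨v, hv, y, hy, rfl⟩ := h3 x (h2 hx)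
  refine hΩ v hv ?_
  have hp : (2:ℝ)^j ≠ 0 := by positivity
  rw [← mem_hcube_iff]
  simp only [add_sub_cancel_right, smul_smul, mul_inv_cancel₀ hp, one_smul]
  exact cube_sub_hcube hy
lemma patch_cc_cube {j : ℕ} {φ : (Fin n → ℤ) → Dom n → U} (h : ∀ v ∈ cidx n j, CcSmooth (unitCube n) (φ v)) :
    CcSmooth (unitCube n) (patch l (j+1) (cidx n j) φ) := by
  have hp : (0:ℝ) < 2^(j+1) := by positivity
  obtain ⟨K, h1, h2, h3⟩ := patch_supp (l := l) (j := j+1) h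
  refine ⟨patch_sm h, HasCompactSupport.of_support_subset_isCompact h1 (subset_closure.trans h2), fun x hx => ?_⟩
  obtain ⟨v, hv, y, hy, rfl⟩ := h3 x (h2 hx)
  intro i _
  have hy' := hy i trivial
  simp only [cidx, Fintype.mem_piFinset, Finset.mem_Ico] at hv
  obtain ⟨h1, h2⟩ := hv i
  have h1' : (-(2^j) : ℝ) ≤ v i := by exact_mod_cast h1
  have h2' : (v i : ℝ) + 1 ≤ 2^j := by exact_mod_cast h2
  simp only [Pi.add_apply, Pi.smul_apply, smul_eq_mul, ctr]
  rw [Set.mem_Ioo] at hy' ⊢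
  rw [show (((2:ℝ)^(j+1))⁻¹ * y i + (v i + 1/2)/2^(j+1)) = (y i + v i + 1/2)/2^(j+1) by field_simp; ring,
    lt_div_iff₀ hp, div_lt_iff₀ hp, pow_succ]
  constructor <;> nlinarith [hy'.1, hy'.2]
lemma ccs_int {E : Type*} [NormedAddCommGroup E] {u : Dom n → E} (hu : Continuous u) (hc : HasCompactSupport u) :
    Integrable u := hu.integrable_of_hasCompactSupport hc
lemma iter_int {u : Dom n → U} (hu : Sm u) (hc : HasCompactSupport u) (i : ℕ) :
    Integrable (fun x => ‖iteratedFDeriv ℝ i u x‖) := by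
  refine ccs_int (hu.continuous_iteratedFDeriv (by exact_mod_cast le_top)).norm ?_
  exact (hc.iteratedFDeriv i).norm
lemma patch_sob (h : ∀ v ∈ s, CcSmooth (unitCube n) (φ v)) :
    sobNorm l (patch l j s φ) ≤ ((2:ℝ)^j)⁻¹ * ∑ v ∈ s, (((2:ℝ)^j)⁻¹)^n * sobNorm l (φ v) := by
  unfold sobNorm
  simp_rw [Finset.mul_sum]
  rw [Finset.sum_comm]
  refine Finset.sum_le_sum fun i hi => ?_
  have hil : i < l := Finset.mem_range.1 hi
  have hp : (1:ℝ) ≤ 2^j := one_le_pow₀ (by norm_num)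
  have e1 : ∀ x, ‖iteratedFDeriv ℝ i (patch l j s φ) x‖ ≤
      ∑ v ∈ s, ((2:ℝ)^j)⁻¹ * ‖iteratedFDeriv ℝ i (φ v) ((2:ℝ)^j • (x - ctr j v))‖ := by
    intro x
    have hs : ∀ v ∈ s, ContDiff ℝ i (fun x => φ v ((2:ℝ)^j • (x - ctr j v))) := fun v hv =>
      (Sm.affine (h v hv).1 _ _).of_le (by exact_mod_cast le_top)
    unfold patch
    rw [iteratedFDeriv_fun_sum_apply (fun v hv => ((hs v hv).const_smul _).contDiffAt)]
    refine (norm_sum_le _ _).trans (Finset.sum_le_sum fun v hv => ?_)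
    have h0 : ContDiff ℝ i (φ v) := (h v hv).1.of_le (by exact_mod_cast le_top)
    rw [iteratedFDeriv_const_smul_apply' (hs v hv).contDiffAt, norm_smul,
      iteratedFDeriv_comp_sub (f := fun x => φ v ((2:ℝ)^j • x)),
      iteratedFDeriv_comp_const_smul _ h0, norm_smul, ← mul_assoc]
    refine mul_le_mul_of_nonneg_right ?_ (norm_nonneg _)
    rw [norm_inv, norm_pow, norm_pow, norm_pow _ i, norm_pow, Real.norm_ofNat, inv_mul_le_iff₀ (by positivity),
      ← div_eq_mul_inv, le_div_iff₀ (by positivity), ← pow_succ]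
    exact pow_le_pow_right₀ hp hil
  have hint : ∀ v ∈ s, Integrable fun x => ((2:ℝ)^j)⁻¹ * ‖iteratedFDeriv ℝ i (φ v) ((2:ℝ)^j • (x - ctr j v))‖ :=
    fun v hv => (((iter_int (h v hv).1 (h v hv).2.1 i).comp_smul (by positivity)).comp_sub_right (ctr j v)).const_mul _
  refine (integral_mono_of_nonneg (ae_of_all _ fun x => norm_nonneg _)
    (integrable_finset_sum _ hint) (ae_of_all _ e1)).trans (le_of_eq ?_)
  rw [integral_finset_sum _ hint]
  refine Finset.sum_congr rfl fun v hv => ?_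
  rw [integral_const_mul, int_cov j (ctr j v) (fun x => ‖iteratedFDeriv ℝ i (φ v) x‖), smul_eq_mul]
/-- change of variables for the patched field -/
lemma patch_int {j : ℕ} {φ : (Fin n → ℤ) → Dom n → U} (h : ∀ v ∈ cidx n j, CcSmooth (unitCube n) (φ v))
    {F : V → ℝ} (hF : Continuous F) (c : V) :
    ∫ x in unitCube n, F (c + opApply B l (patch l (j+1) (cidx n j) φ) x) =
      ∑ v ∈ cidx n j, (((2:ℝ)^(j+1))⁻¹)^n * ∫ x in unitCube n, F (c + opApply B l (φ v) x) := by
  have hc : Continuous fun x => F (c + opApply B l (patch l (j+1) (cidx n j) φ) x) :=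
    hF.comp (continuous_const.add (op_cont B (patch_sm h)))
  have hb : IntegrableOn (fun x => F (c + opApply B l (patch l (j+1) (cidx n j) φ) x)) (hcube n) :=
    (hc.integrableOn_Icc (a := fun _ => -(1/2)) (b := fun _ => 1/2)).mono_set (by
      intro x hx
      exact ⟨fun i => (hx i trivial).1, fun i => (hx i trivial).2.le⟩)
  rw [cube_split j _ hb]
  refine Finset.sum_congr rfl fun v hv => ?_
  rw [← smul_eq_mul, ← cube_cov (j+1) v (fun x => F (c + opApply B l (φ v) x))]
  refine setIntegral_congr_fun (dcell_meas _ v) fun x hx => ?_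
  have hx' : dix (j+1) x = v := hx
  simp only [op_patch B h, hx', if_pos hv]
end patch
end
section
section quasi
variable {n : ℕ} {U V : Type*} [NormedAddCommGroup U] [NormedSpace ℝ U] [NormedAddCommGroup V] [NormedSpace ℝ V]
lemma hcube_int {E : Type*} [NormedAddCommGroup E] {H : Dom n → E} (hH : Continuous H) : IntegrableOn H (hcube n) :=
  (hH.integrableOn_Icc (a := fun _ => -(1/2)) (b := fun _ => 1/2)).mono_set (by
      intro x hx
      exact ⟨fun i => (hx i trivial).1, fun i => (hx i trivial).2.le⟩)
lemma cube_int {E : Type*} [NormedAddCommGroup E] {H : Dom n → E} (hH : Continuous H) : IntegrableOn H (unitCube n) :=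
  (hcube_int hH).mono_set cube_sub_hcube
lemma cube_mono {H G : Dom n → ℝ} (hH : Continuous H) (hG : Continuous G) (e : ℝ) (h : ∀ x, H x ≤ G x + e) :
    ∫ x in unitCube n, H x ≤ (∫ x in unitCube n, G x) + e := by
  have h1 := integral_mono (cube_int hH) (cube_int (hG.add continuous_const)) h
  rwa [integral_add' (cube_int hG) (cube_int continuous_const), integral_const, cube_real, one_smul] at h1
lemma dcell_int {E : Type*} [NormedAddCommGroup E] {H : Dom n → E} (hH : Continuous H) (j : ℕ) (v : Fin n → ℤ) :
    IntegrableOn H (dcell j v) :=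
  (hH.integrableOn_Icc (a := fun i => (v i : ℝ) / 2 ^ j) (b := fun i => (v i + 1) / 2 ^ j)).mono_set (by
      rw [dcell_eq_pi]
      intro x hx
      exact ⟨fun i => (hx i trivial).1, fun i => (hx i trivial).2.le⟩)
lemma dcell_real (j : ℕ) (v : Fin n → ℤ) : (volume.restrict (dcell j v)).real Set.univ = (((2:ℝ)^j)⁻¹)^n := by
  rw [Measure.real, Measure.restrict_apply_univ, dcell_vol, ENNReal.toReal_pow, ENNReal.toReal_ofReal (by positivity)]
lemma dcell_mono {H G : Dom n → ℝ} (hH : Continuous H) (hG : Continuous G) (e : ℝ) (j : ℕ) (v : Fin n → ℤ)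
    (h : ∀ x ∈ dcell j v, H x ≤ G x + e) :
    ∫ x in dcell j v, H x ≤ (∫ x in dcell j v, G x) + (((2:ℝ)^j)⁻¹)^n * e := by
  have h1 := setIntegral_mono_on (dcell_int hH j v) (dcell_int (hG.add continuous_const) j v) (dcell_meas j v) h
  rwa [integral_add' (dcell_int hG j v) (dcell_int continuous_const j v), integral_const, dcell_real] at h1
lemma cidx_sum (j : ℕ) (e : ℝ) : ∑ v ∈ cidx n j, (((2:ℝ)^(j+1))⁻¹)^n * e = e := by
  rw [Finset.sum_const, cidx_card, nsmul_eq_mul]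
  push_cast
  rw [← mul_assoc, ← mul_pow, mul_inv_cancel₀ (by positivity), one_pow, one_mul]
lemma lip_cont {F : V → ℝ} {L : ℝ} (hF : ∀ x y, |F x - F y| ≤ L * ‖x - y‖) : Continuous F := by
  refine (LipschitzWith.of_dist_le_mul (K := L.toNNReal) fun x y => ?_).continuous
  rw [Real.dist_eq, dist_eq_norm]
  exact (hF x y).trans (mul_le_mul_of_nonneg_right (Real.le_coe_toNNReal L) (norm_nonneg _))
lemma op_add (B : (Fin n → ℕ) → (U →L[ℝ] V)) {l : ℕ} {u v : Dom n → U} (hu : Sm u) (hv : Sm v) (x : Dom n) :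
    opApply B l (fun x => u x + v x) x = opApply B l u x + opApply B l v x := by
  unfold opApply
  rw [← Finset.sum_add_distrib]
  refine Finset.sum_congr rfl fun α _ => ?_
  simp only [mderiv_eq_wd]
  rw [wd_add hu hv, map_add]
lemma op_zero (B : (Fin n → ℕ) → (U →L[ℝ] V)) {l : ℕ} (x : Dom n) :
    opApply B l (fun _ => (0:U)) x = 0 := by
  unfold opApply
  refine Finset.sum_eq_zero fun α _ => ?_
  rw [mderiv_eq_wd, wd_zero, map_zero]
lemma cc_zero (Ω : Set (Dom n)) : CcSmooth Ω (fun _ => (0:U)) := by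
  refine ⟨contDiff_const, HasCompactSupport.zero, ?_⟩
  have : tsupport (fun _ : Dom n => (0:U)) = ∅ := tsupport_eq_empty_iff.2 rfl
  rw [this]; exact Set.empty_subset _
variable (B : (Fin n → ℕ) → (U →L[ℝ] V)) (l : ℕ)
def Iq (F : V → ℝ) (c : V) (φ : Dom n → U) : ℝ := ∫ x in unitCube n, F (c + opApply B l φ x)
def Qc (F : V → ℝ) (c : V) : ℝ := ⨅ φ : {φ : Dom n → U // CcSmooth (unitCube n) φ}, Iq B l F c φ.1
variable {B l} {F : V → ℝ} {L : ℝ} (hF : ∀ x y, |F x - F y| ≤ L * ‖x - y‖)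
include hF
lemma Iq_cont {φ : Dom n → U} (hφ : Sm φ) (c : V) : Continuous fun x => F (c + opApply B l φ x) :=
  (lip_cont hF).comp (continuous_const.add (op_cont B hφ))
lemma Iq_lip {φ : Dom n → U} (hφ : Sm φ) (c c' : V) : Iq B l F c φ ≤ Iq B l F c' φ + L * ‖c - c'‖ := by
  refine cube_mono (Iq_cont hF hφ c) (Iq_cont hF hφ c') _ fun x => ?_
  have := le_of_abs_le (hF (c + opApply B l φ x) (c' + opApply B l φ x))
  rw [add_sub_add_right_eq_sub] at this
  linarith
variable {c0 : V} {m : ℝ} (hm : ∀ φ : Dom n → U, CcSmooth (unitCube n) φ → m ≤ Iq B l F c0 φ)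
include hm
lemma Q_bdd (c : V) : BddBelow (Set.range fun φ : {φ : Dom n → U // CcSmooth (unitCube n) φ} => Iq B l F c φ.1) := by
  refine ⟨m - L * ‖c0 - c‖, ?_⟩
  rintro _ ⟨φ, rfl⟩
  have := Iq_lip hF (B := B) (l := l) φ.2.1 c0 c
  linarith [hm φ.1 φ.2]
lemma Q_le {φ : Dom n → U} (hφ : CcSmooth (unitCube n) φ) (c : V) : Qc B l F c ≤ Iq B l F c φ :=
  ciInf_le (Q_bdd hF hm c) ⟨φ, hφ⟩
omit hF hm in
lemma Q_near (c : V) {δ : ℝ} (hδ : 0 < δ) : ∃ φ : Dom n → U, CcSmooth (unitCube n) φ ∧ Iq B l F c φ < Qc B l F c + δ := by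
  haveI : Nonempty {φ : Dom n → U // CcSmooth (unitCube n) φ} := ⟨⟨_, cc_zero _⟩⟩
  obtain ⟨φ, h⟩ := exists_lt_of_ciInf_lt (show Qc B l F c < Qc B l F c + δ by linarith)
  exact ⟨φ.1, φ.2, h⟩
lemma Q_lip1 (c c' : V) : Qc B l F c ≤ Qc B l F c' + L * ‖c - c'‖ := by
  refine le_of_forall_pos_le_add fun δ hδ => ?_
  obtain ⟨φ, h1, h2⟩ := Q_near (B := B) (l := l) (F := F) c' hδ
  have := Iq_lip hF (B := B) (l := l) h1.1 c c'
  linarith [Q_le hF hm h1 c]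
lemma Q_lip (c c' : V) : |Qc B l F c - Qc B l F c'| ≤ L * ‖c - c'‖ := by
  have h1 := Q_lip1 hF hm c c'
  have h2 := Q_lip1 hF hm c' c
  rw [norm_sub_rev] at h2
  rw [abs_le]; constructor <;> linarith
lemma Q_le_F (c : V) : Qc B l F c ≤ F c := by
  have := Q_le hF hm (cc_zero (unitCube n)) c
  simp only [Iq, op_zero, add_zero, integral_const, cube_real, one_smul] at this
  exact this
lemma Q_qc {φ0 : Dom n → U} (h0 : CcSmooth (unitCube n) φ0) (c : V) : Qc B l F c ≤ Iq B l (Qc B l F) c φ0 := by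
  have hfc := lip_cont (Q_lip hF hm)
  have hL : 0 ≤ |L| := abs_nonneg L
  have key : ∀ δ : ℝ, 0 < δ → Qc B l F c ≤ Iq B l (Qc B l F) c φ0 + (1 + 2 * |L|) * δ := by
    intro δ hδ
    have hcs : HasCompactSupport (opApply B l φ0) := h0.2.1.mono' (subset_closure.trans (op_tsupport B))
    obtain ⟨ε, hε, hu⟩ := Metric.uniformContinuous_iff.1 (hcs.uniformContinuous_of_continuous (op_cont B h0.1)) δ hδ
    obtain ⟨j, hj⟩ := exists_pow_lt_of_lt_one hε (show (1/2:ℝ) < 1 by norm_num)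
    have hcell : ∀ v, ∀ x ∈ dcell (j+1) v, ‖opApply B l φ0 x - opApply B l φ0 (ctr (j+1) v)‖ ≤ δ := by
      intro v x hx
      rw [← dist_eq_norm]
      refine (hu ?_).le
      have hv : (ctr (j+1) v : Dom n) ∈ dcell (j+1) v := by
        rw [← mem_hcube_iff]; intro i _; simp
      rw [dist_eq_norm]
      refine (dcell_dist hx hv).trans_lt (lt_of_le_of_lt ?_ hj)
      rw [one_div, inv_pow]
      exact inv_anti₀ (by positivity) (pow_le_pow_right₀ (by norm_num) (Nat.le_succ j))
    choose φ hφ1 hφ2 using fun v => Q_near (B := B) (l := l) (F := F) (c + opApply B l φ0 (ctr (j+1) v)) hδ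
    have hp : CcSmooth (unitCube n) (patch l (j+1) (cidx n j) φ) := patch_cc_cube fun v _ => hφ1 v
    have hs : CcSmooth (unitCube n) (fun x => φ0 x + patch l (j+1) (cidx n j) φ x) :=
      ⟨h0.1.add hp.1, h0.2.1.add hp.2.1, (tsupport_add _ _).trans (Set.union_subset h0.2.2 hp.2.2)⟩
    refine (Q_le hF hm hs c).trans ?_
    have c1 := Iq_cont hF (B := B) (l := l) hs.1 c
    have c2 := Iq_cont (Q_lip hF hm) (B := B) (l := l) h0.1 c
    rw [Iq, Iq, cube_split j _ (hcube_int c1), cube_split j _ (hcube_int c2),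
      ← cidx_sum (n := n) j ((1 + 2 * |L|) * δ), ← Finset.sum_add_distrib]
    refine Finset.sum_le_sum fun v hv => ?_
    have hsm : Sm (φ v) := (hφ1 v).1
    have cF := Iq_cont hF (B := B) (l := l) hsm (c + opApply B l φ0 (ctr (j+1) v))
    have e1 := dcell_mono c1 (cF.comp ((continuous_id.sub continuous_const).const_smul ((2:ℝ)^(j+1)))) (|L| * δ) (j+1) v (by
      intro x hx
      have hx' : dix (j+1) x = v := hx
      change F _ ≤ F (c + _ + opApply B l (φ v) ((2:ℝ)^(j+1) • (x - ctr (j+1) v))) + _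
      have h1 := le_of_abs_le (hF (c + opApply B l (fun x => φ0 x + patch l (j+1) (cidx n j) φ x) x)
        (c + opApply B l φ0 (ctr (j+1) v) + opApply B l (φ v) ((2:ℝ)^(j+1) • (x - ctr (j+1) v))))
      rw [op_add B h0.1 hp.1, op_patch B (fun v _ => hφ1 v), hx', if_pos hv] at h1 ⊢
      have h2 : L * ‖c + (opApply B l φ0 x + opApply B l (φ v) ((2:ℝ)^(j+1) • (x - ctr (j+1) v))) -
          (c + opApply B l φ0 (ctr (j+1) v) + opApply B l (φ v) ((2:ℝ)^(j+1) • (x - ctr (j+1) v)))‖ ≤ |L| * δ := by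
        refine mul_le_mul (le_abs_self L) ?_ (norm_nonneg _) hL
        refine le_trans (le_of_eq (congrArg norm ?_)) (hcell v x hx)
        abel
      linarith)
    have e2 := cube_cov (j+1) v (fun x => F (c + opApply B l φ0 (ctr (j+1) v) + opApply B l (φ v) x))
    have e3 := dcell_mono (continuous_const (y := Qc B l F (c + opApply B l φ0 (ctr (j+1) v)))) c2 (|L| * δ) (j+1) v (by
      intro x hx
      have h1 := le_of_abs_le (Q_lip hF hm (c + opApply B l φ0 (ctr (j+1) v)) (c + opApply B l φ0 x))
      have h2 : L * ‖c + opApply B l φ0 (ctr (j+1) v) - (c + opApply B l φ0 x)‖ ≤ |L| * δ := by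
        refine mul_le_mul (le_abs_self L) ?_ (norm_nonneg _) hL
        rw [add_sub_add_left_eq_sub, norm_sub_rev]
        exact hcell v x hx
      linarith)
    rw [integral_const, dcell_real, smul_eq_mul] at e3
    have e4 := mul_le_mul_of_nonneg_left (hφ2 v).le (show 0 ≤ (((2:ℝ)^(j+1))⁻¹)^n by positivity)
    have e1 := e1.trans_eq (congrArg (· + (((2:ℝ)^(j+1))⁻¹)^n * (|L| * δ)) e2)
    simp only [smul_eq_mul] at e1
    simp only [Iq] at e4
    linarith
  refine le_of_forall_pos_le_add fun δ hδ => ?_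
  have := key (δ / (1 + 2 * |L|)) (by positivity)
  rwa [mul_div_cancel₀ _ (by positivity)] at this
end quasi
end
section
section wave
variable {n : ℕ} {U V : Type*} [NormedAddCommGroup U] [NormedSpace ℝ U] [NormedAddCommGroup V] [NormedSpace ℝ V]
lemma iter_cos (a : ℝ) (m : ℕ) : iteratedDeriv m (fun t : ℝ => Real.cos (t + a)) = fun t => Real.cos (t + (a + m * (Real.pi / 2))) := by
  induction m with
  | zero => simp [iteratedDeriv_zero]
  | succ m ih =>
    rw [iteratedDeriv_succ, ih]
    ext t
    have h : HasDerivAt (fun t : ℝ => Real.cos (t + (a + m * (Real.pi / 2)))) (-Real.sin (t + (a + m * (Real.pi / 2))) * 1) t :=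
      ((hasDerivAt_id t).add_const _).cos
    rw [h.deriv, mul_one, ← Real.cos_add_pi_div_two]
    congr 1; push_cast; ring
lemma exists_chi (δ : ℝ) (hδ : 0 < δ) : ∃ χ : Dom n → ℝ, CcSmooth (unitCube n) χ ∧ (∀ x, 0 ≤ χ x ∧ χ x ≤ 1) ∧
    ∫ x in unitCube n, (1 - χ x) ≤ δ := by
  obtain ⟨K, hK1, hK2, hK3⟩ := (cube_open (n := n)).measurableSet.exists_isCompact_lt_add (μ := volume)
    (by rw [cube_vol]; simp) (ε := ENNReal.ofReal δ) (by simpa using hδ)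
  obtain ⟨χ, h1, h2, h3, h4, h5⟩ := cutoff hK2 cube_open hK1
  refine ⟨χ, ⟨h1, h2, h3⟩, h4, ?_⟩
  have hm : (volume K) ≠ ⊤ := hK2.measure_lt_top.ne
  have hle : ∫ x in unitCube n, (1 - χ x) ≤ ∫ x in unitCube n, (1 - K.indicator (fun _ => (1:ℝ)) x) := by
    refine setIntegral_mono (cube_int (continuous_const.sub h1.continuous)) ?_ ?_
    · exact (cube_int (continuous_const (y := (1:ℝ)))).sub ((cube_int (continuous_const (y := (1:ℝ)))).indicator hK2.measurableSet)
    · intro x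
      by_cases hx : x ∈ K
      · simp [hx, h5 x hx]
      · simpa [hx] using (h4 x).1
  refine hle.trans ?_
  have hi : Integrable (K.indicator fun _ => (1:ℝ)) (volume.restrict (unitCube n)) :=
    (cube_int (continuous_const (y := (1:ℝ)))).indicator hK2.measurableSet
  rw [integral_sub (cube_int continuous_const) hi,
    integral_indicator hK2.measurableSet, Measure.restrict_restrict hK2.measurableSet, Set.inter_eq_left.2 hK1,
    integral_const, integral_const, cube_real, smul_eq_mul, smul_eq_mul, mul_one, mul_one, Measure.real, Measure.restrict_apply_univ]
  rw [cube_vol] at hK3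
  have := ENNReal.toReal_mono (ENNReal.add_ne_top.2 ⟨hm, ENNReal.ofReal_ne_top⟩) hK3.le
  rw [ENNReal.toReal_add hm ENNReal.ofReal_ne_top, ENNReal.toReal_ofReal hδ.le] at this
  simp at this
  linarith
/-- the oscillating test field -/
lemma wave_field (B : (Fin n → ℕ) → (U →L[ℝ] V)) (l : ℕ) (ξ : Dom n) (u0 : U) {χ : Dom n → ℝ} (hχ : CcSmooth (unitCube n) χ) :
    ∃ C, 0 ≤ C ∧ ∀ r : ℝ, ∀ N : ℝ, 1 ≤ N → ∀ τ : ℝ, ∃ φ : Dom n → U, CcSmooth (unitCube n) φ ∧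
      ∀ x, ‖opApply B l φ x - (r * χ x * Real.cos ((∑ i, (N * ξ i) * x i) + τ)) • opSymbol B l ξ u0‖ ≤ |r| * (C / N) := by
  choose C hC0 hC using fun w => leibniz w χ hχ.1 hχ.2.1
  set M : ℝ := (max 1 ‖ξ‖) ^ l with hM
  refine ⟨∑ α ∈ degSet n l, C (word α) * M * ‖B α u0‖, Finset.sum_nonneg fun α _ => by have := hC0 (word α); positivity, ?_⟩
  intro r N hN τ
  have hN0 : 0 < N := by linarith
  set g : ℝ → ℝ := fun t => Real.cos (t + -(l * (Real.pi / 2))) with hg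
  have hgs : ContDiff ℝ (⊤ : ℕ∞) g := by
    exact Real.contDiff_cos.comp (contDiff_id.add contDiff_const)
  set W : Dom n → ℝ := fun x => g ((∑ i, (N * ξ i) * x i) + τ) with hW
  have hWs : Sm W := by
    refine hgs.comp (ContDiff.add ?_ contDiff_const)
    exact ContDiff.sum fun i _ => contDiff_const.mul (contDiff_apply ℝ ℝ i)
  have hχW : Sm (fun x => χ x * W x) := hχ.1.mul hWs
  have hf : Sm (fun x => (r / N ^ l) * (χ x * W x)) := contDiff_const.mul hχW
  have hts : tsupport (fun x => ((r / N ^ l) * (χ x * W x)) • u0) ⊆ tsupport χ := by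
    refine closure_mono ?_
    intro x hx h
    apply hx
    have h' : χ x = 0 := h
    simp [h']
  refine ⟨fun x => ((r / N ^ l) * (χ x * W x)) • u0, ⟨hf.smul contDiff_const, hχ.2.1.mono' (subset_closure.trans hts), hts.trans hχ.2.2⟩, ?_⟩
  intro x
  rw [op_scalar hf]
  have hprod : ∀ w : List (Fin n), (w.map fun i => N * ξ i).prod = N ^ w.length * (w.map ξ).prod := by
    intro w
    induction w with
    | nil => simp
    | cons a w ih => simp only [List.map_cons, List.prod_cons, ih, List.length_cons, pow_succ]; ring
  have hprod2 : ∀ w : List (Fin n), |(w.map ξ).prod| ≤ (max 1 ‖ξ‖) ^ w.length := by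
    intro w
    induction w with
    | nil => simp
    | cons a w ih =>
      simp only [List.map_cons, List.prod_cons, List.length_cons, pow_succ, abs_mul]
      rw [mul_comm]
      exact mul_le_mul ih ((norm_le_pi_norm ξ a).trans (le_max_right _ _)) (abs_nonneg _) (by positivity)
  have hwd : ∀ w x, wd w W x = N ^ w.length * (w.map ξ).prod *
      Real.cos (((∑ i, (N * ξ i) * x i) + τ) + (-(l * (Real.pi / 2)) + w.length * (Real.pi / 2))) := by
    intro w x
    rw [hW, wd_wave hgs (fun i => N * ξ i) τ w, hprod, hg, iter_cos]
  have hlow : ∀ w : List (Fin n), w.length < l → ∀ x, |wd w W x| ≤ N ^ l / N * M := by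
    intro w hw x
    rw [hwd, abs_mul, abs_mul, abs_of_pos (show 0 < N ^ w.length by positivity)]
    have h1 : |(w.map ξ).prod| ≤ M := (hprod2 w).trans (pow_le_pow_right₀ (le_max_left _ _) hw.le)
    have h2 : N ^ w.length ≤ N ^ l / N := by
      rw [le_div_iff₀ hN0, ← pow_succ]
      exact pow_le_pow_right₀ hN hw
    calc _ ≤ N ^ w.length * |(w.map ξ).prod| * 1 := mul_le_mul_of_nonneg_left (Real.abs_cos_le_one _) (by positivity)
      _ ≤ _ := by rw [mul_one]; exact mul_le_mul h2 h1 (abs_nonneg _) (by positivity)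
  have hsym : (r * χ x * Real.cos ((∑ i, (N * ξ i) * x i) + τ)) • opSymbol B l ξ u0 =
      ∑ α ∈ degSet n l, ((r / N ^ l) * (χ x * wd (word α) W x)) • B α u0 := by
    simp only [opSymbol, ContinuousLinearMap.sum_apply, ContinuousLinearMap.smul_apply, Finset.smul_sum, smul_smul]
    refine Finset.sum_congr rfl fun α hα => ?_
    congr 1
    rw [hwd, word_len hα, word_prod, neg_add_cancel, add_zero]
    field_simp
  rw [hsym, ← Finset.sum_sub_distrib, Finset.sum_div, Finset.mul_sum]
  refine (norm_sum_le _ _).trans (Finset.sum_le_sum fun α hα => ?_)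
  have h4 := wd_const_smul hχW (r / N ^ l) (word α)
  simp only [smul_eq_mul] at h4
  rw [h4]
  rw [← sub_smul, norm_smul, ← mul_sub, norm_mul, Real.norm_eq_abs, Real.norm_eq_abs, abs_div, abs_of_pos (show 0 < N ^ l by positivity)]
  have h3 := hC (word α) W (N ^ l / N * M) hWs (by rw [word_len hα]; exact hlow) x
  calc _ ≤ |r| / N ^ l * (C (word α) * (N ^ l / N * M)) * ‖B α u0‖ := by gcongr
    _ = _ := by field_simp
end wave
end
section
section mean
variable {n : ℕ} {U V : Type*} [NormedAddCommGroup U] [NormedSpace ℝ U] [NormedAddCommGroup V] [NormedSpace ℝ V]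
lemma le_of_small {a b K : ℝ} (hK : 0 ≤ K) (h : ∀ δ : ℝ, 0 < δ → a ≤ b + K * δ) : a ≤ b := by
  refine le_of_forall_pos_le_add fun δ hδ => ?_
  have := h (δ / (K + 1)) (by positivity)
  have h2 : K * (δ / (K + 1)) ≤ δ := by
    rw [mul_div_assoc', div_le_iff₀ (by positivity)]; nlinarith
  linarith
lemma wave_mean {B : (Fin n → ℕ) → (U →L[ℝ] V)} {l : ℕ} {f : V → ℝ} {L : ℝ} (hf : ∀ x y, |f x - f y| ≤ L * ‖x - y‖)
    (hqc : ∀ φ : Dom n → U, CcSmooth (unitCube n) φ → ∀ c, f c ≤ Iq B l f c φ) (ξ : Dom n) (u0 : U) (c : V) (r : ℝ) :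
    f c * (2 * Real.pi) ≤ ∫ τ in (0:ℝ)..(2 * Real.pi), f (c + (r * Real.cos τ) • opSymbol B l ξ u0) := by
  set d := opSymbol B l ξ u0 with hd
  set J := ∫ τ in (0:ℝ)..(2 * Real.pi), f (c + (r * Real.cos τ) • d) with hJ
  have hpi : 0 < 2 * Real.pi := by positivity
  have hfc := lip_cont hf
  have hL0 : 0 ≤ |L| := abs_nonneg L
  refine le_of_small (K := (2 * Real.pi) * (|L| * |r| * (1 + ‖d‖))) (by positivity) fun δ hδ => ?_
  obtain ⟨χ, h1, h2, h3⟩ := exists_chi (n := n) δ hδ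
  obtain ⟨C, hC0, hC⟩ := wave_field B l ξ u0 h1
  set N : ℝ := max 1 (C / δ) with hN
  have hN1 : 1 ≤ N := le_max_left _ _
  have hCN : C / N ≤ δ := by
    rw [div_le_iff₀ (by linarith), ← div_le_iff₀' hδ]; exact le_max_right _ _
  set θ : Dom n → ℝ := fun x => ∑ i, (N * ξ i) * x i with hθ
  have hθc : Continuous θ := by fun_prop
  have hGc : Continuous fun p : Dom n × ℝ => f (c + (r * Real.cos (θ p.1 + p.2)) • d) := by fun_prop
  have hG1 : ∀ τ, Continuous fun x => f (c + (r * Real.cos (θ x + τ)) • d) := fun τ => by fun_prop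
  have step : ∀ τ, f c ≤ (∫ x in unitCube n, f (c + (r * Real.cos (θ x + τ)) • d)) + |L| * |r| * (1 + ‖d‖) * δ := by
    intro τ
    obtain ⟨φ, hφ, he⟩ := hC r N hN1 τ
    refine (hqc φ hφ c).trans ?_
    have hpt : ∀ x, f (c + opApply B l φ x) ≤ f (c + (r * Real.cos (θ x + τ)) • d) + |L| * |r| * (δ + ‖d‖ * (1 - χ x)) := by
      intro x
      have e1 := le_of_abs_le (hf (c + opApply B l φ x) (c + (r * Real.cos (θ x + τ)) • d))
      have e2 : ‖c + opApply B l φ x - (c + (r * Real.cos (θ x + τ)) • d)‖ ≤ |r| * (δ + ‖d‖ * (1 - χ x)) := by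
        have e3 : c + opApply B l φ x - (c + (r * Real.cos (θ x + τ)) • d) =
            (opApply B l φ x - (r * χ x * Real.cos (θ x + τ)) • d) - (r * (1 - χ x) * Real.cos (θ x + τ)) • d := by
          module
        rw [e3]
        refine (norm_sub_le _ _).trans ?_
        have e4 := (he x).trans (mul_le_mul_of_nonneg_left hCN (abs_nonneg r))
        have e5 : ‖(r * (1 - χ x) * Real.cos (θ x + τ)) • d‖ ≤ |r| * (1 - χ x) * 1 * ‖d‖ := by
          rw [norm_smul, norm_mul, norm_mul, Real.norm_eq_abs, Real.norm_eq_abs, Real.norm_eq_abs, abs_of_nonneg (show 0 ≤ 1 - χ x by linarith [(h2 x).2])]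
          have : 0 ≤ 1 - χ x := by linarith [(h2 x).2]
          gcongr
          exact Real.abs_cos_le_one _
        linarith
      have e6 : L * ‖c + opApply B l φ x - (c + (r * Real.cos (θ x + τ)) • d)‖ ≤ |L| * (|r| * (δ + ‖d‖ * (1 - χ x))) :=
        mul_le_mul (le_abs_self L) e2 (norm_nonneg _) hL0
      linarith
    have hχc : Continuous fun x => (1 - χ x) := continuous_const.sub h1.1.continuous
    have i1 := cube_int (hG1 τ)
    have i2 := cube_int hχc
    have e1 := integral_mono (cube_int (Iq_cont hf (B := B) (l := l) hφ.1 c))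
      (i1.add (((cube_int (continuous_const (y := δ))).add (i2.const_mul ‖d‖)).const_mul (|L| * |r|))) hpt
    rw [Iq]
    refine e1.trans ?_
    simp only [Pi.add_apply]
    have i3 : Integrable (fun x => |L| * |r| * (δ + ‖d‖ * (1 - χ x))) (volume.restrict (unitCube n)) :=
      ((cube_int (continuous_const (y := δ))).add (i2.const_mul ‖d‖)).const_mul (|L| * |r|)
    rw [integral_add i1 i3, integral_const_mul, integral_add (cube_int (continuous_const (y := δ))) (i2.const_mul ‖d‖), integral_const_mul,
      integral_const, cube_real, one_smul]
    have e7 : |L| * |r| * (δ + ‖d‖ * ∫ x in unitCube n, (1 - χ x)) ≤ |L| * |r| * (δ + ‖d‖ * δ) := by gcongr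
    linarith
  have hint : Integrable (fun p : ℝ × Dom n => f (c + (r * Real.cos (θ p.2 + p.1)) • d))
      ((volume.restrict (Set.Ioc 0 (2 * Real.pi))).prod (volume.restrict (unitCube n))) := by
    haveI : IsFiniteMeasure (volume.restrict (unitCube n)) := ⟨by simp [cube_vol]⟩
    refine Integrable.of_bound (hGc.comp continuous_swap).aestronglyMeasurable (|f c| + |L| * (|r| * ‖d‖)) (ae_of_all _ fun p => ?_)
    have e1 := (hf (c + (r * Real.cos (θ p.2 + p.1)) • d) c)
    rw [add_sub_cancel_left, norm_smul, norm_mul] at e1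
    have e2 : L * (‖r‖ * ‖Real.cos (θ p.2 + p.1)‖ * ‖d‖) ≤ |L| * (|r| * ‖d‖) := by
      have := Real.abs_cos_le_one (θ p.2 + p.1)
      calc L * (‖r‖ * ‖Real.cos (θ p.2 + p.1)‖ * ‖d‖) ≤ |L| * (|r| * 1 * ‖d‖) :=
            mul_le_mul (le_abs_self L) (by rw [Real.norm_eq_abs, Real.norm_eq_abs]; gcongr) (by positivity) hL0
        _ = _ := by ring
    rw [Real.norm_eq_abs]
    have := abs_sub_abs_le_abs_sub (f (c + (r * Real.cos (θ p.2 + p.1)) • d)) (f c)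
    linarith
  have hsw : ∫ τ in (0:ℝ)..(2 * Real.pi), ∫ x in unitCube n, f (c + (r * Real.cos (θ x + τ)) • d) = J := by
    rw [intervalIntegral.integral_of_le hpi.le, integral_integral_swap hint]
    have : ∀ x : Dom n, ∫ τ in Set.Ioc 0 (2 * Real.pi), f (c + (r * Real.cos (θ x + τ)) • d) = J := by
      intro x
      rw [← intervalIntegral.integral_of_le hpi.le,
        intervalIntegral.integral_comp_add_left (fun τ => f (c + (r * Real.cos τ) • d)) (θ x), hJ, add_zero]
      have hper : Function.Periodic (fun τ => f (c + (r * Real.cos τ) • d)) (2 * Real.pi) := fun τ => by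
        simp only [Real.cos_add_two_pi]
      have := hper.intervalIntegral_add_eq (θ x) 0
      rwa [zero_add] at this
    simp only [this, integral_const, cube_real, one_smul]
  have hcI : IntervalIntegrable (fun τ => ∫ x in unitCube n, f (c + (r * Real.cos (θ x + τ)) • d)) volume 0 (2 * Real.pi) := by
    rw [intervalIntegrable_iff_integrableOn_Ioc_of_le hpi.le]
    exact hint.integral_prod_left
  have := intervalIntegral.integral_mono_on hpi.le (intervalIntegrable_const (c := f c))
    (hcI.add (intervalIntegrable_const (c := |L| * |r| * (1 + ‖d‖) * δ))) (fun τ _ => step τ)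
  rw [intervalIntegral.integral_add hcI intervalIntegrable_const, hsw, intervalIntegral.integral_const,
    intervalIntegral.integral_const] at this
  simp only [sub_zero, smul_eq_mul] at this
  linarith
lemma convex_of_mean {g : ℝ → ℝ} (hg : Continuous g)
    (hm : ∀ s r, g s * (2 * Real.pi) ≤ ∫ τ in (0:ℝ)..(2 * Real.pi), g (s + r * Real.cos τ)) : ConvexOn ℝ Set.univ g := by
  refine ⟨convex_univ, ?_⟩
  intro x _ y _ a b ha hb hab
  have hpi : 0 < 2 * Real.pi := by positivity
  have main : ∀ x y : ℝ, x < y → ∀ p ∈ Set.Icc x y, g p ≤ g x + (g y - g x) / (y - x) * (p - x) := by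
    intro x y hxy p hp
    set q := (g y - g x) / (y - x) with hq
    set h : ℝ → ℝ := fun s => g s - (g x + q * (s - x)) with hh
    have hc : Continuous h := by fun_prop
    have hx0 : h x = 0 := by simp [hh]
    have hy0 : h y = 0 := by
      have : y - x ≠ 0 := by linarith
      simp only [hh, hq]; field_simp; ring
    obtain ⟨s, hs, hmax⟩ := isCompact_Icc.exists_isMaxOn ⟨p, hp⟩ hc.continuousOn
    by_contra hcon
    have hpos : 0 < h s := by
      have : h p ≤ h s := hmax hp
      have : 0 < h p := by simp only [hh]; linarith
      linarith
    have hsx : s ≠ x := fun e => by rw [e, hx0] at hpos; exact lt_irrefl _ hpos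
    have hsy : s ≠ y := fun e => by rw [e, hy0] at hpos; exact lt_irrefl _ hpos
    set r := min (s - x) (y - s) with hr
    have hr0 : 0 ≤ r := le_min (by linarith [hs.1]) (by linarith [hs.2])
    have hin : ∀ τ, s + r * Real.cos τ ∈ Set.Icc x y := by
      intro τ
      have h1 := Real.neg_one_le_cos τ
      have h2 := Real.cos_le_one τ
      have h3 : r ≤ s - x := min_le_left _ _
      have h4 : r ≤ y - s := min_le_right _ _
      constructor <;> nlinarith
    have hmean : h s * (2 * Real.pi) ≤ ∫ τ in (0:ℝ)..(2 * Real.pi), h (s + r * Real.cos τ) := by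
      have e : ∀ τ, h (s + r * Real.cos τ) = g (s + r * Real.cos τ) - ((g x + q * (s - x)) + (q * r) * Real.cos τ) := by
        intro τ; simp only [hh]; ring
      simp only [e]
      rw [intervalIntegral.integral_sub (by apply Continuous.intervalIntegrable; fun_prop) (by apply Continuous.intervalIntegrable; fun_prop),
        intervalIntegral.integral_add (by simp) (by apply Continuous.intervalIntegrable; fun_prop),
        intervalIntegral.integral_const, intervalIntegral.integral_const_mul, integral_cos]
      simp only [Real.sin_two_pi, Real.sin_zero, sub_zero, mul_zero, smul_eq_mul, add_zero]
      have := hm s r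
      simp only [hh]
      linarith
    have hstrict : 0 < ∫ τ in (0:ℝ)..(2 * Real.pi), (h s - h (s + r * Real.cos τ)) := by
      refine intervalIntegral.integral_pos hpi (by fun_prop) (fun τ _ => sub_nonneg.2 (hmax (hin τ))) ?_
      rcases le_total (s - x) (y - s) with hle | hle
      · refine ⟨Real.pi, ⟨Real.pi_pos.le, by linarith [Real.pi_pos]⟩, ?_⟩
        rw [Real.cos_pi, hr, min_eq_left hle, show s + (s - x) * -1 = x by ring, hx0]; linarith
      · refine ⟨0, ⟨le_rfl, hpi.le⟩, ?_⟩
        rw [Real.cos_zero, hr, min_eq_right hle, show s + (y - s) * 1 = y by ring, hy0]; linarith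
    rw [intervalIntegral.integral_sub (by simp) (by apply Continuous.intervalIntegrable; fun_prop), intervalIntegral.integral_const, smul_eq_mul] at hstrict
    linarith
  have hxy : ∀ x y : ℝ, x < y → ∀ a b : ℝ, 0 ≤ a → 0 ≤ b → a + b = 1 → g (a * x + b * y) ≤ a * g x + b * g y := by
    intro x y hxy a b ha hb hab
    obtain rfl : a = 1 - b := by linarith
    have := main x y hxy ((1 - b) * x + b * y) ⟨by nlinarith, by nlinarith⟩
    rw [show (1 - b) * x + b * y - x = b * (y - x) by ring] at this
    have h0 : y - x ≠ 0 := by linarith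
    rw [show (g y - g x) / (y - x) * (b * (y - x)) = b * (g y - g x) by field_simp] at this
    linarith
  simp only [smul_eq_mul]
  rcases lt_trichotomy x y with h | h | h
  · exact hxy x y h a b ha hb hab
  · subst h; rw [← add_mul, ← add_mul, hab, one_mul, one_mul]
  · have := hxy y x h b a hb ha (by linarith)
    rw [add_comm (a * x), add_comm (a * g x)]; exact this
lemma wave_convex {B : (Fin n → ℕ) → (U →L[ℝ] V)} {l : ℕ} {f : V → ℝ} {L : ℝ} (hf : ∀ x y, |f x - f y| ≤ L * ‖x - y‖)
    (hqc : ∀ φ : Dom n → U, CcSmooth (unitCube n) φ → ∀ c, f c ≤ Iq B l f c φ) (ξ : Dom n) (u0 : U) (c : V) :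
    ConvexOn ℝ Set.univ fun t : ℝ => f (c + t • opSymbol B l ξ u0) := by
  refine convex_of_mean (by have := lip_cont hf; fun_prop) fun s r => ?_
  have := wave_mean hf hqc ξ u0 (c + s • opSymbol B l ξ u0) r
  simpa only [add_smul, add_assoc] using this
end mean
end
section
section recess
variable {V : Type*} [NormedAddCommGroup V] [NormedSpace ℝ V]
variable {f : V → ℝ} {L : ℝ}
lemma rec_bd (hf : ∀ x y, |f x - f y| ≤ L * ‖x - y‖) (w : V) :
    ∀ᶠ t : ℝ in atTop, |f (t • w) / t| ≤ |f 0| + L * ‖w‖ := by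
  filter_upwards [eventually_ge_atTop (1:ℝ)] with t ht
  have h1 := hf (t • w) 0
  rw [sub_zero, norm_smul, Real.norm_eq_abs, abs_of_pos (show (0:ℝ) < t by linarith)] at h1
  have h2 := abs_sub_abs_le_abs_sub (f (t • w)) (f 0)
  rw [abs_div, abs_of_pos (show 0 < t by linarith), div_le_iff₀ (by linarith)]
  nlinarith [abs_nonneg (f 0)]
lemma rrec_lt (hf : ∀ x y, |f x - f y| ≤ L * ‖x - y‖) {w : V} {a : ℝ} (h : rrec f w < a) :
    ∀ᶠ t : ℝ in atTop, f (t • w) / t < a :=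
  eventually_lt_of_limsup_lt h ⟨|f 0| + L * ‖w‖, eventually_map.2 ((rec_bd hf w).mono fun _ h => (abs_le.1 h).2)⟩
lemma rrec_le (hf : ∀ x y, |f x - f y| ≤ L * ‖x - y‖) {w : V} {a : ℝ} (h : ∀ᶠ t : ℝ in atTop, f (t • w) / t ≤ a) :
    rrec f w ≤ a := by
  refine limsup_le_of_le ?_ h
  refine IsBoundedUnder.isCoboundedUnder_le ⟨-(|f 0| + L * ‖w‖), eventually_map.2 ((rec_bd hf w).mono fun _ h => (abs_le.1 h).1)⟩
lemma rrec_good (hf : ∀ x y, |f x - f y| ≤ L * ‖x - y‖) {Lam : Set V}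
    (hc : ∀ d ∈ Lam, ∀ w, ConvexOn ℝ Set.univ fun t : ℝ => f (w + t • d)) : KKGood Lam L (rrec f) := by
  have lip1 : ∀ x y, rrec f x ≤ rrec f y + L * ‖x - y‖ := by
    intro x y
    refine le_of_forall_pos_le_add fun δ hδ => ?_
    refine rrec_le hf ?_
    filter_upwards [rrec_lt hf (show rrec f y < rrec f y + δ by linarith), eventually_gt_atTop (0:ℝ)] with t h1 h2
    have h3 := le_of_abs_le (hf (t • x) (t • y))
    rw [← smul_sub, norm_smul, Real.norm_eq_abs, abs_of_pos h2] at h3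
    rw [div_lt_iff₀ h2] at h1
    rw [div_le_iff₀ h2]
    linarith
  have hom1 : ∀ (c : ℝ) (x : V), 0 < c → rrec f (c • x) ≤ c * rrec f x := by
    intro c x hc
    refine le_of_forall_pos_le_add fun δ hδ => ?_
    refine rrec_le hf ?_
    have hd : 0 < δ / c := by positivity
    have h0 := rrec_lt hf (show rrec f x < rrec f x + δ / c by linarith)
    filter_upwards [(tendsto_id.atTop_mul_const hc).eventually h0, eventually_gt_atTop (0:ℝ)] with t h1 h2
    simp only [id] at h1
    rw [div_lt_iff₀ (by positivity)] at h1
    rw [smul_smul, div_le_iff₀ h2]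
    have e : (rrec f x + δ / c) * (t * c) = (c * rrec f x + δ) * t := by field_simp
    linarith
  refine ⟨?_, ?_, ?_⟩
  · intro x y
    have h1 := lip1 x y
    have h2 := lip1 y x
    rw [norm_sub_rev] at h2
    rw [abs_le]; constructor <;> linarith
  · intro c x hc
    refine le_antisymm (hom1 c x hc) ?_
    have := hom1 c⁻¹ (c • x) (inv_pos.2 hc)
    rw [smul_smul, inv_mul_cancel₀ hc.ne', one_smul, inv_mul_eq_div, le_div_iff₀ hc] at this
    linarith
  · intro d hd w
    refine ⟨convex_univ, ?_⟩
    intro x _ y _ a b ha hb hab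
    simp only [smul_eq_mul]
    refine le_of_forall_pos_le_add fun δ hδ => ?_
    refine rrec_le hf ?_
    filter_upwards [rrec_lt hf (show rrec f (w + x • d) < rrec f (w + x • d) + δ by linarith),
      rrec_lt hf (show rrec f (w + y • d) < rrec f (w + y • d) + δ by linarith), eventually_gt_atTop (0:ℝ)] with t h1 h2 h3
    rw [div_lt_iff₀ h3] at h1 h2
    rw [div_le_iff₀ h3]
    have h4 := (hc d hd (t • w)).2 (Set.mem_univ (t * x)) (Set.mem_univ (t * y)) ha hb hab
    simp only [smul_eq_mul] at h4
    rw [show t • w + (a * (t * x) + b * (t * y)) • d = t • (w + (a * x + b * y) • d) by module,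
      show t • w + (t * x) • d = t • (w + x • d) by module, show t • w + (t * y) • d = t • (w + y • d) by module] at h4
    have h5 := mul_le_mul_of_nonneg_left h1.le ha
    have h6 := mul_le_mul_of_nonneg_left h2.le hb
    obtain rfl : a = 1 - b := by linarith
    linarith
lemma rrec_ray (hf : ∀ x y, |f x - f y| ≤ L * ‖x - y‖) {z0 : V} (hc : ConvexOn ℝ Set.univ fun t : ℝ => f (0 + t • z0))
    {s : ℝ} (hs : 0 ≤ s) : f (s • z0) ≤ f 0 + s * rrec f z0 := by
  refine le_of_small (K := s + s * |f 0|) (by positivity) fun δ hδ => ?_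
  obtain ⟨t, h1, h2, h3, h4⟩ := ((rrec_lt hf (show rrec f z0 < rrec f z0 + δ by linarith)).and
    ((eventually_gt_atTop (0:ℝ)).and ((eventually_ge_atTop s).and (eventually_ge_atTop δ⁻¹)))).exists
  have h5 := hc.2 (Set.mem_univ 0) (Set.mem_univ t) (show 0 ≤ 1 - s / t by rw [sub_nonneg, div_le_one h2]; exact h3)
    (show 0 ≤ s / t by positivity) (by ring)
  simp only [smul_eq_mul, zero_smul, zero_add, mul_zero, div_mul_cancel₀ s h2.ne'] at h5
  have h6 : s / t * f (t • z0) = s * (f (t • z0) / t) := by field_simp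
  have h7 : s * (f (t • z0) / t) ≤ s * (rrec f z0 + δ) := mul_le_mul_of_nonneg_left h1.le hs
  have h8 : -(s / t * f 0) ≤ s * δ * |f 0| := by
    have : s / t ≤ s * δ := by
      rw [div_le_iff₀ h2]
      have : 1 ≤ δ * t := by rw [← inv_mul_le_iff₀ hδ, mul_one]; exact h4
      nlinarith
    have h9 : s / t * |f 0| ≤ s * δ * |f 0| := mul_le_mul_of_nonneg_right this (abs_nonneg _)
    have h10 : s / t * (-f 0) ≤ s / t * |f 0| := mul_le_mul_of_nonneg_left (neg_le_abs _) (by positivity)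
    linarith
  linarith
lemma lim_lip (hf : ∀ x y, |f x - f y| ≤ L * ‖x - y‖) {g : V → ℝ} (hg : ∀ w, Tendsto (fun t : ℝ => f (t • w) / t) atTop (𝓝 (g w)))
    (x y : V) : |g x - g y| ≤ L * ‖x - y‖ := by
  refine le_of_tendsto ((hg x).sub (hg y)).abs ?_
  filter_upwards [eventually_gt_atTop (0:ℝ)] with t ht
  have h3 := hf (t • x) (t • y)
  rw [← smul_sub, norm_smul, Real.norm_eq_abs, abs_of_pos ht] at h3
  rw [← sub_div, abs_div, abs_of_pos ht, div_le_iff₀ ht]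
  linarith
end recess
section lemmaL
variable {n k l : ℕ} {U V W : Type*} [NormedAddCommGroup U] [NormedSpace ℝ U] [NormedAddCommGroup V] [InnerProductSpace ℝ V]
  [FiniteDimensional ℝ V] [MeasurableSpace V] [BorelSpace V] [NormedAddCommGroup W] [NormedSpace ℝ W]
  {A : (Fin n → ℕ) → (V →L[ℝ] W)} {B : (Fin n → ℕ) → (U →L[ℝ] V)}
lemma sph_int {E : Type*} [NormedAddCommGroup E] (ν : Measure (Metric.sphere (0:V) 1)) [IsFiniteMeasure ν] {g : V → E} (hg : Continuous g) :
    Integrable (fun w : Metric.sphere (0:V) 1 => g (w : V)) ν := by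
  have hc : Continuous fun w : Metric.sphere (0:V) 1 => g (w : V) := hg.comp continuous_subtype_val
  haveI : CompactSpace (Metric.sphere (0:V) 1) := isCompact_iff_compactSpace.1 (isCompact_sphere _ _)
  exact hc.integrable_of_hasCompactSupport (HasCompactSupport.of_compactSpace _)
lemma qc_bound (hspan : SpanningCone A k) (hexact : ExactPotential A k B l) {F Finf : V → ℝ} {L : ℝ}
    (hF : ∀ x y, |F x - F y| ≤ L * ‖x - y‖) (hinf : ∀ w, Tendsto (fun t : ℝ => F (t • w) / t) atTop (𝓝 (Finf w)))
    {c0 : V} {m : ℝ} (hm : ∀ φ : Dom n → U, CcSmooth (unitCube n) φ → m ≤ Iq B l F c0 φ)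
    (ν : Measure (Metric.sphere (0:V) 1)) [IsProbabilityMeasure ν] (hz : (∫ w, (w : V) ∂ν) ∈ waveCone A k) {s : ℝ} (hs : 0 ≤ s) :
    Qc B l F (s • ∫ w, (w : V) ∂ν) ≤ F 0 + s * ∫ w, Finf (w : V) ∂ν := by
  set z0 := ∫ w, (w : V) ∂ν with hz0
  have hl := Q_lip hF hm
  have hc : ∀ d ∈ waveCone A k, ∀ w, ConvexOn ℝ Set.univ fun t : ℝ => Qc B l F (w + t • d) := by
    rintro d ⟨ξ, hξ, hd⟩ w
    have hd' : d ∈ LinearMap.ker (opSymbol A k ξ : V →ₗ[ℝ] W) := hd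
    rw [hexact ξ hξ] at hd'
    obtain ⟨u0, rfl⟩ := hd'
    exact wave_convex hl (fun φ hφ c => Q_qc hF hm hφ c) ξ u0 w
  obtain ⟨ℓ, h1, h2⟩ := kk (rrec_good hl hc) hspan hz
  have h3 := rrec_ray hl (hc z0 hz 0) hs
  have h4 : ∀ w, rrec (Qc B l F) w ≤ Finf w := by
    intro w
    refine le_of_forall_pos_le_add fun δ hδ => rrec_le hl ?_
    filter_upwards [(hinf w).eventually_lt_const (show Finf w < Finf w + δ by linarith), eventually_gt_atTop (0:ℝ)] with t ht h0
    exact (div_le_div_of_nonneg_right (Q_le_F hF hm _) h0.le).trans ht.le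
  have h5 : ∫ w, ℓ (w : V) ∂ν = ℓ z0 :=
    (ℓ.toContinuousLinearMap).integral_comp_comm (sph_int ν continuous_id)
  have h6 : ∫ w, ℓ (w : V) ∂ν ≤ ∫ w, Finf (w : V) ∂ν :=
    integral_mono (sph_int ν ℓ.continuous_of_finiteDimensional) (sph_int ν (lip_cont (lim_lip hF hinf))) fun w => (h1 w).trans (h4 w)
  have h7 : s * rrec (Qc B l F) z0 ≤ s * ∫ w, Finf (w : V) ∂ν := mul_le_mul_of_nonneg_left (by linarith) hs
  linarith [Q_le_F hF hm (B := B) (l := l) 0]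
lemma glue (hn : 0 < n) {ι : Type*} [Fintype ι] {Φ : ι → V → ℝ} (hΦ : ∀ i, Continuous (Φ i)) (c : V) :
    Convex ℝ (closure {p : ι → ℝ | ∃ φ : Dom n → U, CcSmooth (unitCube n) φ ∧ p = fun i => Iq B l (Φ i) c φ}) := by
  set S := {p : ι → ℝ | ∃ φ : Dom n → U, CcSmooth (unitCube n) φ ∧ p = fun i => Iq B l (Φ i) c φ} with hS
  have key : ∀ p ∈ S, ∀ q ∈ S, ∀ a b : ℝ, 0 ≤ a → 0 ≤ b → a + b = 1 → a • p + b • q ∈ closure S := by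
    rintro _ ⟨φ, hφ, rfl⟩ _ ⟨φ', hφ', rfl⟩ a b ha hb hab
    set M : ℕ → ℕ := fun j => (2^(j+1))^n with hM
    have hM0 : ∀ j, (0:ℝ) < M j := fun j => by simp only [hM]; positivity
    have hMt : Tendsto (fun j => (M j : ℝ)) atTop atTop := by
      refine tendsto_atTop_mono (fun j => ?_) tendsto_natCast_atTop_atTop
      have h1 : j < 2^(j+1) := (Nat.lt_succ_self j).trans (Nat.lt_two_pow_self)
      have h2 : 2^(j+1) ≤ M j := Nat.le_self_pow hn.ne' _
      exact_mod_cast h1.le.trans h2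
    have ht : Tendsto (fun j => (⌊a * M j⌋₊ : ℝ) / M j) atTop (𝓝 a) :=
      (tendsto_nat_floor_mul_div_atTop ha).comp hMt
    have ht2 : Tendsto (fun j => ((⌊a * M j⌋₊ : ℝ) / M j) • (fun i => Iq B l (Φ i) c φ) +
        (1 - (⌊a * M j⌋₊ : ℝ) / M j) • (fun i => Iq B l (Φ i) c φ')) atTop
        (𝓝 (a • (fun i => Iq B l (Φ i) c φ) + b • (fun i => Iq B l (Φ i) c φ'))) := by
      obtain rfl : b = 1 - a := by linarith
      exact (ht.smul_const _).add ((ht.const_sub 1).smul_const _)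
    refine mem_closure_of_tendsto ht2 (Eventually.of_forall fun j => ?_)
    have hKle : ⌊a * M j⌋₊ ≤ (cidx n j).card := by
      rw [cidx_card]
      refine Nat.floor_le_of_le ?_
      have := hM0 j
      simp only [hM] at this ⊢
      nlinarith
    obtain ⟨T, hT1, hT2⟩ := Finset.exists_subset_card_eq hKle
    classical
    have hcc : ∀ v ∈ cidx n j, CcSmooth (unitCube n) ((fun v => if v ∈ T then φ else φ') v) := by
      intro v _; dsimp only; split_ifs <;> assumption
    refine ⟨patch l (j+1) (cidx n j) (fun v => if v ∈ T then φ else φ'), patch_cc_cube hcc, ?_⟩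
    ext i
    simp only [Iq, Pi.add_apply, Pi.smul_apply, smul_eq_mul]
    rw [patch_int B hcc (hΦ i) c, ← Finset.sum_sdiff hT1]
    rw [Finset.sum_congr rfl (g := fun _ => (((2:ℝ)^(j+1))⁻¹)^n * ∫ x in unitCube n, Φ i (c + opApply B l φ' x)) (fun v hv => by
      rw [if_neg (Finset.mem_sdiff.1 hv).2]),
      Finset.sum_congr (s₁ := T) rfl (g := fun _ => (((2:ℝ)^(j+1))⁻¹)^n * ∫ x in unitCube n, Φ i (c + opApply B l φ x)) (fun v hv => by
      rw [if_pos hv]), Finset.sum_const, Finset.sum_const, Finset.card_sdiff_of_subset hT1, hT2, nsmul_eq_mul, nsmul_eq_mul,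
      Nat.cast_sub hKle, cidx_card]
    have e : (((2:ℝ)^(j+1))⁻¹)^n = (M j : ℝ)⁻¹ := by simp [hM, inv_pow]
    rw [e]
    have := (hM0 j).ne'
    have e2 : (((2^(j+1))^n : ℕ) : ℝ) = M j := rfl
    rw [e2]
    field_simp
    ring
  intro p hp q hq a b ha hb hab
  have := map_mem_closure₂ (f := fun x y : ι → ℝ => a • x + b • y) (u := closure S) (by fun_prop) hp hq
    (fun x hx y hy => key x hx y hy a b ha hb hab)
  rwa [closure_closure] at this
theorem lemmaL (hn : 0 < n) (hspan : SpanningCone A k) (hexact : ExactPotential A k B l) {ι : Type*} [Fintype ι]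
    {Φ Φinf : ι → V → ℝ} {L : ℝ} (hΦ : ∀ i x y, |Φ i x - Φ i y| ≤ L * ‖x - y‖)
    (hinf : ∀ i w, Tendsto (fun t : ℝ => Φ i (t • w) / t) atTop (𝓝 (Φinf i w)))
    (ν : Measure (Metric.sphere (0:V) 1)) [IsProbabilityMeasure ν] (hz : (∫ w, (w : V) ∂ν) ∈ waveCone A k) {s : ℝ} (hs : 0 ≤ s)
    {ε : ℝ} (hε : 0 < ε) : ∃ φ : Dom n → U, CcSmooth (unitCube n) φ ∧
      ∀ i, |(∫ x in unitCube n, Φ i ((s • ∫ w, (w : V) ∂ν) + opApply B l φ x)) - (Φ i 0 + s * ∫ w, Φinf i (w : V) ∂ν)| ≤ ε := by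
  set c := s • ∫ w, (w : V) ∂ν with hc
  set S := {p : ι → ℝ | ∃ φ : Dom n → U, CcSmooth (unitCube n) φ ∧ p = fun i => Iq B l (Φ i) c φ} with hS
  set p0 : ι → ℝ := fun i => Φ i 0 + s * ∫ w, Φinf i (w : V) ∂ν with hp0
  have hmem : p0 ∈ closure S := by
    by_contra hnot
    obtain ⟨g, u, hu1, hu2⟩ := geometric_hahn_banach_point_closed (glue (B := B) (l := l) hn (fun i => lip_cont (hΦ i)) c) isClosed_closure hnot
    classical
    set a : ι → ℝ := fun i => g (Pi.single i 1) with ha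
    have hg : ∀ p : ι → ℝ, g p = ∑ i, a i * p i := by
      intro p
      have : p = ∑ i, p i • (Pi.single i (1:ℝ) : ι → ℝ) := by
        ext j; simp [Finset.sum_apply, Pi.single_apply]
      conv_lhs => rw [this]
      simp [map_sum, ha, mul_comm]
    set F : V → ℝ := fun z => ∑ i, a i * Φ i z with hF
    have hFl : ∀ x y, |F x - F y| ≤ (∑ i, |a i| * L) * ‖x - y‖ := by
      intro x y
      simp only [hF]
      rw [← Finset.sum_sub_distrib, Finset.sum_mul]
      refine (Finset.abs_sum_le_sum_abs _ _).trans (Finset.sum_le_sum fun i _ => ?_)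
      rw [← mul_sub, abs_mul, mul_assoc]
      exact mul_le_mul_of_nonneg_left (hΦ i x y) (abs_nonneg _)
    have hFinf : ∀ w, Tendsto (fun t : ℝ => F (t • w) / t) atTop (𝓝 (∑ i, a i * Φinf i w)) := by
      intro w
      have := tendsto_finset_sum Finset.univ (fun i _ => (hinf i w).const_mul (a i))
      refine this.congr fun t => ?_
      simp only [hF, Finset.sum_div, mul_div_assoc]
    have hI : ∀ φ : Dom n → U, CcSmooth (unitCube n) φ → Iq B l F c φ = g (fun i => Iq B l (Φ i) c φ) := by
      intro φ hφ
      rw [hg]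
      simp only [Iq, hF]
      rw [integral_finset_sum _ fun i _ => (cube_int (Iq_cont (hΦ i) hφ.1 c)).const_mul (a i)]
      simp only [integral_const_mul]
    have hm : ∀ φ : Dom n → U, CcSmooth (unitCube n) φ → u ≤ Iq B l F c φ := by
      intro φ hφ
      rw [hI φ hφ]
      exact (hu2 _ (subset_closure ⟨φ, hφ, rfl⟩)).le
    have h1 := qc_bound hspan hexact hFl hFinf hm ν hz hs
    have h2 : u ≤ Qc B l F c := by
      haveI : Nonempty {φ : Dom n → U // CcSmooth (unitCube n) φ} := ⟨⟨_, cc_zero _⟩⟩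
      exact le_ciInf fun φ => hm φ.1 φ.2
    have h3 : F 0 + s * ∫ w, (∑ i, a i * Φinf i (w : V)) ∂ν = g p0 := by
      rw [integral_finset_sum _ fun i _ => (sph_int ν (lip_cont (lim_lip (hΦ i) (hinf i)))).const_mul (a i), hg]
      simp only [integral_const_mul, hp0, hF, mul_add, Finset.sum_add_distrib, Finset.mul_sum]
      congr 1
      exact Finset.sum_congr rfl fun i _ => by ring
    rw [h3] at h1
    linarith
  obtain ⟨_, ⟨φ, hφ, rfl⟩, hd⟩ := Metric.mem_closure_iff.1 hmem ε hε
  refine ⟨φ, hφ, fun i => ?_⟩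
  have := (dist_le_pi_dist p0 (fun i => Iq B l (Φ i) c φ) i).trans hd.le
  rw [dist_comm, Real.dist_eq] at this
  exact this
end lemmaL
end
section
section testclass
lemma supbd {X : Type*} {s : Set X} {f : X → ℝ} {M : ℝ} (h : ∀ x ∈ s, |f x| ≤ M) {x : X} (hx : x ∈ s) :
    |f x| ≤ ⨆ x ∈ s, |f x| := by
  have h1 : BddAbove (Set.range fun x => ⨆ (_ : x ∈ s), |f x|) := by
    refine ⟨max M 0, ?_⟩
    rintro _ ⟨y, rfl⟩
    by_cases hy : y ∈ s
    · simpa [hy] using Or.inl (h y hy)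
    · simp [hy]
  have h2 := le_ciSup h1 x
  simpa [hx] using h2
lemma etaU {n : ℕ} {Ω : Set (Dom n)} (hb : Bornology.IsBounded Ω) {η : Dom n → ℝ} (h : etaLipUnit Ω η) :
    ∃ η' : Dom n → ℝ, (∀ x y, |η' x - η' y| ≤ ‖x - y‖) ∧ (∀ x, |η' x| ≤ 1) ∧ ∀ x ∈ Ω, η x = η' x := by
  obtain ⟨K, hK, h1⟩ := h
  have hbd : ∃ M, ∀ x ∈ closure Ω, |η x| ≤ M := by
    obtain ⟨M, hM⟩ := (hb.isCompact_closure.image_of_continuousOn hK.continuousOn).isBounded.exists_norm_le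
    exact ⟨M, fun x hx => hM _ ⟨x, hx, rfl⟩⟩
  obtain ⟨M, hM⟩ := hbd
  have h0 : (0:ℝ) ≤ ⨆ x ∈ closure Ω, |η x| := Real.iSup_nonneg fun _ => Real.iSup_nonneg fun _ => abs_nonneg _
  have hK0 := K.2
  have hK1 : (K:ℝ) ≤ 1 := by linarith
  obtain ⟨g, hg, hgη⟩ := hK.extend_real
  refine ⟨fun x => max (-1) (min 1 (g x)), fun x y => ?_, fun x => ?_, fun x hx => ?_⟩
  · have h3 := hg.dist_le_mul x y
    rw [Real.dist_eq, dist_eq_norm] at h3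
    refine (abs_max_sub_max_le_max _ _ _ _).trans ?_
    rw [sub_self, abs_zero, max_eq_right (abs_nonneg _)]
    refine (abs_min_sub_min_le_max _ _ _ _).trans ?_
    rw [sub_self, abs_zero, max_eq_right (abs_nonneg _)]
    nlinarith [norm_nonneg (x - y)]
  · rw [abs_le]; exact ⟨le_max_left _ _, max_le (by norm_num) (min_le_left _ _)⟩
  · have h4 := supbd hM (subset_closure hx)
    have h5 : |η x| ≤ 1 := by linarith
    rw [abs_le] at h5
    show _ = max (-1) (min 1 (g x))
    rw [← hgη (subset_closure hx), min_eq_right h5.2, max_eq_right h5.1]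
variable {V : Type*} [NormedAddCommGroup V] [NormedSpace ℝ V] {Φ Ψ : V → ℝ}
lemma tlip (h : TLipUnit Φ) : (∀ x ∈ Metric.closedBall (0:V) 1, |Tfun Φ x| ≤ 1) ∧
    ∀ x ∈ Metric.closedBall (0:V) 1, ∀ y ∈ Metric.closedBall (0:V) 1, |Tfun Φ x - Tfun Φ y| ≤ ‖x - y‖ := by
  obtain ⟨K, hK, h1⟩ := h
  have hL : ∀ x ∈ Metric.closedBall (0:V) 1, ∀ y ∈ Metric.closedBall (0:V) 1, |Tfun Φ x - Tfun Φ y| ≤ K * ‖x - y‖ := by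
    intro x hx y hy
    simpa [Real.dist_eq, dist_eq_norm] using hK.dist_le_mul x hx y hy
  have hK0 : (0:ℝ) ≤ K := K.2
  have hbd : ∀ x ∈ Metric.closedBall (0:V) 1, |Tfun Φ x| ≤ |Tfun Φ 0| + K := by
    intro x hx
    have h2 := hL x hx 0 (by simp)
    rw [sub_zero] at h2
    have h3 : ‖x‖ ≤ 1 := by simpa using hx
    have := abs_sub_abs_le_abs_sub (Tfun Φ x) (Tfun Φ 0)
    nlinarith
  have h0 : (0:ℝ) ≤ ⨆ x ∈ Metric.closedBall (0:V) 1, |Tfun Φ x| :=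
    Real.iSup_nonneg fun _ => Real.iSup_nonneg fun _ => abs_nonneg _
  refine ⟨fun x hx => ?_, fun x hx y hy => (hL x hx y hy).trans ?_⟩
  · have := supbd hbd hx
    linarith
  · nlinarith [norm_nonneg (x - y)]
lemma ball_pt (z : V) : ‖(1 + ‖z‖)⁻¹ • z‖ = 1 - (1 + ‖z‖)⁻¹ := by
  rw [norm_smul, Real.norm_eq_abs, abs_of_pos (by positivity)]
  field_simp
  ring
lemma ball_mem (z : V) : (1 + ‖z‖)⁻¹ • z ∈ Metric.closedBall (0:V) 1 := by
  rw [mem_closedBall_zero_iff, ball_pt]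
  have : 0 < (1 + ‖z‖)⁻¹ := by positivity
  linarith
lemma Tinv (Φ : V → ℝ) (z : V) : Φ z = (1 + ‖z‖) * Tfun Φ ((1 + ‖z‖)⁻¹ • z) := by
  have : 0 < (1 + ‖z‖)⁻¹ := by positivity
  have h0 : (1 + ‖z‖) ≠ 0 := by positivity
  rw [Tfun, if_pos (by rw [ball_pt]; linarith), transf, ball_pt, sub_sub_cancel, inv_inv, smul_smul, mul_inv_cancel₀ h0, one_smul,
    ← mul_assoc, mul_inv_cancel₀ h0, one_mul]
lemma tlip3 (h : TLipUnit Φ) (x y : V) : |Φ x - Φ y| ≤ 3 * ‖x - y‖ := by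
  obtain ⟨h1, h2⟩ := tlip h
  have hx := h1 _ (ball_mem x)
  have hxy := h2 _ (ball_mem x) _ (ball_mem y)
  have h4 : (1 + ‖y‖) * ‖(1 + ‖x‖)⁻¹ • x - (1 + ‖y‖)⁻¹ • y‖ ≤ 2 * ‖x - y‖ := by
    have h0 : (1 + ‖y‖) ≠ 0 := by positivity
    have h0' : (1 + ‖x‖) ≠ 0 := by positivity
    have e : (1 + ‖y‖) • ((1 + ‖x‖)⁻¹ • x - (1 + ‖y‖)⁻¹ • y) = (x - y) + (‖y‖ - ‖x‖) • ((1 + ‖x‖)⁻¹ • x) := by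
      rw [smul_sub, smul_smul, smul_smul, smul_smul, mul_inv_cancel₀ h0, one_smul]
      have : (1 + ‖y‖) * (1 + ‖x‖)⁻¹ = 1 + (‖y‖ - ‖x‖) * (1 + ‖x‖)⁻¹ := by field_simp; ring
      rw [this, add_smul, one_smul]; abel
    have e2 : (1 + ‖y‖) * ‖(1 + ‖x‖)⁻¹ • x - (1 + ‖y‖)⁻¹ • y‖ = ‖(x - y) + (‖y‖ - ‖x‖) • ((1 + ‖x‖)⁻¹ • x)‖ := by
      rw [← e, norm_smul, Real.norm_eq_abs, abs_of_pos (by positivity)]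
    rw [e2]
    refine (norm_add_le _ _).trans ?_
    rw [norm_smul, Real.norm_eq_abs, two_mul]
    have h5 := ball_mem x
    rw [mem_closedBall_zero_iff] at h5
    have h6 : |‖y‖ - ‖x‖| ≤ ‖x - y‖ := by rw [abs_sub_comm]; exact abs_norm_sub_norm_le x y
    nlinarith [abs_nonneg (‖y‖ - ‖x‖)]
  rw [Tinv Φ x, Tinv Φ y]
  have e : (1 + ‖x‖) * Tfun Φ ((1 + ‖x‖)⁻¹ • x) - (1 + ‖y‖) * Tfun Φ ((1 + ‖y‖)⁻¹ • y) =
    (‖x‖ - ‖y‖) * Tfun Φ ((1 + ‖x‖)⁻¹ • x) + (1 + ‖y‖) * (Tfun Φ ((1 + ‖x‖)⁻¹ • x) - Tfun Φ ((1 + ‖y‖)⁻¹ • y)) := by ring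
  rw [e]
  refine (abs_add_le _ _).trans ?_
  rw [abs_mul, abs_mul, abs_of_pos (show 0 < 1 + ‖y‖ by positivity)]
  have h6 := abs_norm_sub_norm_le x y
  have h7 := norm_nonneg y
  have h8 : |‖x‖ - ‖y‖| * |Tfun Φ ((1 + ‖x‖)⁻¹ • x)| ≤ ‖x - y‖ * 1 := mul_le_mul h6 hx (abs_nonneg _) (norm_nonneg _)
  have h9 := mul_le_mul_of_nonneg_left hxy (show 0 ≤ 1 + ‖y‖ by positivity)
  linarith
lemma rrec_lim (h : MemH Φ) (w : V) : Tendsto (fun t : ℝ => Φ (t • w) / t) atTop (𝓝 (rrec Φ w)) := by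
  obtain ⟨_, _, g, hg⟩ := h
  have h1 := (tendstoLocallyUniformlyOn_univ.2 hg).tendsto_at (Set.mem_univ w)
  rw [rrec, h1.limsup_eq]
  exact h1
lemma tnet [FiniteDimensional ℝ V] {e : ℝ} (he : 0 < e) : ∃ S : Set (V → ℝ), S.Finite ∧ (∀ Ψ ∈ S, MemH Ψ ∧ TLipUnit Ψ) ∧
    ∀ Φ : V → ℝ, MemH Φ → TLipUnit Φ → ∃ Ψ ∈ S, (∀ z, |Φ z - Ψ z| ≤ e * (1 + ‖z‖)) ∧
      ∀ z : V, ‖z‖ = 1 → |rrec Φ z - rrec Ψ z| ≤ e := by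
  haveI : CompactSpace (Metric.closedBall (0:V) 1) := isCompact_iff_compactSpace.1 (isCompact_closedBall _ _)
  let A : Set (BoundedContinuousFunction (Metric.closedBall (0:V) 1) ℝ) :=
    {f | ∃ Φ : V → ℝ, (MemH Φ ∧ TLipUnit Φ) ∧ ∀ x, f x = Tfun Φ x}
  have hA : IsCompact (closure A) := by
    refine BoundedContinuousFunction.arzela_ascoli (Set.Icc (-1) 1) isCompact_Icc A ?_ ?_
    · rintro f x ⟨Φ, h, hf⟩
      rw [hf]; exact abs_le.1 ((tlip h.2).1 x x.2)
    · refine (LipschitzWith.uniformEquicontinuous _ 1 ?_).equicontinuous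
      rintro ⟨f, Φ, h, hf⟩
      refine LipschitzWith.of_dist_le_mul fun x y => ?_
      simp only [hf, Real.dist_eq, NNReal.coe_one, one_mul, Subtype.dist_eq, dist_eq_norm]
      exact (tlip h.2).2 x x.2 y y.2
  obtain ⟨T, hTA, hT, hc⟩ := exists_finite_cover_balls_of_isCompact_closure hA he
  choose! P hP using (show ∀ f ∈ A, ∃ Φ : V → ℝ, (MemH Φ ∧ TLipUnit Φ) ∧ ∀ x, f x = Tfun Φ x from fun f hf => hf)
  refine ⟨P '' T, hT.image _, ?_, fun Φ h1 h2 => ?_⟩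
  · rintro _ ⟨f, hf, rfl⟩; exact (hP f (hTA hf)).1
  · have hcont : Continuous fun x : Metric.closedBall (0:V) 1 => Tfun Φ x :=
      (LipschitzWith.of_dist_le_mul (K := 1) fun x y => by
        simp only [Real.dist_eq, NNReal.coe_one, one_mul, Subtype.dist_eq, dist_eq_norm]; exact (tlip h2).2 x x.2 y y.2).continuous
    have hm : BoundedContinuousFunction.mkOfCompact ⟨_, hcont⟩ ∈ A := ⟨Φ, ⟨h1, h2⟩, fun x => rfl⟩
    obtain ⟨f, hfT, hd⟩ := Set.mem_iUnion₂.1 (hc hm)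
    have key : ∀ x ∈ Metric.closedBall (0:V) 1, |Tfun Φ x - Tfun (P f) x| ≤ e := by
      intro x hx
      have h3 := (BoundedContinuousFunction.dist_coe_le_dist ⟨x, hx⟩).trans (Metric.mem_ball.1 hd).le
      rw [(hP f (hTA hfT)).2, Real.dist_eq] at h3
      exact h3
    refine ⟨P f, ⟨f, hfT, rfl⟩, fun z => ?_, fun z hz => ?_⟩
    · rw [Tinv Φ, Tinv (P f), ← mul_sub, abs_mul, abs_of_pos (show 0 < 1 + ‖z‖ by positivity), mul_comm]
      exact mul_le_mul_of_nonneg_right (key _ (ball_mem z)) (by positivity)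
    · have := key z (by simp [hz])
      simpa [Tfun, hz] using this
end testclass
end
section
section ysetup
variable {n k : ℕ} {V W : Type*} [NormedAddCommGroup V] [InnerProductSpace ℝ V] [FiniteDimensional ℝ V]
  [MeasurableSpace V] [BorelSpace V] [NormedAddCommGroup W] [InnerProductSpace ℝ W] [FiniteDimensional ℝ W]
  {Ω : Set (Dom n)}
lemma ker_meas {X Y E : Type*} [MeasurableSpace X] [MeasurableSpace Y] [TopologicalSpace Y] [OpensMeasurableSpace Y]
    [SecondCountableTopology Y] [NormedAddCommGroup E] [NormedSpace ℝ E]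
    {κ : X → Measure Y} (hκ : Measurable κ) {f : Y → E} (hf : Continuous f) :
    StronglyMeasurable fun x => ∫ y, f y ∂κ x :=
  hf.stronglyMeasurable.integral_kernel (κ := (⟨κ, hκ⟩ : ProbabilityTheory.Kernel X Y))
lemma bar_le (ν : Measure (Metric.sphere (0:V) 1)) [IsProbabilityMeasure ν] : ‖∫ w, (w : V) ∂ν‖ ≤ 1 := by
  have := norm_integral_le_of_norm_le_const (μ := ν) (f := fun w : Metric.sphere (0:V) 1 => (w : V)) (C := 1)
    (Eventually.of_forall fun w => by simp)
  simpa using this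
lemma bar_m (Y : YoungMeasure n V Ω) : Measurable Y.barAng :=
  (ker_meas Y.ang_meas continuous_subtype_val).measurable
lemma ys_fin (Y : YoungMeasure n V Ω) : IsFiniteMeasure Y.lamS := by
  haveI := Y.conc_finite
  exact inferInstanceAs (IsFiniteMeasure (Y.conc.singularPart volume))
lemma ys_null (Y : YoungMeasure n V Ω) (hΩo : IsOpen Ω) (hYfr : Y.conc (frontier Ω) = 0) : Y.lamS Ωᶜ = 0 := by
  refine Measure.absolutelyContinuous_of_le (Y.conc.singularPart_le volume) ?_
  refine measure_mono_null (t := (closure Ω)ᶜ ∪ frontier Ω) (fun x hx => ?_) (measure_union_null Y.conc_carrier hYfr)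
  by_cases h : x ∈ closure Ω
  · exact Or.inr (by rw [hΩo.frontier_eq]; exact ⟨h, hx⟩)
  · exact Or.inl h
lemma ys_int (Y : YoungMeasure n V Ω) : IntegrableOn Y.baryAC Ω := by
  haveI := Y.conc_finite
  have h1 : IntegrableOn Y.barOsc Ω := by
    refine ⟨((ker_meas Y.osc_meas continuous_id).aestronglyMeasurable), ?_⟩
    refine lt_of_le_of_lt (lintegral_mono fun x => ?_) Y.moment
    exact enorm_integral_le_lintegral_enorm _
  have h2 : Integrable (fun x => Y.lamA x • Y.barAng x) := by
    have hl : Integrable Y.lamA := Measure.integrable_toReal_rnDeriv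
    have hae : ∀ᵐ x ∂(volume : Measure (Dom n)), Y.conc.rnDeriv volume x ≠ 0 → IsProbabilityMeasure (Y.ang x) := by
      rw [← ae_withDensity_iff (Measure.measurable_rnDeriv _ _)]
      exact (Measure.absolutelyContinuous_of_le (Measure.withDensity_rnDeriv_le _ _)).ae_le Y.ang_prob
    refine hl.mono (hl.1.smul (bar_m Y).aestronglyMeasurable) ?_
    filter_upwards [hae] with x hx
    rw [norm_smul]
    by_cases h0 : Y.conc.rnDeriv volume x = 0
    · simp [YoungMeasure.lamA, h0]
    · haveI := hx h0
      have := bar_le (Y.ang x)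
      exact mul_le_of_le_one_right (norm_nonneg _) this
  exact h1.add h2.integrableOn
lemma ys_good (A : (Fin n → ℕ) → (V →L[ℝ] W)) (Y : YoungMeasure n V Ω) (hΩo : IsOpen Ω) (hYfr : Y.conc (frontier Ω) = 0)
    (hA : Y.AFree A k) : ∀ᵐ x ∂Y.lamS, IsProbabilityMeasure (Y.ang x) ∧ Y.barAng x ∈ waveCone A k := by
  haveI := Y.conc_finite
  haveI := ys_fin Y
  have hp : ∀ᵐ x ∂Y.lamS, IsProbabilityMeasure (Y.ang x) :=
    (Measure.absolutelyContinuous_of_le (Y.conc.singularPart_le volume)).ae_le Y.ang_prob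
  set S : Set (Dom n) := {x | Y.ang x Set.univ = 1} with hS
  have hSm : MeasurableSet S := (Measure.measurable_coe MeasurableSet.univ).comp Y.ang_meas (measurableSet_singleton _)
  have he : ∀ᵐ x ∂Y.lamS, S.indicator Y.barAng x = Y.barAng x := by
    filter_upwards [hp] with x hx
    exact Set.indicator_of_mem (show x ∈ S from hx.measure_univ) _
  have h := dpr (k := k) A Ω Y.lamS (S.indicator Y.barAng) Y.baryAC (Measure.mutuallySingular_singularPart _ _) hΩo (ys_null Y hΩo hYfr)
    ((bar_m Y).indicator hSm) (fun x => ?_) (ys_int Y) (fun φ h1 h2 h3 => ?_)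
  · filter_upwards [hp, he, h] with x h1 h2 h3
    exact ⟨h1, h2 ▸ h3⟩
  · by_cases hx : x ∈ S
    · rw [Set.indicator_of_mem hx]
      haveI : IsProbabilityMeasure (Y.ang x) := ⟨hx⟩
      exact bar_le _
    · rw [Set.indicator_of_notMem hx]; simp
  · rw [← hA φ h1 h2 h3]
    congr 1
    refine integral_congr_ae ?_
    filter_upwards [he] with x hx
    rw [hx]
end ysetup
end
section
section partition
variable {n : ℕ} {F : Type*} [MetricSpace F] [ProperSpace F] [SecondCountableTopology F] [MeasurableSpace F] [BorelSpace F] [Nonempty F]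
lemma part (μ : Measure (Dom n)) [IsFiniteMeasure μ] {Ω : Set (Dom n)} (hμ : μ Ωᶜ = 0) {H : Dom n → F} (hH : Measurable H)
    {G : Set (Dom n)} (hG : ∀ᵐ x ∂μ, x ∈ G) (hb : Bornology.IsBounded (H '' G)) {δ : ℝ} (hδ : 0 < δ) :
    ∃ (E : Set (Dom n)) (r : Dom n → Dom n), IsCompact E ∧ E ⊆ Ω ∧ μ.real Eᶜ ≤ δ ∧
      (∀ y ∈ E, y ∈ G ∧ r y ∈ G ∧ dist (H y) (H (r y)) ≤ δ) ∧ ∃ d > 0, ∀ y ∈ E, ∀ y' ∈ E, dist y y' < d → r y = r y' := by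
  set e := TopologicalSpace.denseSeq F
  obtain ⟨t, ht⟩ := hb.isCompact_closure.elim_finite_subcover (fun k => Metric.ball (e k) (δ / 2)) (fun _ => Metric.isOpen_ball)
    (fun p _ => by
      obtain ⟨k, hk⟩ := (TopologicalSpace.denseRange_denseSeq F).exists_dist_lt p (half_pos hδ)
      exact Set.mem_iUnion.2 ⟨k, Metric.mem_ball.2 hk⟩)
  set N := t.sup id
  set q := SimpleFunc.nearestPt e N
  have hq : ∀ x ∈ G, dist (q (H x)) (H x) ≤ δ / 2 := by
    intro x hx
    obtain ⟨k, hk, hxk⟩ := Set.mem_iUnion₂.1 (ht (subset_closure ⟨x, hx, rfl⟩))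
    have h1 := SimpleFunc.edist_nearestPt_le e (H x) (show k ≤ N from Finset.le_sup (f := id) hk)
    rw [edist_dist, edist_dist, ENNReal.ofReal_le_ofReal_iff dist_nonneg] at h1
    rw [Metric.mem_ball, dist_comm] at hxk
    exact h1.trans hxk.le
  obtain ⟨G', hG', hGm, hGG⟩ := (hG.and (show ∀ᵐ x ∂μ, x ∈ Ω from hμ)).exists_measurable_mem
  set T := q.range
  set η : ℝ := δ / (T.card + 1)
  have hη : 0 < η := by positivity
  have hSm : ∀ p, MeasurableSet ({x | q (H x) = p} ∩ G') := fun p =>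
    (hH (q.measurableSet_fiber p)).inter hGm
  choose C hC1 hC2 hC3 using fun p => (hSm p).exists_isCompact_sdiff_lt (measure_ne_top μ _) (ENNReal.ofReal_pos.2 hη).ne'
  set E := ⋃ p ∈ T, C p
  have hEc : IsCompact E := T.finite_toSet.isCompact_biUnion fun p _ => hC2 p
  have hEG : ∀ y ∈ E, y ∈ C (q (H y)) ∧ y ∈ G' := by
    intro y hy
    obtain ⟨p, _, hp⟩ := Set.mem_iUnion₂.1 hy
    have h := hC1 p hp
    have h2 : q (H y) = p := h.1
    exact ⟨h2 ▸ hp, h.2⟩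
  classical
  refine ⟨E, fun y => if h : (C (q (H y))).Nonempty then h.some else y, hEc, fun y hy => (hGG _ (hEG y hy).2).2, ?_, ?_, ?_⟩
  · have h1 : Eᶜ ⊆ G'ᶜ ∪ ⋃ p ∈ T, (({x | q (H x) = p} ∩ G') \ C p) := by
      intro y hy
      by_cases hyG : y ∈ G'
      · refine Or.inr (Set.mem_iUnion₂.2 ⟨q (H y), q.mem_range_self _, ⟨rfl, hyG⟩, fun h => hy (Set.mem_iUnion₂.2 ⟨_, q.mem_range_self _, h⟩)⟩)
      · exact Or.inl hyG
    have h2 : μ.real G'ᶜ = 0 := by rw [measureReal_def, show μ G'ᶜ = 0 from hG']; rfl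
    calc μ.real Eᶜ ≤ _ := measureReal_mono h1
      _ ≤ _ := measureReal_union_le _ _
      _ ≤ 0 + ∑ p ∈ T, μ.real (({x | q (H x) = p} ∩ G') \ C p) := add_le_add h2.le (measureReal_biUnion_finset_le _ _)
      _ ≤ 0 + ∑ p ∈ T, η := by
        gcongr with p
        exact ENNReal.toReal_le_of_le_ofReal hη.le (hC3 p).le
      _ ≤ δ := by
        rw [Finset.sum_const, nsmul_eq_mul, zero_add]
        simp only [η]
        rw [← mul_div_assoc, div_le_iff₀ (by positivity)]
        nlinarith
  · intro y hy
    have h0 := hEG y hy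
    have hne : (C (q (H y))).Nonempty := ⟨y, h0.1⟩
    have h1 := hC1 _ hne.some_mem
    simp only [dif_pos hne]
    refine ⟨(hGG _ h0.2).1, (hGG _ h1.2).1, ?_⟩
    have h2 := hq _ (hGG _ h0.2).1
    have h3 := hq _ (hGG _ h1.2).1
    have h4 : q (H hne.some) = q (H y) := h1.1
    rw [h4] at h3
    have := dist_triangle_left (H y) (H hne.some) (q (H y))
    linarith
  · obtain ⟨d, hd, h⟩ := lebesgue_number_lemma_of_metric (c := fun p : F => (⋃ p' ∈ T.filter (· ≠ p), C p')ᶜ) hEc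
      (fun p => ((T.filter (· ≠ p)).finite_toSet.isCompact_biUnion fun p _ => hC2 p).isClosed.isOpen_compl)
      (fun y hy => Set.mem_iUnion.2 ⟨q (H y), fun hy' => by
        obtain ⟨p, hp, hyp⟩ := Set.mem_iUnion₂.1 hy'
        exact (Finset.mem_filter.1 hp).2 ((hC1 p hyp).1 : q (H y) = p).symm⟩)
    refine ⟨d, hd, fun y hy y' hy' hdd => ?_⟩
    obtain ⟨p, hp⟩ := h y hy
    have key : ∀ u ∈ E, dist y u < d → q (H u) = p := by
      intro u hu hyu
      by_contra hne
      exact hp (Metric.mem_ball'.2 hyu) (Set.mem_iUnion₂.2 ⟨q (H u), Finset.mem_filter.2 ⟨q.mem_range_self _, hne⟩, (hEG u hu).1⟩)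
    have h1 := key y hy (by simpa using hd)
    have h2 := key y' hy' hdd
    by_cases hne : (C p).Nonempty
    · simp only [h1, h2]
      rw [dif_pos hne, dif_pos hne]
    · exact absurd ⟨y, h1 ▸ (hEG y hy).1⟩ hne
end partition
end
section
section moll
variable {n : ℕ} {E : Type*} [NormedAddCommGroup E] [NormedSpace ℝ E]
/-- A mollifying kernel at scale `t`. -/
structure MK (K : Dom n → ℝ) (t : ℝ) : Prop where
  cont : Continuous K
  nn : ∀ x, 0 ≤ K x
  supp : ∀ x, K x ≠ 0 → ‖x‖ ≤ t
  one : ∫ x, K x = 1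
  bdd : ∃ M, ∀ x, K x ≤ M
  int : Integrable K
lemma mk_moll {ρ : Dom n → ℝ} (hρ : IsStdMollifier n ρ) {t : ℝ} (ht : 0 < t) : MK (mollK ρ t) t := by
  obtain ⟨h1, h2, h3, -, h5⟩ := hρ
  have hc : Continuous (mollK ρ t) := by
    unfold mollK; exact continuous_const.mul (h1.continuous.comp (continuous_const_smul _))
  have hs : ∀ x, mollK ρ t x ≠ 0 → ‖x‖ ≤ t := by
    intro x hx
    have h6 : ρ (t⁻¹ • x) ≠ 0 := right_ne_zero_of_mul hx
    have h7 := h3 (subset_tsupport _ h6)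
    have h8 : ‖t⁻¹ • x‖ ≤ 1 := (pi_norm_le_iff_of_nonneg zero_le_one).2 fun i => by
      have := h7 i (Set.mem_univ _)
      rw [Real.norm_eq_abs, abs_le]; constructor <;> linarith [this.1, this.2]
    rwa [norm_smul, norm_inv, Real.norm_eq_abs, abs_of_pos ht, inv_mul_le_iff₀ ht, mul_one] at h8
  have hcs : HasCompactSupport (mollK ρ t) :=
    HasCompactSupport.of_support_subset_isCompact (isCompact_closedBall 0 t) fun x hx => by simpa using hs x hx
  refine ⟨hc, fun x => mul_nonneg (by positivity) (h2 _), hs, ?_, ?_, hc.integrable_of_hasCompactSupport hcs⟩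
  · unfold mollK
    rw [integral_const_mul, Measure.integral_comp_smul, h5]
    simp [abs_of_pos ht, ht.ne']
  · obtain ⟨M, hM⟩ := hcs.exists_bound_of_continuous hc
    exact ⟨M, fun x => (le_abs_self _).trans (hM x)⟩
variable {K : Dom n → ℝ} {t : ℝ} (hK : MK K t) {μ : Measure (Dom n)} [IsFiniteMeasure μ] {w : Dom n → E} (hw : Integrable w μ)
include hK
lemma mk_norm (y : Dom n) (c : E) : ∫ x, ‖K (x - y) • c‖ = ‖c‖ := by
  simp only [norm_smul, Real.norm_eq_abs, abs_of_nonneg (hK.nn _)]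
  rw [integral_mul_const, integral_sub_right_eq_self K y, hK.one, one_mul]
include hw
lemma mk_prod : Integrable (fun p : Dom n × Dom n => K (p.1 - p.2) • w p.2) (volume.prod μ) := by
  have hm : AEStronglyMeasurable (fun p : Dom n × Dom n => K (p.1 - p.2) • w p.2) (volume.prod μ) :=
    (hK.cont.comp (continuous_fst.sub continuous_snd)).aestronglyMeasurable.smul hw.1.comp_snd
  rw [integrable_prod_iff' hm]
  refine ⟨Eventually.of_forall fun y => (hK.int.comp_sub_right y).smul_const (w y), ?_⟩
  simp only [mk_norm hK]
  exact hw.norm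
lemma mk_int : Integrable (fun x => ∫ y, K (x - y) • w y ∂μ) := (mk_prod hK hw).integral_prod_left
lemma mk_L1 : ∫ x, ‖∫ y, K (x - y) • w y ∂μ‖ ≤ ∫ y, ‖w y‖ ∂μ := by
  have h := mk_prod hK hw
  calc _ ≤ ∫ x, ∫ y, ‖K (x - y) • w y‖ ∂μ := integral_mono h.integral_prod_left.norm h.norm.integral_prod_left
        fun x => norm_integral_le_integral_norm _
    _ = ∫ y, ∫ x, ‖K (x - y) • w y‖ ∂volume ∂μ := integral_integral_swap h.norm
    _ = _ := by simp only [mk_norm hK]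
lemma mk_cont : Continuous (fun x => ∫ y, K (x - y) • w y ∂μ) := by
  obtain ⟨M, hM⟩ := hK.bdd
  refine continuous_of_dominated (bound := fun y => M * ‖w y‖) (fun x => ?_) (fun x => Eventually.of_forall fun y => ?_) (hw.norm.const_mul M)
    (Eventually.of_forall fun y => (hK.cont.comp (continuous_id.sub continuous_const)).smul continuous_const)
  · exact (hK.cont.comp (continuous_const.sub continuous_id)).aestronglyMeasurable.smul hw.1
  · rw [norm_smul, Real.norm_eq_abs, abs_of_nonneg (hK.nn _)]
    exact mul_le_mul_of_nonneg_right (hM _) (norm_nonneg _)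
omit hw
lemma mk_eta {w : Dom n → ℝ} (hw : Integrable w μ) {η : Dom n → ℝ} (h1 : ∀ x y, |η x - η y| ≤ ‖x - y‖) (h2 : ∀ x, |η x| ≤ 1) :
    |(∫ x, η x * ∫ y, K (x - y) * w y ∂μ) - ∫ y, η y * w y ∂μ| ≤ t * ∫ y, |w y| ∂μ := by
  have hη : Continuous η := lip_cont (L := 1) (by simpa using h1)
  have h := mk_prod hK hw
  have hp : Integrable (fun p : Dom n × Dom n => η p.1 * (K (p.1 - p.2) * w p.2)) (volume.prod μ) :=
    h.bdd_mul (c := 1) (hη.comp continuous_fst).aestronglyMeasurable (Eventually.of_forall fun p => h2 _)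
  have hs : (∫ x, η x * ∫ y, K (x - y) * w y ∂μ) = ∫ y, ∫ x, η x * (K (x - y) * w y) ∂volume ∂μ := by
    rw [← integral_integral_swap hp]
    simp only [integral_const_mul]
  have hi : Integrable (fun y => η y * w y) μ := hw.bdd_mul (c := 1) hη.aestronglyMeasurable (Eventually.of_forall fun p => h2 _)
  rw [hs, ← integral_sub hp.integral_prod_right hi, ← integral_const_mul]
  refine (abs_integral_le_integral_abs (μ := μ)).trans (integral_mono_of_nonneg (Eventually.of_forall fun y => abs_nonneg _) (hw.abs.const_mul t)
    (Eventually.of_forall fun y => ?_))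
  have hKy := hK.int.comp_sub_right y
  have e : (∫ x, η x * (K (x - y) * w y)) - η y * w y = ∫ x, (η x - η y) * (K (x - y) * w y) := by
    have e1 : η y * w y = ∫ x, η y * (K (x - y) * w y) := by
      rw [integral_const_mul, integral_mul_const, integral_sub_right_eq_self K y, hK.one, one_mul]
    rw [e1, ← integral_sub]
    · simp only [sub_mul]
    · exact (hKy.mul_const _).bdd_mul (c := 1) hη.aestronglyMeasurable (Eventually.of_forall fun p => h2 _)
    · exact (hKy.mul_const _).const_mul _
  simp only [e]
  refine (abs_integral_le_integral_abs (μ := volume)).trans ?_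
  calc _ ≤ ∫ x, t * ‖K (x - y) • w y‖ := by
        refine integral_mono_of_nonneg (Eventually.of_forall fun y => abs_nonneg _) ((hKy.smul_const _).norm.const_mul t)
          (Eventually.of_forall fun x => ?_)
        show |(η x - η y) * (K (x - y) * w y)| ≤ t * ‖K (x - y) • w y‖
        rw [abs_mul, smul_eq_mul, Real.norm_eq_abs]
        by_cases h0 : K (x - y) = 0
        · simp [h0]
        · exact mul_le_mul_of_nonneg_right ((h1 x y).trans (hK.supp _ h0)) (abs_nonneg _)
    _ = _ := by rw [integral_const_mul, mk_norm hK]; rfl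
end moll
end
section
section grid
variable {n l : ℕ} {U V : Type*} [NormedAddCommGroup U] [NormedSpace ℝ U] [NormedAddCommGroup V] [NormedSpace ℝ V]
lemma dix_fin {K : Set (Dom n)} (hK : IsCompact K) (j : ℕ) : (dix j '' K).Finite := by
  obtain ⟨R, hR⟩ := hK.isBounded.exists_norm_le
  refine (Set.finite_Icc (fun _ : Fin n => ⌊(2:ℝ)^j * (-R)⌋) (fun _ => ⌊(2:ℝ)^j * R⌋)).subset ?_
  rintro _ ⟨x, hx, rfl⟩
  have h : ∀ i, -R ≤ x i ∧ x i ≤ R := fun i => abs_le.1 ((norm_le_pi_norm x i).trans (hR x hx))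
  exact ⟨fun i => Int.floor_mono (mul_le_mul_of_nonneg_left (h i).1 (by positivity)),
    fun i => Int.floor_mono (mul_le_mul_of_nonneg_left (h i).2 (by positivity))⟩
lemma bdd_int {E : Type*} [NormedAddCommGroup E] {Ω : Set (Dom n)} (hb : Bornology.IsBounded Ω) {f : Dom n → E} (hf : Continuous f) :
    IntegrableOn f Ω :=
  (hf.continuousOn.integrableOn_compact hb.isCompact_closure).mono_set subset_closure
lemma grid (B : (Fin n → ℕ) → (U →L[ℝ] V)) {ι : Type*} [Fintype ι] {Ψ : ι → V → ℝ} {L : ℝ} (hΨ : ∀ i x y, |Ψ i x - Ψ i y| ≤ L * ‖x - y‖)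
    {Ω : Set (Dom n)} (hΩo : IsOpen Ω) (hΩb : Bornology.IsBounded Ω) {c : Dom n → V} (hc : Continuous c)
    {e : ι → Dom n → ℝ} (he : ∀ i, Continuous (e i)) {K : Set (Dom n)} (hK : IsCompact K) (hKΩ : K ⊆ Ω)
    (hoff : ∀ x, x ∉ K → c x = 0 ∧ ∀ i, e i x = Ψ i 0) {a : ℝ} (ha : 0 < a)
    (hloc : ∀ x ∈ K, ∃ φ : Dom n → U, CcSmooth (unitCube n) φ ∧ ∀ i, |(∫ y in unitCube n, Ψ i (c x + opApply B l φ y)) - e i x| ≤ a)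
    {ε1 : ℝ} (hε1 : 0 < ε1) :
    ∃ φ : Dom n → U, CcSmooth Ω φ ∧ sobNorm l φ < ε1 ∧ ∀ η : Dom n → ℝ, (∀ x y, |η x - η y| ≤ ‖x - y‖) → (∀ x, |η x| ≤ 1) →
      ∀ i, |(∫ x in Ω, η x * e i x) - ∫ x in Ω, η x * Ψ i (c x + opApply B l φ x)| ≤ 4 * a * volume.real Ω := by
  classical
  have hΨc : ∀ i, Continuous (Ψ i) := fun i => lip_cont (hΨ i)
  choose! φ0 hφ0 hφ1 using hloc
  set O : Dom n → Set (Dom n) := fun x => ({y | L * ‖c y - c x‖ < a} ∩ ⋂ i, {y | |e i y - e i x| < a}) ∩ Ω with hO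
  have hOo : ∀ x, IsOpen (O x) := fun x =>
    ((isOpen_lt (continuous_const.mul (hc.sub continuous_const).norm) continuous_const).inter
      (isOpen_iInter_of_finite fun i => isOpen_lt ((he i).sub continuous_const).abs continuous_const)).inter hΩo
  obtain ⟨t, htK, htc⟩ := hK.elim_nhds_subcover O fun x hx => (hOo x).mem_nhds ⟨⟨by simpa using ha, by simpa using fun _ => ha⟩, hKΩ hx⟩
  obtain ⟨δ, hδ, hleb⟩ := lebesgue_number_lemma_of_metric (c := fun p : t => O p) hK (fun p => hOo p)
    (fun x hx => by obtain ⟨p, hp, hx⟩ := Set.mem_iUnion₂.1 (htc hx); exact Set.mem_iUnion.2 ⟨⟨p, hp⟩, hx⟩)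
  set G : ι → Dom n → Dom n → ℝ := fun i p y => e i p - Ψ i (c p + opApply B l (φ0 p) y) with hG
  have hGc : ∀ i, ∀ p ∈ t, Continuous (G i p) := fun i p hp =>
    continuous_const.sub ((hΨc i).comp (continuous_const.add (op_cont B (hφ0 p (htK p hp)).1)))
  obtain ⟨D, hD⟩ := (isCompact_closedBall (0 : Dom n) 1).exists_bound_of_continuousOn (f := fun y => ∑ p ∈ t, ∑ i, |G i p y|)
    (continuous_finset_sum _ fun p hp => continuous_finset_sum _ fun i _ => (hGc i p hp).abs).continuousOn
  have hD' : ∀ i, ∀ p ∈ t, ∀ y ∈ hcube n, |G i p y| ≤ |D| := by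
    intro i p hp y hy
    have h1 : y ∈ Metric.closedBall (0 : Dom n) 1 := by
      rw [mem_closedBall_zero_iff, pi_norm_le_iff_of_nonneg zero_le_one]
      intro i
      have := hy i (Set.mem_univ _)
      rw [Real.norm_eq_abs, abs_le]; constructor <;> linarith [this.1, this.2]
    have h2 := (le_abs_self _).trans ((hD y h1).trans (le_abs_self D))
    refine le_trans ?_ h2
    refine le_trans ?_ (Finset.single_le_sum (f := fun p => ∑ i, |G i p y|) (fun p _ => Finset.sum_nonneg fun i _ => abs_nonneg _) hp)
    exact Finset.single_le_sum (f := fun i => |G i p y|) (fun i _ => abs_nonneg _) (Finset.mem_univ i)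
  have hsn : ∀ u : Dom n → U, 0 ≤ sobNorm l u := fun u => Finset.sum_nonneg fun j _ => integral_nonneg fun x => norm_nonneg _
  set S0 := ∑ p ∈ t, sobNorm l (φ0 p) with hS0
  have hS0n : 0 ≤ S0 := Finset.sum_nonneg fun p _ => hsn _
  set M := volume.real Ω with hM
  have hM0 : 0 ≤ M := measureReal_nonneg
  obtain ⟨j, hj1, hj2, hj3⟩ : ∃ j : ℕ, ((2:ℝ)^j)⁻¹ < δ ∧ ((2:ℝ)^j)⁻¹ * |D| < a ∧ ((2:ℝ)^j)⁻¹ * (M * S0) < ε1 := by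
    have h0 : Tendsto (fun j : ℕ => ((2:ℝ)^j)⁻¹) atTop (𝓝 0) := (tendsto_pow_atTop_atTop_of_one_lt one_lt_two).inv_tendsto_atTop
    have h1 := h0.mul_const |D|
    have h2 := h0.mul_const (M * S0)
    rw [zero_mul] at h1 h2
    exact ((h0.eventually_lt_const hδ).and ((h1.eventually_lt_const ha).and (h2.eventually_lt_const hε1))).exists
  set s := (dix_fin hK j).toFinset with hs
  have hsv : ∀ v ∈ s, ∃ y ∈ K, dix j y = v := fun v hv => by simpa [hs] using hv
  choose! q hqK hqv using hsv
  have hp : ∀ v ∈ s, ∃ p ∈ t, dcell j v ⊆ O p := by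
    intro v hv
    obtain ⟨p, hp⟩ := hleb (q v) (hqK v hv)
    refine ⟨p, p.2, fun x hx => hp ?_⟩
    rw [Metric.mem_ball, dist_eq_norm]
    exact (dcell_dist hx (hqv v hv)).trans_lt hj1
  choose! p hpt hpO using hp
  have hcc : ∀ v ∈ s, CcSmooth (unitCube n) (φ0 (p v)) := fun v hv => hφ0 _ (htK _ (hpt v hv))
  have hcΩ : ∀ v ∈ s, dcell j v ⊆ Ω := fun v hv x hx => (hpO v hv hx).2
  have hvol : ∑ v ∈ s, (((2:ℝ)^j)⁻¹)^n ≤ M := by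
    have h1 : volume.real (⋃ v ∈ s, dcell j v) = ∑ v ∈ s, volume.real (dcell j v) :=
      measureReal_biUnion_finset (dcell_disj j _) (fun v _ => dcell_meas j v)
        (fun v hv => ((measure_mono (hcΩ v hv)).trans_lt hΩb.measure_lt_top).ne)
    have h2 : ∀ v, volume.real (dcell j v) = (((2:ℝ)^j)⁻¹)^n := fun v => by rw [← dcell_real j v, measureReal_restrict_apply_univ]
    simp only [h2] at h1
    rw [← h1]
    exact measureReal_mono (Set.iUnion₂_subset hcΩ) hΩb.measure_lt_top.ne
  set φ := patch l j s (fun v => φ0 (p v)) with hφ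
  have hφs : Sm φ := patch_sm hcc
  refine ⟨φ, patch_cc hcc hcΩ, ?_, fun η hη1 hη2 i => ?_⟩
  · refine lt_of_le_of_lt (patch_sob hcc) (lt_of_le_of_lt ?_ hj3)
    refine mul_le_mul_of_nonneg_left ?_ (by positivity)
    calc _ ≤ ∑ v ∈ s, (((2:ℝ)^j)⁻¹)^n * S0 := Finset.sum_le_sum fun v hv => mul_le_mul_of_nonneg_left
            (Finset.single_le_sum (f := fun p => sobNorm l (φ0 p)) (fun p _ => hsn _) (hpt v hv)) (by positivity)
      _ = (∑ v ∈ s, (((2:ℝ)^j)⁻¹)^n) * S0 := by rw [Finset.sum_mul]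
      _ ≤ _ := mul_le_mul_of_nonneg_right hvol hS0n
  · have hηc : Continuous η := lip_cont (L := 1) (by simpa using hη1)
    have hBc : Continuous (opApply B l φ) := op_cont B hφs
    have i1 : Continuous fun x => η x * e i x := hηc.mul (he i)
    have i2 : Continuous fun x => η x * Ψ i (c x + opApply B l φ x) := hηc.mul ((hΨc i).comp (hc.add hBc))
    set d : Dom n → ℝ := fun x => η x * e i x - η x * Ψ i (c x + opApply B l φ x) with hd
    have hdc : Continuous d := i1.sub i2
    have hd0 : ∀ x ∈ Ω \ ⋃ v ∈ s, dcell j v, d x = 0 := by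
      rintro x ⟨_, hx⟩
      have h1 : dix j x ∉ s := fun h => hx (Set.mem_iUnion₂.2 ⟨_, h, rfl⟩)
      have h2 : x ∉ K := fun h => h1 (by simpa [hs] using ⟨x, h, rfl⟩)
      simp only [hd, hφ]
      rw [op_patch B hcc, if_neg h1, (hoff x h2).1, (hoff x h2).2, add_zero, sub_self]
    have hcell : ∀ v ∈ s, |∫ x in dcell j v, d x| ≤ 4 * a * (((2:ℝ)^j)⁻¹)^n := by
      intro v hv
      have hGv := hGc i _ (hpt v hv)
      set g : Dom n → ℝ := fun x => G i (p v) ((2:ℝ)^j • (x - ctr j v)) with hg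
      have hgc : Continuous g := hGv.comp (show Continuous fun x : Dom n => (2:ℝ)^j • (x - ctr j v) by fun_prop)
      have h1 : |∫ x in dcell j v, g x| ≤ a * (((2:ℝ)^j)⁻¹)^n := by
        rw [hg, cube_cov, smul_eq_mul, abs_mul, abs_of_pos (show (0:ℝ) < (((2:ℝ)^j)⁻¹)^n by positivity), mul_comm]
        refine mul_le_mul_of_nonneg_right ?_ (by positivity)
        have h2 := hφ1 _ (htK _ (hpt v hv)) i
        rw [abs_sub_comm] at h2
        simp only [hG]
        rw [integral_sub (cube_int continuous_const) (cube_int (show Continuous fun x => Ψ i (c (p v) + opApply B l (φ0 (p v)) x) from (hΨc i).comp (continuous_const.add (op_cont B (hcc v hv).1)))), integral_const,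
          cube_real, one_smul]
        exact h2
      have h3 : ∀ x ∈ dcell j v, ‖d x - η (q v) * g x‖ ≤ 3 * a := by
        intro x hx
        have hx' : dix j x = v := hx
        obtain ⟨⟨o1, o2⟩, -⟩ := hpO v hv hx
        have o2 := Set.mem_iInter.1 o2 i
        have o1 : L * ‖c x - c (p v)‖ < a := o1
        have o2 : |e i x - e i (p v)| < a := o2
        have e1 : opApply B l φ x = opApply B l (φ0 (p v)) ((2:ℝ)^j • (x - ctr j v)) := by
          rw [hφ, op_patch B hcc, hx', if_pos hv]
        have h4 := hΨ i (c x + opApply B l φ x) (c (p v) + opApply B l φ x)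
        rw [add_sub_add_right_eq_sub] at h4
        have e2 : d x - η (q v) * g x = (η x - η (q v)) * g x + η x * ((e i x - e i (p v)) -
            (Ψ i (c x + opApply B l φ x) - Ψ i (c (p v) + opApply B l φ x))) := by
          simp only [hd, hg, hG, ← e1]; ring
        rw [e2, Real.norm_eq_abs]
        have h5 : |η x - η (q v)| * |g x| ≤ ((2:ℝ)^j)⁻¹ * |D| :=
          mul_le_mul ((hη1 _ _).trans (dcell_dist hx (hqv v hv))) (hD' i _ (hpt v hv) _ (mem_hcube_iff.2 hx)) (abs_nonneg _) (by positivity)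
        have h6 : |η x| * |(e i x - e i (p v)) - (Ψ i (c x + opApply B l φ x) - Ψ i (c (p v) + opApply B l φ x))| ≤ 1 * (a + a) :=
          mul_le_mul (hη2 x) ((abs_sub _ _).trans (add_le_add o2.le (h4.trans o1.le))) (abs_nonneg _) zero_le_one
        refine (abs_add_le _ _).trans ?_
        rw [abs_mul, abs_mul]
        linarith
      have h7 := norm_setIntegral_le_of_norm_le_const (μ := volume) ((measure_mono (hcΩ v hv)).trans_lt hΩb.measure_lt_top) h3
      rw [integral_sub (dcell_int hdc j v) (dcell_int (show Continuous fun x => η (q v) * g x from continuous_const.mul hgc) j v), integral_const_mul, Real.norm_eq_abs,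
        ← measureReal_restrict_apply_univ, dcell_real] at h7
      have h8 : |η (q v) * ∫ x in dcell j v, g x| ≤ 1 * (a * (((2:ℝ)^j)⁻¹)^n) := by
        rw [abs_mul]; exact mul_le_mul (hη2 _) h1 (abs_nonneg _) zero_le_one
      have h9 := abs_sub_abs_le_abs_sub (∫ x in dcell j v, d x) (η (q v) * ∫ x in dcell j v, g x)
      linarith
    rw [← integral_sub (bdd_int hΩb i1) (bdd_int hΩb i2)]
    have h10 : ∫ x in Ω, d x = ∑ v ∈ s, ∫ x in dcell j v, d x := by
      rw [setIntegral_eq_of_subset_of_forall_sdiff_eq_zero hΩo.measurableSet (Set.iUnion₂_subset hcΩ) hd0]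
      exact integral_biUnion_finset s (fun v _ => dcell_meas j v) (dcell_disj j _) (fun v _ => dcell_int hdc j v)
    show |∫ x in Ω, d x| ≤ _
    rw [h10]
    calc _ ≤ ∑ v ∈ s, |∫ x in dcell j v, d x| := Finset.abs_sum_le_sum_abs _ _
      _ ≤ ∑ v ∈ s, 4 * a * (((2:ℝ)^j)⁻¹)^n := Finset.sum_le_sum hcell
      _ = 4 * a * ∑ v ∈ s, (((2:ℝ)^j)⁻¹)^n := by rw [Finset.mul_sum]
      _ ≤ _ := mul_le_mul_of_nonneg_left hvol (by positivity)
end grid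
end
section
section core0
variable {n : ℕ} {F : Type*} [NormedAddCommGroup F]
lemma ind_l1 {μ : Measure (Dom n)} [IsFiniteMeasure μ] {E G : Set (Dom n)} {r : Dom n → Dom n} {δ d C : ℝ} (hE : MeasurableSet E)
    (hEc : μ.real Eᶜ ≤ δ) (hG : ∀ᵐ x ∂μ, x ∈ G) (hr : ∀ y ∈ E, r y ∈ G) (hd : 0 < d)
    (hloc : ∀ y ∈ E, ∀ y' ∈ E, dist y y' < d → r y = r y') (hδ : 0 ≤ δ) (hC : 0 ≤ C)
    {f : Dom n → F} (hf : AEStronglyMeasurable f μ) (hfC : ∀ y ∈ G, ‖f y‖ ≤ C) (hfr : ∀ y ∈ E, ‖f y - f (r y)‖ ≤ δ) :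
    Integrable f μ ∧ Integrable (E.indicator fun y => f (r y)) μ ∧
      (∫ y, ‖E.indicator (fun y => f (r y)) y - f y‖ ∂μ) ≤ δ * μ.real Set.univ + C * δ ∧
      (∫ y, ‖E.indicator (fun y => f (r y)) y‖ ∂μ) ≤ C * μ.real Set.univ := by
  have i1 : Integrable f μ := Integrable.of_bound hf C (hG.mono fun y hy => hfC y hy)
  have hco : ContinuousOn (fun y => f (r y)) E := by
    intro y hy
    refine (continuousWithinAt_const (b := f (r y))).congr_of_eventuallyEq ?_ rfl
    filter_upwards [self_mem_nhdsWithin, mem_nhdsWithin_of_mem_nhds (Metric.ball_mem_nhds y hd)] with y' h1 h2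
    rw [hloc y' h1 y hy h2]
  have i2 : Integrable (E.indicator fun y => f (r y)) μ := by
    rw [integrable_indicator_iff hE]
    exact Integrable.of_bound (hco.aestronglyMeasurable hE) C ((ae_restrict_iff' hE).2 (Eventually.of_forall fun y hy => hfC _ (hr y hy)))
  refine ⟨i1, i2, ?_, ?_⟩
  · have h1 : (∫ y, ‖E.indicator (fun y => f (r y)) y - f y‖ ∂μ) ≤ ∫ y, (δ + Eᶜ.indicator (fun _ => C) y) ∂μ := by
      refine integral_mono_ae (i2.sub i1).norm ((integrable_const _).add ((integrable_const C).indicator hE.compl)) ?_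
      filter_upwards [hG] with y hy
      by_cases h : y ∈ E
      · simpa [h, norm_sub_rev] using hfr y h
      · simpa [h] using (hfC y hy).trans (le_add_of_nonneg_left hδ)
    rw [integral_add (integrable_const _) ((integrable_const C).indicator hE.compl), integral_indicator hE.compl, integral_const,
      setIntegral_const, smul_eq_mul, smul_eq_mul] at h1
    nlinarith [mul_le_mul_of_nonneg_right hEc hC]
  · have h1 : (∫ y, ‖E.indicator (fun y => f (r y)) y‖ ∂μ) ≤ ∫ y, C ∂μ := by
      refine integral_mono i2.norm (integrable_const _) fun y => ?_
      by_cases h : y ∈ E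
      · simpa [h] using hfC _ (hr y h)
      · simpa [h] using hC
    rw [integral_const, smul_eq_mul] at h1
    linarith
lemma mk_int1 [NormedSpace ℝ F] {K : Dom n → ℝ} {t : ℝ} (hK : MK K t) {μ : Measure (Dom n)} {w : Dom n → F} (hw : Integrable w μ) (x : Dom n) :
    Integrable (fun y => K (x - y) • w y) μ := by
  obtain ⟨M, hM⟩ := hK.bdd
  exact hw.bdd_smul M (hK.cont.comp (continuous_const.sub continuous_id)).aestronglyMeasurable
    (Eventually.of_forall fun y => by rw [Real.norm_eq_abs, abs_of_nonneg (hK.nn _)]; exact hM _)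
lemma mk_diff [NormedSpace ℝ F] {K : Dom n → ℝ} {t : ℝ} (hK : MK K t) {μ : Measure (Dom n)} [IsFiniteMeasure μ] {w w' : Dom n → F}
    (hw : Integrable w μ) (hw' : Integrable w' μ) :
    ∫ x, ‖(∫ y, K (x - y) • w y ∂μ) - ∫ y, K (x - y) • w' y ∂μ‖ ≤ ∫ y, ‖w y - w' y‖ ∂μ := by
  have h := mk_L1 hK (hw.sub hw')
  simp only [Pi.sub_apply, smul_sub] at h
  convert h using 4 with x
  exact (integral_sub (mk_int1 hK hw x) (mk_int1 hK hw' x)).symm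
end core0
end
section
section core
variable {n k l : ℕ} {V W U : Type*} [NormedAddCommGroup V] [InnerProductSpace ℝ V] [FiniteDimensional ℝ V]
  [MeasurableSpace V] [BorelSpace V] [NormedAddCommGroup W] [InnerProductSpace ℝ W] [FiniteDimensional ℝ W]
  [NormedAddCommGroup U] [InnerProductSpace ℝ U] [FiniteDimensional ℝ U]
  {A : (Fin n → ℕ) → (V →L[ℝ] W)} {B : (Fin n → ℕ) → (U →L[ℝ] V)}
lemma sph_le {g : V → ℝ} (h0 : g 0 = 0) {L : ℝ} (hg : ∀ x y, |g x - g y| ≤ L * ‖x - y‖) (ν : Measure (Metric.sphere (0:V) 1))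
    [IsProbabilityMeasure ν] : |∫ w, g (w : V) ∂ν| ≤ L := by
  have := norm_integral_le_of_norm_le_const (μ := ν) (f := fun w : Metric.sphere (0:V) 1 => g (w : V)) (C := L)
    (Eventually.of_forall fun w => by simpa [h0] using hg (w : V) 0)
  simpa using this
lemma lim_zero {f g : V → ℝ} (hg : ∀ w, Tendsto (fun t : ℝ => f (t • w) / t) atTop (𝓝 (g w))) : g 0 = 0 := by
  refine tendsto_nhds_unique (hg 0) ?_
  simp only [smul_zero]
  exact tendsto_const_nhds.div_atTop tendsto_id
lemma core (hn : 0 < n) (hspan : SpanningCone A k) (hexact : ExactPotential A k B l)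
    {Ω : Set (Dom n)} (hΩo : IsOpen Ω) (hΩb : Bornology.IsBounded Ω)
    (Y : YoungMeasure n V Ω) (hYfr : Y.conc (frontier Ω) = 0) (hAfree : Y.AFree A k)
    {ρ : Dom n → ℝ} (hρ : IsStdMollifier n ρ) {ι : Type*} [Fintype ι] {Ψ Ψi : ι → V → ℝ}
    (hΨ : ∀ i x y, |Ψ i x - Ψ i y| ≤ 3 * ‖x - y‖)
    (hinf : ∀ i w, Tendsto (fun t : ℝ => Ψ i (t • w) / t) atTop (𝓝 (Ψi i w))) {ε : ℝ} (hε : 0 < ε) :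
    ∃ tε > (0:ℝ), ∀ t ∈ Set.Ioc (0:ℝ) tε, ∃ φ : Dom n → U, CcSmooth Ω φ ∧ sobNorm l φ < ε ∧
      ∀ η : Dom n → ℝ, (∀ x y, |η x - η y| ≤ ‖x - y‖) → (∀ x, |η x| ≤ 1) → ∀ i,
        |(∫ x in Ω, η x * Ψ i 0) + (∫ x, η x * ∫ w, Ψi i (w : V) ∂(Y.ang x) ∂Y.lamS) -
          ∫ x in Ω, η x * Ψ i (Y.mollSingPart ρ t x + opApply B l φ x)| ≤ ε := by
  haveI := ys_fin Y
  set μ := Y.lamS with hμ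
  set z := Y.barAng with hz
  set h : ι → Dom n → ℝ := fun i x => ∫ w, Ψi i (w : V) ∂(Y.ang x) with hh
  set G : Set (Dom n) := {x | IsProbabilityMeasure (Y.ang x) ∧ z x ∈ waveCone A k} with hGd
  have hG : ∀ᵐ x ∂μ, x ∈ G := ys_good A Y hΩo hYfr hAfree
  have hzG : ∀ x ∈ G, ‖z x‖ ≤ 1 := fun x hx => by haveI := hx.1; exact bar_le (Y.ang x)
  have hlip : ∀ i x y, |Ψi i x - Ψi i y| ≤ 3 * ‖x - y‖ := fun i => lim_lip (hΨ i) (hinf i)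
  have hhG : ∀ i, ∀ x ∈ G, ‖h i x‖ ≤ 3 := fun i x hx => by haveI := hx.1; exact sph_le (lim_zero (hinf i)) (hlip i) (Y.ang x)
  have hhm : ∀ i, Measurable (h i) := fun i =>
    (ker_meas Y.ang_meas ((lip_cont (hlip i)).comp continuous_subtype_val)).measurable
  have hzm : Measurable z := bar_m Y
  set M := μ.real Set.univ with hM
  have hM0 : 0 ≤ M := measureReal_nonneg
  set v := volume.real Ω with hv
  have hv0 : 0 ≤ v := measureReal_nonneg
  obtain ⟨a, ha, hav⟩ : ∃ a : ℝ, 0 < a ∧ 4 * a * v ≤ ε / 4 := by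
    refine ⟨ε / (16 * (v + 1)), by positivity, ?_⟩
    rw [mul_div_assoc', div_mul_eq_mul_div, div_le_div_iff₀ (by positivity) (by norm_num)]
    nlinarith
  obtain ⟨δ, hδ, hδM⟩ : ∃ δ : ℝ, 0 < δ ∧ 4 * δ * M + 6 * δ ≤ ε / 4 := by
    refine ⟨ε / (4 * (4 * M + 6)), by positivity, ?_⟩
    field_simp; rfl
  have hmain := part μ (ys_null Y hΩo hYfr) (H := fun x => (z x, fun i => h i x)) (hzm.prodMk (measurable_pi_lambda _ hhm)) hG (by
    refine (Metric.isBounded_closedBall (x := (0 : V × (ι → ℝ))) (r := 3)).subset ?_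
    rintro _ ⟨x, hx, rfl⟩
    rw [mem_closedBall_zero_iff, Prod.norm_def]
    exact max_le ((hzG x hx).trans (by norm_num)) ((pi_norm_le_iff_of_nonneg (by norm_num)).2 fun i => hhG i x hx)) hδ
  obtain ⟨E, r, hE, hEΩ, hEc, hEr, d, hd, hloc⟩ := hmain
  have hzr : ∀ y ∈ E, ‖z y - z (r y)‖ ≤ δ := fun y hy => by
    rw [← dist_eq_norm]; exact (le_max_left _ _).trans (hEr y hy).2.2
  have hhr : ∀ i, ∀ y ∈ E, ‖h i y - h i (r y)‖ ≤ δ := fun i y hy => by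
    rw [← dist_eq_norm]
    exact ((dist_le_pi_dist (fun i => h i y) (fun i => h i (r y)) i).trans (le_max_right _ _)).trans (hEr y hy).2.2
  have hrG : ∀ y ∈ E, r y ∈ G := fun y hy => (hEr y hy).2.1
  obtain ⟨z1, z2, z3, -⟩ := ind_l1 hE.measurableSet hEc hG hrG hd hloc hδ.le zero_le_one hzm.aestronglyMeasurable hzG hzr
  have hI := fun i => ind_l1 hE.measurableSet hEc hG hrG hd hloc hδ.le (show (0:ℝ) ≤ 3 by norm_num)
    (hhm i).aestronglyMeasurable (hhG i) (hhr i)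
  set wz := E.indicator fun y => z (r y) with hwz
  set wh : ι → Dom n → ℝ := fun i => E.indicator fun y => h i (r y) with hwh
  obtain ⟨t0, ht0, htE⟩ := hE.exists_cthickening_subset_open hΩo hEΩ
  refine ⟨min t0 (min (d / 3) (ε / (4 * (3 * M + 1)))), by positivity, fun t ht => ?_⟩
  have htp := ht.1
  have hta : t ≤ t0 := ht.2.trans (min_le_left _ _)
  have htd : t ≤ d / 3 := ht.2.trans ((min_le_right _ _).trans (min_le_left _ _))
  have htM : t * (3 * M) ≤ ε / 4 := by
    have := ht.2.trans ((min_le_right _ _).trans (min_le_right _ _))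
    rw [le_div_iff₀ (by positivity)] at this
    nlinarith
  set K := mollK ρ t with hKd
  have hK : MK K t := mk_moll hρ htp
  set c : Dom n → V := fun x => ∫ y, K (x - y) • wz y ∂μ with hc
  set q : ι → Dom n → ℝ := fun i x => ∫ y, K (x - y) * wh i y ∂μ with hq
  have hcc : Continuous c := mk_cont hK z2
  have hqc : ∀ i, Continuous (q i) := fun i => mk_cont hK (hI i).2.1
  have hoff : ∀ x, x ∉ Metric.cthickening t E → c x = 0 ∧ ∀ i, q i x = 0 := by
    intro x hx
    have h1 : ∀ y ∈ E, K (x - y) = 0 := fun y hy => by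
      by_contra h2
      exact hx (Metric.mem_cthickening_of_dist_le x y t E hy (by rw [dist_eq_norm]; exact hK.supp _ h2))
    constructor
    · refine integral_eq_zero_of_ae (Eventually.of_forall fun y => ?_)
      by_cases hy : y ∈ E
      · simp [h1 y hy]
      · simp [hwz, hy]
    · intro i
      refine integral_eq_zero_of_ae (Eventually.of_forall fun y => ?_)
      by_cases hy : y ∈ E
      · simp [h1 y hy]
      · simp [hwh, hy]
  have hon : ∀ x ∈ Metric.cthickening t E, ∃ φ : Dom n → U, CcSmooth (unitCube n) φ ∧
      ∀ i, |(∫ y in unitCube n, Ψ i (c x + opApply B l φ y)) - (Ψ i 0 + q i x)| ≤ a := by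
    intro x hx
    rw [hE.cthickening_eq_biUnion_closedBall htp.le] at hx
    obtain ⟨y0, hy0, hx⟩ := Set.mem_iUnion₂.1 hx
    set s := ∫ y, K (x - y) * E.indicator (fun _ => (1:ℝ)) y ∂μ with hs
    have hs0 : 0 ≤ s := integral_nonneg fun y => mul_nonneg (hK.nn _) (Set.indicator_nonneg (fun _ _ => zero_le_one) _)
    have key : ∀ y ∈ E, K (x - y) ≠ 0 → r y = r y0 := fun y hy hk => by
      refine hloc y hy y0 hy0 ?_
      have h1 := hK.supp _ hk
      rw [← dist_eq_norm, dist_comm] at h1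
      have h2 := dist_triangle y x y0
      have h3 : dist x y0 ≤ t := hx
      linarith
    have e1 : c x = s • z (r y0) := by
      rw [hs, ← integral_smul_const]
      refine integral_congr_ae (Eventually.of_forall fun y => ?_)
      by_cases hy : y ∈ E
      · by_cases hk : K (x - y) = 0
        · simp [hk]
        · simp [hwz, hy, key y hy hk]
      · simp [hwz, hy]
    have e2 : ∀ i, q i x = s * h i (r y0) := fun i => by
      rw [hs, ← integral_mul_const]
      refine integral_congr_ae (Eventually.of_forall fun y => ?_)
      by_cases hy : y ∈ E
      · by_cases hk : K (x - y) = 0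
        · simp [hk]
        · simp [hwh, hy, key y hy hk]
      · simp [hwh, hy]
    haveI := (hrG y0 hy0).1
    obtain ⟨φ, h1, h2⟩ := lemmaL (B := B) (l := l) hn hspan hexact hΨ hinf (Y.ang (r y0)) (hrG y0 hy0).2 hs0 ha
    refine ⟨φ, h1, fun i => ?_⟩
    rw [e1, e2]
    exact h2 i
  obtain ⟨φ, hφ1, hφ2, hφ3⟩ := grid B hΨ hΩo hΩb hcc (e := fun i x => Ψ i 0 + q i x) (fun i => continuous_const.add (hqc i))
    (hE.cthickening (r := t)) ((Metric.cthickening_mono hta E).trans htE)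
    (fun x hx => ⟨(hoff x hx).1, fun i => by simp [(hoff x hx).2 i]⟩) ha hon hε
  refine ⟨φ, hφ1, hφ2, fun η hη1 hη2 i => ?_⟩
  have hηc : Continuous η := lip_cont (L := 1) (by simpa using hη1)
  have T1 := hφ3 η hη1 hη2 i
  have hBc : Continuous (opApply B l φ) := op_cont B hφ1.1
  have hmc : Continuous (Y.mollSingPart ρ t) := mk_cont hK z1
  have hΨc := lip_cont (hΨ i)
  have T2 : ∫ x in Ω, η x * (Ψ i 0 + q i x) = (∫ x in Ω, η x * Ψ i 0) + ∫ x, η x * q i x := by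
    simp only [mul_add]
    rw [integral_add (bdd_int hΩb (show Continuous fun x => η x * Ψ i 0 from hηc.mul continuous_const))
      (bdd_int hΩb (show Continuous fun x => η x * q i x from hηc.mul (hqc i)))]
    congr 1
    refine setIntegral_eq_integral_of_forall_compl_eq_zero fun x hx => ?_
    rw [(hoff x fun h' => hx (htE (Metric.cthickening_mono hta E h'))).2 i, mul_zero]
  have T3 : |(∫ x, η x * q i x) - ∫ y, η y * wh i y ∂μ| ≤ ε / 4 :=
    (mk_eta hK (hI i).2.1 hη1 hη2).trans ((mul_le_mul_of_nonneg_left (hI i).2.2.2 htp.le).trans htM)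
  have hmul : ∀ {f : Dom n → ℝ}, Integrable f μ → Integrable (fun y => η y * f y) μ := fun hf =>
    hf.bdd_mul (c := 1) hηc.aestronglyMeasurable (Eventually.of_forall fun p => hη2 _)
  have T4 : |(∫ y, η y * wh i y ∂μ) - ∫ y, η y * h i y ∂μ| ≤ δ * M + 3 * δ := by
    rw [← integral_sub (hmul (hI i).2.1) (hmul (hI i).1)]
    refine (norm_integral_le_integral_norm _).trans ((integral_mono ((hmul (hI i).2.1).sub (hmul (hI i).1)).norm
      ((hI i).2.1.sub (hI i).1).norm fun y => ?_).trans (hI i).2.2.1)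
    show |η y * wh i y - η y * h i y| ≤ |wh i y - h i y|
    rw [← mul_sub, abs_mul]
    exact mul_le_of_le_one_left (abs_nonneg _) (hη2 y)
  have T5 : |(∫ x in Ω, η x * Ψ i (c x + opApply B l φ x)) - ∫ x in Ω, η x * Ψ i (Y.mollSingPart ρ t x + opApply B l φ x)|
      ≤ 3 * (δ * M + 1 * δ) := by
    have c1 : Continuous fun x => η x * Ψ i (c x + opApply B l φ x) := hηc.mul (hΨc.comp (hcc.add hBc))
    have c2 : Continuous fun x => η x * Ψ i (Y.mollSingPart ρ t x + opApply B l φ x) := hηc.mul (hΨc.comp (hmc.add hBc))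
    have hint : Integrable fun x => 3 * ‖c x - Y.mollSingPart ρ t x‖ := ((mk_int hK z2).sub (mk_int hK z1)).norm.const_mul 3
    rw [← integral_sub (bdd_int hΩb c1) (bdd_int hΩb c2)]
    calc _ ≤ ∫ x in Ω, 3 * ‖c x - Y.mollSingPart ρ t x‖ := by
          rw [← Real.norm_eq_abs]
          refine norm_integral_le_of_norm_le hint.integrableOn (Eventually.of_forall fun x => ?_)
          rw [← mul_sub, Real.norm_eq_abs, abs_mul]
          refine (mul_le_of_le_one_left (abs_nonneg _) (hη2 x)).trans ((hΨ i _ _).trans ?_)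
          rw [add_sub_add_right_eq_sub]
      _ ≤ ∫ x, 3 * ‖c x - Y.mollSingPart ρ t x‖ :=
          setIntegral_le_integral hint (Eventually.of_forall fun x => by positivity)
      _ = 3 * ∫ x, ‖c x - Y.mollSingPart ρ t x‖ := integral_const_mul _ _
      _ ≤ _ := mul_le_mul_of_nonneg_left ((mk_diff hK z2 z1).trans z3) (by norm_num)
  rw [T2] at T1
  rw [abs_le] at *
  constructor <;> linarith
end core
end
section
section fin
variable {n k l : ℕ} {V W U : Type*} [NormedAddCommGroup V] [InnerProductSpace ℝ V] [FiniteDimensional ℝ V]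
  [MeasurableSpace V] [BorelSpace V] [NormedAddCommGroup W] [InnerProductSpace ℝ W] [FiniteDimensional ℝ W]
  [NormedAddCommGroup U] [InnerProductSpace ℝ U] [FiniteDimensional ℝ U]
  {A : (Fin n → ℕ) → (V →L[ℝ] W)} {B : (Fin n → ℕ) → (U →L[ℝ] V)}
lemma ys_prob {Ω : Set (Dom n)} (Y : YoungMeasure n V Ω) : ∀ᵐ x ∂Y.lamS, IsProbabilityMeasure (Y.ang x) :=
  (Measure.absolutelyContinuous_of_le (Y.conc.singularPart_le volume)).ae_le Y.ang_prob
lemma rec_int {Ω : Set (Dom n)} (Y : YoungMeasure n V Ω) {Φ : V → ℝ} (h1 : MemH Φ) (h2 : TLipUnit Φ) :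
    Integrable (fun x => ∫ w, rrec Φ (w : V) ∂Y.ang x) Y.lamS := by
  haveI := ys_fin Y
  have hl := lim_lip (tlip3 h2) (rrec_lim h1)
  refine Integrable.of_bound (ker_meas Y.ang_meas ((lip_cont hl).comp continuous_subtype_val)).aestronglyMeasurable 3 ?_
  filter_upwards [ys_prob Y] with x hx
  exact sph_le (lim_zero (rrec_lim h1)) hl _
lemma final (hn : 0 < n) (hspan : SpanningCone A k) (hexact : ExactPotential A k B l)
    {Ω : Set (Dom n)} (hΩo : IsOpen Ω) (hΩb : Bornology.IsBounded Ω)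
    (Y : YoungMeasure n V Ω) (hYfr : Y.conc (frontier Ω) = 0) (hAfree : Y.AFree A k)
    {ρ : Dom n → ℝ} (hρ : IsStdMollifier n ρ) {ε : ℝ} (hε : 0 < ε) :
    ∃ tε > (0:ℝ), ∀ t ∈ Set.Ioc (0:ℝ) tε,
      ∃ φ : Dom n → U, CcSmooth Ω φ ∧ sobNorm l φ < ε ∧
        ∀ (η : Dom n → ℝ) (Φ : V → ℝ), MemH Φ → etaLipUnit Ω η → TLipUnit Φ →
          |(∫ x in Ω, η x * Φ 0) +
            (∫ x, η x * ∫ w, rrec Φ (w : V) ∂(Y.ang x) ∂Y.lamS) -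
            ∫ x in Ω, η x * Φ (Y.mollSingPart ρ t x + opApply B l φ x)| < ε := by
  haveI := ys_fin Y
  set μ := Y.lamS with hμ
  set M := μ.real Set.univ with hM
  have hM0 : 0 ≤ M := measureReal_nonneg
  set v := volume.real Ω with hv
  have hv0 : 0 ≤ v := measureReal_nonneg
  obtain ⟨e, he, heb⟩ : ∃ e : ℝ, 0 < e ∧ e * (2 * v + 2 * M + ε) < ε / 2 := by
    refine ⟨ε / (4 * (2 * v + 2 * M + ε)), by positivity, ?_⟩
    rw [div_mul_eq_mul_div, div_lt_div_iff₀ (by positivity) (by norm_num)]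
    have : 0 < ε * (2 * v + 2 * M + ε) := by positivity
    nlinarith
  obtain ⟨S, hS, hS1, hS2⟩ := tnet (V := V) he
  haveI := hS.fintype
  obtain ⟨tε, htε, hmain⟩ := core (B := B) (l := l) hn hspan hexact hΩo hΩb Y hYfr hAfree hρ
    (Ψ := fun o : Option S => o.elim (fun z => ‖z‖) fun s => s.1) (Ψi := fun o : Option S => o.elim (fun z => ‖z‖) fun s => rrec s.1)
    (by
      rintro (_ | s) x y
      · have h1 := abs_norm_sub_norm_le x y
        have h2 := norm_nonneg (x - y)
        show |‖x‖ - ‖y‖| ≤ 3 * ‖x - y‖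
        linarith
      · exact tlip3 (hS1 _ s.2).2 x y)
    (by
      rintro (_ | s) w
      · refine tendsto_const_nhds.congr' ?_
        filter_upwards [eventually_gt_atTop (0:ℝ)] with t ht
        show ‖w‖ = ‖t • w‖ / t
        rw [norm_smul, Real.norm_eq_abs, abs_of_pos ht]; field_simp
      · exact rrec_lim (hS1 _ s.2).1 w) (half_pos hε)
  refine ⟨tε, htε, fun t ht => ?_⟩
  obtain ⟨φ, hφ1, hφ2, hφ3⟩ := hmain t ht
  refine ⟨φ, hφ1, by linarith, fun η Φ hΦ hη hT => ?_⟩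
  obtain ⟨η', hη1, hη2, hηe⟩ := etaU hΩb hη
  obtain ⟨Ψ, hΨS, hΨ1, hΨ2⟩ := hS2 Φ hΦ hT
  have hK := mk_moll hρ ht.1
  have hBc : Continuous (opApply B l φ) := op_cont B hφ1.1
  have hzi : Integrable Y.barAng μ := Integrable.of_bound (bar_m Y).aestronglyMeasurable 1 (by
    filter_upwards [ys_prob Y] with x hx using bar_le _)
  have hmc : Continuous (Y.mollSingPart ρ t) := mk_cont hK hzi
  set g : Dom n → V := fun x => Y.mollSingPart ρ t x + opApply B l φ x with hg
  have hgc : Continuous g := hmc.add hBc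
  have hηc : Continuous η' := lip_cont (L := 1) (by simpa using hη1)
  have hΦc := lip_cont (tlip3 hT)
  have hΨc := lip_cont (tlip3 (hS1 Ψ hΨS).2)
  have N : ∫ x in Ω, ‖g x‖ ≤ M + ε / 2 := by
    have h1 := hφ3 (fun _ => 1) (by simp) (by simp) none
    have h2 : ∫ x, (1:ℝ) * ∫ w, ‖(w : V)‖ ∂(Y.ang x) ∂μ = M := by
      rw [hM, ← smul_eq_mul (μ.real Set.univ) 1 |>.trans (mul_one _), ← integral_const]
      refine integral_congr_ae ?_
      filter_upwards [ys_prob Y] with x hx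
      simp
    simp only [Option.elim, norm_zero, mul_zero, integral_zero, zero_add] at h1
    rw [h2] at h1
    simp only [one_mul] at h1
    linarith [(abs_le.1 h1).1]
  have T0 := hφ3 η' hη1 hη2 (some ⟨Ψ, hΨS⟩)
  simp only [Option.elim] at T0
  have E1 : ∫ x in Ω, η x * Φ 0 = ∫ x in Ω, η' x * Φ 0 :=
    setIntegral_congr_fun hΩo.measurableSet fun x hx => by simp only [hηe x hx]
  have E3 : ∫ x in Ω, η x * Φ (g x) = ∫ x in Ω, η' x * Φ (g x) :=
    setIntegral_congr_fun hΩo.measurableSet fun x hx => by simp only [hηe x hx]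
  have E2 : ∫ x, η x * ∫ w, rrec Φ (w : V) ∂(Y.ang x) ∂μ = ∫ x, η' x * ∫ w, rrec Φ (w : V) ∂(Y.ang x) ∂μ := by
    refine integral_congr_ae ?_
    have h0 : ∀ᵐ x ∂μ, x ∈ Ω := ys_null Y hΩo hYfr
    filter_upwards [h0] with x hx
    rw [hηe x hx]
  have D1 : |(∫ x in Ω, η' x * Φ 0) - ∫ x in Ω, η' x * Ψ 0| ≤ e * v := by
    rw [← integral_sub (bdd_int hΩb (show Continuous fun x => η' x * Φ 0 from hηc.mul continuous_const))
      (bdd_int hΩb (show Continuous fun x => η' x * Ψ 0 from hηc.mul continuous_const))]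
    rw [← Real.norm_eq_abs]
    refine norm_setIntegral_le_of_norm_le_const (μ := volume) hΩb.measure_lt_top fun x _ => ?_
    rw [← mul_sub, Real.norm_eq_abs, abs_mul]
    refine (mul_le_of_le_one_left (abs_nonneg _) (hη2 x)).trans ?_
    simpa using hΨ1 0
  have D3 : |(∫ x in Ω, η' x * Φ (g x)) - ∫ x in Ω, η' x * Ψ (g x)| ≤ e * (v + (M + ε / 2)) := by
    rw [← integral_sub (bdd_int hΩb (show Continuous fun x => η' x * Φ (g x) from hηc.mul (hΦc.comp hgc)))
      (bdd_int hΩb (show Continuous fun x => η' x * Ψ (g x) from hηc.mul (hΨc.comp hgc))), ← Real.norm_eq_abs]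
    have h1 : ‖∫ x in Ω, (η' x * Φ (g x) - η' x * Ψ (g x))‖ ≤ ∫ x in Ω, e * (1 + ‖g x‖) := by
      refine norm_integral_le_of_norm_le (bdd_int hΩb (continuous_const.mul (continuous_const.add hgc.norm)))
        (Eventually.of_forall fun x => ?_)
      rw [← mul_sub, Real.norm_eq_abs, abs_mul]
      exact (mul_le_of_le_one_left (abs_nonneg _) (hη2 x)).trans (hΨ1 _)
    rw [integral_const_mul, integral_add (bdd_int hΩb continuous_const) (bdd_int hΩb hgc.norm), setIntegral_const, smul_eq_mul, mul_one] at h1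
    exact h1.trans (mul_le_mul_of_nonneg_left (by linarith) he.le)
  have D2 : |(∫ x, η' x * ∫ w, rrec Φ (w : V) ∂(Y.ang x) ∂μ) - ∫ x, η' x * ∫ w, rrec Ψ (w : V) ∂(Y.ang x) ∂μ| ≤ e * M := by
    have hmul : ∀ {f : Dom n → ℝ}, Integrable f μ → Integrable (fun y => η' y * f y) μ := fun hf =>
      hf.bdd_mul (c := 1) hηc.aestronglyMeasurable (Eventually.of_forall fun p => hη2 _)
    rw [← integral_sub (hmul (rec_int Y hΦ hT)) (hmul (rec_int Y (hS1 Ψ hΨS).1 (hS1 Ψ hΨS).2))]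
    rw [← Real.norm_eq_abs]
    refine norm_integral_le_of_norm_le_const ?_
    filter_upwards [ys_prob Y] with x hx
    rw [← mul_sub, Real.norm_eq_abs, abs_mul]
    refine (mul_le_of_le_one_left (abs_nonneg _) (hη2 x)).trans ?_
    rw [← integral_sub (sph_int _ (lip_cont (lim_lip (tlip3 hT) (rrec_lim hΦ))))
      (sph_int _ (lip_cont (lim_lip (tlip3 (hS1 Ψ hΨS).2) (rrec_lim (hS1 Ψ hΨS).1))))]
    have := norm_integral_le_of_norm_le_const (μ := Y.ang x) (f := fun w : Metric.sphere (0:V) 1 => rrec Φ (w : V) - rrec Ψ (w : V)) (C := e)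
      (Eventually.of_forall fun w => hΨ2 _ (by simp))
    simpa using this
  rw [E1, E2, E3]
  rw [abs_le] at T0 D1 D2 D3
  rw [abs_lt]
  have hee : 0 < e * ε := mul_pos he hε
  constructor <;> nlinarith
end fin
end
/-! ## Statement 5: generation of the singular part (Lemma singgen) -/
theorem stmt5 {n k l : ℕ} (hn : 0 < n) (hk : 0 < k) (hl : 0 < l)
    {V W U : Type*} [NormedAddCommGroup V] [InnerProductSpace ℝ V] [FiniteDimensional ℝ V]
    [MeasurableSpace V] [BorelSpace V]
    [NormedAddCommGroup W] [InnerProductSpace ℝ W] [FiniteDimensional ℝ W]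
    [NormedAddCommGroup U] [InnerProductSpace ℝ U] [FiniteDimensional ℝ U]
    (A : (Fin n → ℕ) → (V →L[ℝ] W)) (B : (Fin n → ℕ) → (U →L[ℝ] V))
    (hspan : SpanningCone A k) (hexact : ExactPotential A k B l)
    (Ω : Set (Dom n)) (hΩo : IsOpen Ω) (hΩb : Bornology.IsBounded Ω)
    (hΩfr : volume (frontier Ω) = 0)
    (Y : YoungMeasure n V Ω) (hYfr : Y.conc (frontier Ω) = 0)
    (hAfree : Y.AFree A k) (hJen : Y.JensenAE A k)
    (ρ : Dom n → ℝ) (hρ : IsStdMollifier n ρ)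
    (ε : ℝ) (hε : 0 < ε) :
    ∃ tε > (0:ℝ), ∀ t ∈ Set.Ioc (0:ℝ) tε,
      ∃ φ : Dom n → U, CcSmooth Ω φ ∧ sobNorm l φ < ε ∧
        ∀ (η : Dom n → ℝ) (Φ : V → ℝ), MemH Φ → etaLipUnit Ω η → TLipUnit Φ →
          |(∫ x in Ω, η x * Φ 0) +
            (∫ x, η x * ∫ w, rrec Φ (w : V) ∂(Y.ang x) ∂Y.lamS) -
            ∫ x in Ω, η x * Φ (Y.mollSingPart ρ t x + opApply B l φ x)| < ε := by exact final hn hspan hexact hΩo hΩb Y hYfr hAfree hρ hε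
end
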